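/- arXiv:1910.04110 — 2 statements merged into one kernel-verified Lean document; each statement's English description precedes it below -/
import Mathlib

section
/- The operators T_a and T_b map SLF(H) into itself, and on SLF(H) they satisfy: (i) T_aT_bT_a = T_bT_aT_b; (ii) (T_aT_b)³(ψ) = (μ^l(v^{-1})/μ^l(v))·(ψ ∘ S) for every ψ ∈ SLF(H); (iii) (T_aT_b)⁶ = (μ^l(v^{-1})/μ^l(v))²·id on SLF(H). Consequently the assignment τ_a ↦ T_a|_{SLF(H)}, τ_b ↦ T_b|_{SLF(H)} defines a projective representation of SL₂(ℤ) = ⟨τ_a, τ_b | τ_aτ_bτ_a = τ_bτ_aτ_b, (τ_aτ_b)⁶ = 1⟩ on SLF(H); if moreover ψ ∘ S = ψ for all ψ ∈ SLF(H), it defines a projective representation of PSL₂(ℤ) = ⟨τ_a, τ_b | τ_aτ_bτ_a = τ_bτ_aτ_b, (τ_aτ_b)³ = 1⟩. -/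
/- STATEMENT 6: `T_a, T_b` preserve `SLF(H)`; on `SLF(H)` they satisfy the braid relation,
`(T_aT_b)³ = (μˡ(v⁻¹)/μˡ(v))·(· ∘ S)` and `(T_aT_b)⁶ = (μˡ(v⁻¹)/μˡ(v))²·id`; hence a
projective `SL₂(ℤ)`-representation on `SLF(H)` (a `PSL₂(ℤ)`-one if `S` fixes `SLF(H)`). -/

noncomputable section

open scoped TensorProduct
open TensorProduct

/-- Symmetric linear forms on `H`. -/
def IsSLF {H : Type} [Ring H] [Algebra ℂ H] (φ : Module.Dual ℂ H) : Prop :=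
  ∀ x y : H, φ (x * y) = φ (y * x)

/-- The convolution product on the dual of a Hopf algebra: `(φψ)(x) = φ(x')ψ(x'')`. -/
def conv {H : Type} [Ring H] [HopfAlgebra ℂ H] (φ ψ : Module.Dual ℂ H) :
    Module.Dual ℂ H :=
  LinearMap.mul' ℂ ℂ ∘ₗ TensorProduct.map φ ψ ∘ₗ (Coalgebra.comul (R := ℂ) (A := H))

/-- The operator `T_a(φ) = φ(v⁻¹ ?)`. -/
def Ta {H : Type} [Ring H] [Algebra ℂ H] (vinv : H) (φ : Module.Dual ℂ H) :
    Module.Dual ℂ H :=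
  φ ∘ₗ LinearMap.mulLeft ℂ vinv

/-- The operator `T_b(φ) = μˡ(v)⁻¹·[μˡ(g⁻¹v ?)·φ(v ?)](v⁻¹ ?)`. -/
def Tb {H : Type} [Ring H] [HopfAlgebra ℂ H] (μl : Module.Dual ℂ H)
    (v vinv gi : H) (φ : Module.Dual ℂ H) : Module.Dual ℂ H :=
  (μl v)⁻¹ • ((conv (μl ∘ₗ LinearMap.mulLeft ℂ (gi * v))
      (φ ∘ₗ LinearMap.mulLeft ℂ v)) ∘ₗ LinearMap.mulLeft ℂ vinv)

namespace RibbonHopf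

open Coalgebra Bialgebra HopfAlgebra

variable {H : Type} [Ring H] [HopfAlgebra ℂ H]

/-- The antipode of `H`. -/
local notation "S" => HopfAlgebra.antipode ℂ (A := H)

/-- The coproduct of `H`. -/
local notation "Δ" => Coalgebra.comul (R := ℂ) (A := H)

/-- The slice map `x ⊗ y ↦ β(y) x`. -/
def sliceRight (β : Module.Dual ℂ H) : H ⊗[ℂ] H →ₗ[ℂ] H :=
  (TensorProduct.rid ℂ H).toLinearMap ∘ₗ LinearMap.lTensor H β

/-- The slice map `x ⊗ y ↦ α(x) y`. -/
def sliceLeft (α : Module.Dual ℂ H) : H ⊗[ℂ] H →ₗ[ℂ] H :=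
  (TensorProduct.lid ℂ H).toLinearMap ∘ₗ LinearMap.rTensor H α

/-- The functional `x ⊗ y ↦ φ(x) ψ(y)`. -/
def dualPair (φ ψ : Module.Dual ℂ H) : H ⊗[ℂ] H →ₗ[ℂ] ℂ :=
  LinearMap.mul' ℂ ℂ ∘ₗ TensorProduct.map φ ψ

@[simp] lemma sliceRight_tmul (β : Module.Dual ℂ H) (x y : H) :
    sliceRight β (x ⊗ₜ y) = β y • x := by
  simp [sliceRight]

@[simp] lemma sliceLeft_tmul (α : Module.Dual ℂ H) (x y : H) :
    sliceLeft α (x ⊗ₜ y) = α x • y := by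
  simp [sliceLeft]

@[simp] lemma dualPair_tmul (φ ψ : Module.Dual ℂ H) (x y : H) :
    dualPair φ ψ (x ⊗ₜ y) = φ x * ψ y := by
  simp [dualPair]

lemma conv_apply (φ ψ : Module.Dual ℂ H) (x : H) : conv φ ψ x = dualPair φ ψ (Δ x) := rfl

lemma sliceRight_tmul_mul (β : Module.Dual ℂ H) (a b : H) (t : H ⊗[ℂ] H) :
    sliceRight β ((a ⊗ₜ b) * t) = a * sliceRight (β ∘ₗ LinearMap.mulLeft ℂ b) t := by
  induction t using TensorProduct.induction_on with
  | zero => simp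
  | tmul x y => simp
  | add t u ht hu => simp only [mul_add, map_add, ht, hu]

lemma sliceRight_mul_tmul (β : Module.Dual ℂ H) (a b : H) (t : H ⊗[ℂ] H) :
    sliceRight β (t * (a ⊗ₜ b)) = sliceRight (β ∘ₗ LinearMap.mulRight ℂ b) t * a := by
  induction t using TensorProduct.induction_on with
  | zero => simp
  | tmul x y => simp
  | add t u ht hu => simp only [add_mul, map_add, ht, hu]

lemma dualPair_eq_sliceRight (φ ψ : Module.Dual ℂ H) (t : H ⊗[ℂ] H) :
    dualPair φ ψ t = φ (sliceRight ψ t) := by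
  induction t using TensorProduct.induction_on with
  | zero => simp
  | tmul x y => simp [mul_comm]
  | add t u ht hu => simp only [map_add, ht, hu]

lemma dualPair_eq_sliceLeft (φ ψ : Module.Dual ℂ H) (t : H ⊗[ℂ] H) :
    dualPair φ ψ t = ψ (sliceLeft φ t) := by
  induction t using TensorProduct.induction_on with
  | zero => simp
  | tmul x y => simp
  | add t u ht hu => simp only [map_add, ht, hu]

lemma dualPair_tmul_mul (φ ψ : Module.Dual ℂ H) (a b : H) (t : H ⊗[ℂ] H) :
    dualPair φ ψ ((a ⊗ₜ b) * t) =
      dualPair (φ ∘ₗ LinearMap.mulLeft ℂ a) (ψ ∘ₗ LinearMap.mulLeft ℂ b) t := by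
  induction t using TensorProduct.induction_on with
  | zero => simp
  | tmul x y => simp
  | add t u ht hu => simp only [mul_add, map_add, ht, hu]

lemma tmul_comm_of_central {z z' : H} (hz : ∀ x, z * x = x * z) (hz' : ∀ x, z' * x = x * z')
    (t : H ⊗[ℂ] H) : (z ⊗ₜ[ℂ] z') * t = t * (z ⊗ₜ z') := by
  induction t using TensorProduct.induction_on with
  | zero => simp
  | tmul a b => simp [hz, hz']
  | add s t hs ht => simp only [mul_add, add_mul, hs, ht]

lemma conv_assoc (φ ψ χ : Module.Dual ℂ H) : conv (conv φ ψ) χ = conv φ (conv ψ χ) :=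
  congrArg WithConv.ofConv (mul_assoc (WithConv.toConv φ) (WithConv.toConv ψ) (WithConv.toConv χ))

lemma counit_conv (φ : Module.Dual ℂ H) : conv (Coalgebra.counit (R := ℂ) (A := H)) φ = φ :=
  congrArg WithConv.ofConv (one_mul (WithConv.toConv φ))

lemma conv_counit (φ : Module.Dual ℂ H) : conv φ (Coalgebra.counit (R := ℂ) (A := H)) = φ :=
  congrArg WithConv.ofConv (mul_one (WithConv.toConv φ))

/-- `x' μ(y x'') = S(y') μ(y'' x)` for a left integral `μ`. -/
lemma leftIntegral_mul (μ : Module.Dual ℂ H) (hμ : ∀ x, sliceRight μ (Δ x) = μ x • (1 : H))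
    (x y : H) :
    sliceRight (μ ∘ₗ LinearMap.mulLeft ℂ y) (Δ x) =
      S (sliceRight (μ ∘ₗ LinearMap.mulRight ℂ x) (Δ y)) := by
  let G : H ⊗[ℂ] (H ⊗[ℂ] H) →ₗ[ℂ] H :=
    TensorProduct.lift ((LinearMap.mul ℂ H).compl₁₂ S
      (sliceRight μ ∘ₗ LinearMap.mulRight ℂ (Δ x)))
  have hG : ∀ a t, G (a ⊗ₜ t) = S a * sliceRight μ (t * Δ x) := fun a t => by simp [G]
  have key := congrArg G (Coalgebra.coassoc_apply (R := ℂ) y)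
  have h₁ : ∀ t : H ⊗[ℂ] H, G (LinearMap.lTensor H Δ t) =
      S (sliceRight (μ ∘ₗ LinearMap.mulRight ℂ x) t) := fun t => by
    induction t using TensorProduct.induction_on with
    | zero => simp
    | tmul a b => simp [hG, ← Bialgebra.comul_mul, hμ]
    | add t u ht hu => simp only [map_add, ht, hu]
  have h₂ : ∀ (b : H) (t : H ⊗[ℂ] H), G (TensorProduct.assoc ℂ H H H (t ⊗ₜ b)) =
      LinearMap.mul' ℂ H (LinearMap.rTensor H S t) * sliceRight μ ((1 ⊗ₜ b) * Δ x) :=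
      fun b t => by
    induction t using TensorProduct.induction_on with
    | zero => simp
    | tmul a c => simp [hG, sliceRight_tmul_mul, mul_assoc]
    | add t u ht hu => simp only [TensorProduct.add_tmul, map_add, ht, hu, add_mul]
  have h₃ : ∀ t : H ⊗[ℂ] H, G (TensorProduct.assoc ℂ H H H (LinearMap.rTensor H Δ t)) =
      sliceRight μ ((1 ⊗ₜ sliceLeft (Coalgebra.counit (R := ℂ)) t) * Δ x) := fun t => by
    induction t using TensorProduct.induction_on with
    | zero => simp
    | tmul a b => simp [h₂, Algebra.algebraMap_eq_smul_one]
    | add t u ht hu =>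
      simp only [map_add, ht, hu, TensorProduct.tmul_add, add_mul]
  have h₄ : sliceLeft (Coalgebra.counit (R := ℂ)) (Δ y) = y := by
    simp [sliceLeft]
  rw [← h₁, ← key, h₃, h₄, sliceRight_tmul_mul, one_mul]

variable (H) in
/-- A factorizable ribbon Hopf algebra with invertible antipode and a left integral `μ`;
`w` is the inverse of the ribbon element `v` and `gi` that of the pivotal element `g`. -/
structure RibbonData where
  Sinv : H →ₗ[ℂ] H
  Sinv_antipode : ∀ x, Sinv (S x) = x
  antipode_Sinv : ∀ x, S (Sinv x) = x
  ι : Type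
  [fintype : Fintype ι]
  a : ι → H
  b : ι → H
  isUnit_R : IsUnit (∑ i, a i ⊗ₜ[ℂ] b i : H ⊗[ℂ] H)
  R_comul : ∀ x, (∑ i, a i ⊗ₜ[ℂ] b i) * Δ x =
    TensorProduct.comm ℂ H H (Δ x) * ∑ i, a i ⊗ₜ[ℂ] b i
  comul_R : ∑ i, Δ (a i) ⊗ₜ[ℂ] b i = ∑ i, ∑ j, (a i ⊗ₜ[ℂ] a j) ⊗ₜ[ℂ] (b i * b j)
  R_comul_right : ∑ i, a i ⊗ₜ[ℂ] Δ (b i) = ∑ i, ∑ j, (a i * a j) ⊗ₜ[ℂ] (b j ⊗ₜ[ℂ] b i)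
  v : H
  w : H
  v_mul_w : v * w = 1
  w_mul_v : w * v = 1
  v_comm : ∀ x, v * x = x * v
  antipode_v : S v = v
  counit_v : Coalgebra.counit (R := ℂ) v = 1
  comul_v : (∑ i, b i ⊗ₜ[ℂ] a i) * ((∑ i, a i ⊗ₜ[ℂ] b i) * Δ v) = v ⊗ₜ[ℂ] v
  injective_drinfeld : Function.Injective fun β : Module.Dual ℂ H =>
    ∑ i, ∑ j, β (a i * b j) • (b i * a j)
  g : H
  gi : H
  g_eq : g = (∑ i, S (b i) * a i) * w
  g_mul_gi : g * gi = 1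
  gi_mul_g : gi * g = 1
  comul_g : Δ g = g ⊗ₜ[ℂ] g
  antipode_antipode_mul_g : ∀ x, S (S x) * g = g * x
  μ : Module.Dual ℂ H
  sliceRight_μ : ∀ x, sliceRight μ (Δ x) = μ x • (1 : H)
  μ_v : μ v ≠ 0
  μ_w : μ w ≠ 0

namespace RibbonData

attribute [instance] RibbonData.fintype

lemma map_antipode_mul (s t : H ⊗[ℂ] H) :
    TensorProduct.map S S (s * t) = TensorProduct.map S S t * TensorProduct.map S S s := by
  induction s using TensorProduct.induction_on with
  | zero => simp
  | add s s' hs hs' => simp only [add_mul, mul_add, map_add, hs, hs']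
  | tmul x y =>
    induction t using TensorProduct.induction_on with
    | zero => simp
    | add t t' ht ht' => simp only [add_mul, mul_add, map_add, ht, ht']
    | tmul x' y' => simp [HopfAlgebra.antipode_mul_antidistrib]

lemma comm_mul (s t : H ⊗[ℂ] H) :
    TensorProduct.comm ℂ H H (s * t) = TensorProduct.comm ℂ H H s * TensorProduct.comm ℂ H H t :=
  map_mul (Algebra.TensorProduct.comm ℂ H H) s t

variable (D : RibbonData H)

/-- The universal R-matrix. -/
def R : H ⊗[ℂ] H := ∑ i, D.a i ⊗ₜ D.b i

/-- The flipped R-matrix. -/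
def R' : H ⊗[ℂ] H := ∑ i, D.b i ⊗ₜ D.a i

/-- The inverse of the R-matrix. -/
def Ri : H ⊗[ℂ] H := ∑ i, S (D.a i) ⊗ₜ D.b i

/-- The inverse of the flipped R-matrix. -/
def Ri' : H ⊗[ℂ] H := ∑ i, D.b i ⊗ₜ S (D.a i)

/-- The monodromy matrix. -/
def M : H ⊗[ℂ] H := D.R' * D.R

/-- The inverse of the monodromy matrix. -/
def P : H ⊗[ℂ] H := D.Ri * D.Ri'

lemma comm_R : TensorProduct.comm ℂ H H D.R = D.R' := by simp [R, R']

lemma comm_R' : TensorProduct.comm ℂ H H D.R' = D.R := by simp [R, R']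

lemma comm_Ri : TensorProduct.comm ℂ H H D.Ri = D.Ri' := by simp [Ri, Ri']

lemma antipode_injective (D : RibbonData H) : Function.Injective S :=
  Function.LeftInverse.injective D.Sinv_antipode

lemma sliceLeft_counit_R : ∑ i, Coalgebra.counit (R := ℂ) (D.a i) • D.b i = 1 := by
  have hu : IsUnit (∑ i, Coalgebra.counit (R := ℂ) (D.a i) • D.b i) := by
    have := D.isUnit_R.map ((Algebra.TensorProduct.lid ℂ H).toAlgHom.comp
      (Algebra.TensorProduct.map (Bialgebra.counitAlgHom ℂ H) (AlgHom.id ℂ H)))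
    simpa using this
  have h := congrArg ((sliceLeft (Coalgebra.counit (R := ℂ) (A := H))) ∘ₗ
    LinearMap.rTensor H (sliceLeft (Coalgebra.counit (R := ℂ) (A := H)))) D.comul_R
  have hε : ∀ x : H, sliceLeft (Coalgebra.counit (R := ℂ)) (Δ x) = x := fun x => by
    simp [sliceLeft]
  simp only [map_sum, LinearMap.comp_apply, LinearMap.rTensor_tmul, hε, sliceLeft_tmul] at h
  refine hu.mul_left_cancel ?_
  rw [mul_one, Finset.sum_mul_sum, h]
  simp [smul_smul, mul_comm]

lemma sliceRight_counit_R : ∑ i, Coalgebra.counit (R := ℂ) (D.b i) • D.a i = 1 := by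
  have hu : IsUnit (∑ i, Coalgebra.counit (R := ℂ) (D.b i) • D.a i) := by
    have := D.isUnit_R.map ((Algebra.TensorProduct.rid ℂ ℂ H).toAlgHom.comp
      (Algebra.TensorProduct.map (AlgHom.id ℂ H) (Bialgebra.counitAlgHom ℂ H)))
    simpa using this
  have h := congrArg ((sliceRight (Coalgebra.counit (R := ℂ) (A := H))) ∘ₗ
    LinearMap.lTensor H (sliceLeft (Coalgebra.counit (R := ℂ) (A := H)))) D.R_comul_right
  have hε : ∀ x : H, sliceLeft (Coalgebra.counit (R := ℂ)) (Δ x) = x := fun x => by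
    simp [sliceLeft]
  simp only [map_sum, LinearMap.comp_apply, LinearMap.lTensor_tmul, hε, sliceLeft_tmul,
    sliceRight_tmul] at h
  refine hu.mul_left_cancel ?_
  rw [mul_one, Finset.sum_mul_sum, h]
  simp [smul_smul, mul_comm]

lemma Ri_mul_R : D.Ri * D.R = 1 := by
  have h := congrArg (LinearMap.rTensor H (LinearMap.mul' ℂ H ∘ₗ LinearMap.rTensor H S)) D.comul_R
  simp only [map_sum, LinearMap.rTensor_tmul, LinearMap.comp_apply,
    HopfAlgebra.mul_antipode_rTensor_comul_apply, LinearMap.mul'_apply] at h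
  rw [Ri, R, Finset.sum_mul_sum]
  simp only [Algebra.TensorProduct.tmul_mul_tmul, ← h, Algebra.algebraMap_eq_smul_one,
    TensorProduct.smul_tmul]
  rw [← TensorProduct.tmul_sum, D.sliceLeft_counit_R, Algebra.TensorProduct.one_def]

lemma sum_mul_tmul_antipode_mul : ∑ i, ∑ j, (D.a i * D.a j) ⊗ₜ[ℂ] (S (D.b j) * D.b i) = 1 := by
  have h := congrArg (LinearMap.lTensor H (LinearMap.mul' ℂ H ∘ₗ LinearMap.rTensor H S))
    D.R_comul_right
  simp only [map_sum, LinearMap.rTensor_tmul, LinearMap.lTensor_tmul, LinearMap.comp_apply,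
    HopfAlgebra.mul_antipode_rTensor_comul_apply, LinearMap.mul'_apply] at h
  simp only [← h, Algebra.algebraMap_eq_smul_one, ← TensorProduct.smul_tmul]
  rw [← TensorProduct.sum_tmul, D.sliceRight_counit_R, Algebra.TensorProduct.one_def]

lemma sum_mul_tmul_mul_antipode :
    ∑ i, ∑ j, (D.a i * D.a j) ⊗ₜ[ℂ] (D.b j * S (D.b i)) = 1 := by
  have h := congrArg (LinearMap.lTensor H (LinearMap.mul' ℂ H ∘ₗ LinearMap.lTensor H S))
    D.R_comul_right
  simp only [map_sum, LinearMap.lTensor_tmul, LinearMap.comp_apply,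
    HopfAlgebra.mul_antipode_lTensor_comul_apply, LinearMap.mul'_apply] at h
  simp only [← h, Algebra.algebraMap_eq_smul_one, ← TensorProduct.smul_tmul]
  rw [← TensorProduct.sum_tmul, D.sliceRight_counit_R, Algebra.TensorProduct.one_def]

lemma R_mul_Ri : D.R * D.Ri = 1 := by
  obtain ⟨r, hr⟩ := D.isUnit_R
  have : D.R = r := hr.symm
  have h := D.Ri_mul_R
  rw [this] at h ⊢
  rw [← Units.inv_eq_of_mul_eq_one_left h, Units.mul_inv]

lemma Ri'_mul_R' : D.Ri' * D.R' = 1 := by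
  rw [← comm_R, ← comm_Ri, ← comm_mul, Ri_mul_R]; rfl

lemma R'_mul_Ri' : D.R' * D.Ri' = 1 := by
  rw [← comm_R, ← comm_Ri, ← comm_mul, R_mul_Ri]; rfl

lemma M_mul_P : D.M * D.P = 1 := by
  rw [M, P, mul_assoc, ← mul_assoc D.R, R_mul_Ri, one_mul, R'_mul_Ri']

lemma P_mul_M : D.P * D.M = 1 := by
  rw [M, P, mul_assoc, ← mul_assoc D.Ri', Ri'_mul_R', one_mul, Ri_mul_R]

lemma Sinv_mul (x y : H) : D.Sinv (x * y) = D.Sinv y * D.Sinv x := by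
  apply D.antipode_injective
  rw [HopfAlgebra.antipode_mul_antidistrib, D.antipode_Sinv, D.antipode_Sinv, D.antipode_Sinv]

lemma lTensor_Sinv_R : LinearMap.lTensor H D.Sinv D.R = D.Ri := by
  have h := congrArg (LinearMap.lTensor H D.Sinv) D.sum_mul_tmul_antipode_mul
  have h1 : D.Sinv 1 = 1 := by simpa using D.Sinv_antipode 1
  simp only [map_sum, LinearMap.lTensor_tmul, Sinv_mul, D.Sinv_antipode,
    Algebra.TensorProduct.one_def, h1] at h
  have h2 : LinearMap.lTensor H D.Sinv D.R * D.R = 1 := by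
    simpa [R, Finset.sum_mul_sum, Algebra.TensorProduct.one_def] using h
  exact left_inv_eq_right_inv h2 D.R_mul_Ri

lemma map_antipode_R : TensorProduct.map S S D.R = D.R := by
  have h := congrArg (LinearMap.lTensor H S) D.lTensor_Sinv_R
  simpa [R, Ri, D.antipode_Sinv] using h.symm

lemma map_antipode_R' : TensorProduct.map S S D.R' = D.R' := by
  have h := congrArg (TensorProduct.comm ℂ H H) D.map_antipode_R
  simpa [R, R'] using h

lemma map_antipode_M : TensorProduct.map S S D.M = TensorProduct.comm ℂ H H D.M := by
  rw [M, map_antipode_mul, map_antipode_R, map_antipode_R', comm_mul, comm_R, comm_R']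

/-! The ribbon and pivotal elements -/

lemma w_comm (x : H) : D.w * x = x * D.w := by
  calc D.w * x = D.w * (x * D.v) * D.w := by rw [mul_assoc, mul_assoc, D.v_mul_w, mul_one]
    _ = x * D.w := by rw [← D.v_comm, ← mul_assoc, D.w_mul_v, one_mul]

lemma antipode_w : S D.w = D.w := by
  have h : S D.w * D.v = 1 := by
    have h := congrArg S D.v_mul_w
    rwa [HopfAlgebra.antipode_mul_antidistrib, D.antipode_v, HopfAlgebra.antipode_one] at h
  exact left_inv_eq_right_inv h D.v_mul_w

lemma comul_v' : Δ D.v = D.P * (D.v ⊗ₜ D.v) := by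
  have h : D.R' * (D.R * Δ D.v) = D.v ⊗ₜ D.v := D.comul_v
  rw [← h, ← mul_assoc D.R', ← M, ← mul_assoc, P_mul_M, one_mul]

lemma comul_w : Δ D.w = D.M * (D.w ⊗ₜ D.w) := by
  have h : (D.M * (D.w ⊗ₜ D.w)) * Δ D.v = 1 := by
    rw [comul_v', mul_assoc, ← mul_assoc (D.w ⊗ₜ[ℂ] D.w), tmul_comm_of_central D.w_comm D.w_comm,
      mul_assoc, ← mul_assoc, M_mul_P]
    simp [D.w_mul_v, Algebra.TensorProduct.one_def]
  refine (left_inv_eq_right_inv h ?_).symm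
  rw [← Bialgebra.comul_mul, D.v_mul_w, Bialgebra.comul_one]

lemma counit_w : Coalgebra.counit (R := ℂ) D.w = 1 := by
  have := congrArg (Coalgebra.counit (R := ℂ)) D.v_mul_w
  simpa [D.counit_v] using this

lemma M_mul_comul (x : H) : D.M * Δ x = Δ x * D.M := by
  have h : D.R * Δ x = TensorProduct.comm ℂ H H (Δ x) * D.R := D.R_comul x
  have h' := congrArg (TensorProduct.comm ℂ H H) h
  have hcc : ∀ t : H ⊗[ℂ] H, TensorProduct.comm ℂ H H (TensorProduct.comm ℂ H H t) = t :=
    fun t => (TensorProduct.comm ℂ H H).symm_apply_apply t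
  rw [comm_mul, comm_mul, comm_R, hcc] at h'
  rw [M, mul_assoc, h, ← mul_assoc, h', mul_assoc]

lemma counit_g : Coalgebra.counit (R := ℂ) D.g = 1 := by
  have h : sliceLeft (Coalgebra.counit (R := ℂ) (A := H)) (Δ D.g) = D.g := by simp [sliceLeft]
  rw [D.comul_g, sliceLeft_tmul] at h
  have := congrArg (fun x => Coalgebra.counit (R := ℂ) (x * D.gi)) h
  simpa [D.g_mul_gi] using this

lemma antipode_g : S D.g = D.gi := by
  have h := HopfAlgebra.mul_antipode_rTensor_comul_apply (R := ℂ) D.g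
  rw [D.comul_g] at h
  simp only [LinearMap.rTensor_tmul, LinearMap.mul'_apply, D.counit_g, map_one] at h
  exact left_inv_eq_right_inv h D.g_mul_gi

lemma antipode_gi : S D.gi = D.g := by
  have h : S D.gi * S D.g = 1 := by
    rw [← HopfAlgebra.antipode_mul_antidistrib, D.g_mul_gi, HopfAlgebra.antipode_one]
  rw [antipode_g] at h
  exact left_inv_eq_right_inv h D.gi_mul_g

lemma comul_gi : Δ D.gi = D.gi ⊗ₜ D.gi := by
  have h : Δ D.gi * (D.g ⊗ₜ D.g) = 1 := by
    rw [← D.comul_g, ← Bialgebra.comul_mul, D.gi_mul_g, Bialgebra.comul_one]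
  refine left_inv_eq_right_inv h ?_
  simp [D.g_mul_gi, Algebra.TensorProduct.one_def]

lemma antipode_antipode (x : H) : S (S x) = D.g * x * D.gi := by
  rw [← D.antipode_antipode_mul_g, mul_assoc, D.g_mul_gi, mul_one]

lemma sum_antipode_mul : ∑ i, S (D.b i) * D.a i = D.g * D.v := by
  rw [D.g_eq, mul_assoc, D.w_mul_v, mul_one]

lemma sum_mul_antipode : ∑ i, D.a i * S (D.b i) = D.gi * D.v := by
  have h := congrArg (fun t => LinearMap.mul' ℂ H (LinearMap.lTensor H S t)) D.map_antipode_R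
  have h' := congrArg S D.sum_antipode_mul
  simp only [R, map_sum, TensorProduct.map_tmul, LinearMap.lTensor_tmul, LinearMap.mul'_apply,
    HopfAlgebra.antipode_mul_antidistrib, antipode_g, D.antipode_v] at h h'
  rw [← h, h', D.v_comm]

lemma sum_antipode_mul_g_mul : ∑ i, S (D.a i) * D.g * D.b i = D.v := by
  have h := congrArg (fun t => LinearMap.mul' ℂ H
    (TensorProduct.map (LinearMap.mulRight ℂ D.g ∘ₗ S) LinearMap.id t)) D.map_antipode_R
  simp only [R, map_sum, TensorProduct.map_tmul, LinearMap.mul'_apply, LinearMap.comp_apply,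
    LinearMap.mulRight_apply, LinearMap.id_apply, D.antipode_antipode_mul_g] at h
  rw [← h]
  simp only [mul_assoc, ← Finset.mul_sum]
  rw [sum_mul_antipode, ← mul_assoc, D.g_mul_gi, one_mul]

lemma sum_mul_antipode_antipode : ∑ i, D.b i * S (S (D.a i)) = D.gi * D.w := by
  have h := congrArg (fun t => LinearMap.mul' ℂ H (TensorProduct.comm ℂ H H t))
    D.sum_mul_tmul_mul_antipode
  simp only [map_sum, TensorProduct.comm_tmul, LinearMap.mul'_apply,
    Algebra.TensorProduct.one_def, mul_one] at h
  have h' : (∑ i, D.b i * S (S (D.a i))) * (D.g * D.v) = 1 := by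
    rw [← h, Finset.sum_comm, Finset.sum_mul]
    refine Finset.sum_congr rfl fun j _ => ?_
    rw [mul_assoc, ← mul_assoc (S _), D.antipode_antipode_mul_g, mul_assoc D.g, ← D.v_comm,
      ← mul_assoc D.g, ← sum_antipode_mul, Finset.sum_mul, Finset.mul_sum]
    simp only [mul_assoc]
  refine left_inv_eq_right_inv h' ?_
  rw [mul_assoc, ← mul_assoc D.v, D.v_comm, mul_assoc D.gi, D.v_mul_w, mul_one, D.g_mul_gi]

lemma sum_antipode_mul_g_mul_antipode : ∑ i, S (D.b i) * D.g * S (D.a i) = D.w := by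
  have h := congrArg (fun t => LinearMap.mul' ℂ H
    (TensorProduct.map (LinearMap.mulRight ℂ D.g ∘ₗ S) S t)) D.map_antipode_R'
  simp only [R', map_sum, TensorProduct.map_tmul, LinearMap.mul'_apply, LinearMap.comp_apply,
    LinearMap.mulRight_apply, D.antipode_antipode_mul_g] at h
  rw [← h]
  simp only [mul_assoc, ← Finset.mul_sum]
  rw [sum_mul_antipode_antipode, ← mul_assoc, D.g_mul_gi, one_mul]

end RibbonData

/-- `x' Φ(x'') = c x` determines `Φ` for `c` central. -/
lemma eq_counit_smul_of_conv (Φ : H →ₗ[ℂ] H) (c : H) (hc : ∀ x, c * x = x * c)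
    (h : ∀ x, LinearMap.mul' ℂ H (LinearMap.lTensor H Φ (Δ x)) = c * x) (x : H) :
    Φ x = Coalgebra.counit (R := ℂ) x • c := by
  have h₁ : WithConv.toConv (LinearMap.id : H →ₗ[ℂ] H) * WithConv.toConv Φ =
      WithConv.toConv (LinearMap.mulLeft ℂ c) := by
    ext y
    simpa [LinearMap.convMul_apply, LinearMap.lTensor] using h y
  have h₂ : WithConv.toConv Φ =
      WithConv.toConv (S) * WithConv.toConv (LinearMap.mulLeft ℂ c) := by
    rw [← h₁, ← mul_assoc, LinearMap.antipode_mul_id, one_mul]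
  have h₃ := congrArg (fun f => f.ofConv x) h₂
  simp only [LinearMap.convMul_apply] at h₃
  have h₄ : ∀ t : H ⊗[ℂ] H, LinearMap.mul' ℂ H (TensorProduct.map S (LinearMap.mulLeft ℂ c) t) =
      c * LinearMap.mul' ℂ H (LinearMap.rTensor H S t) := fun t => by
    induction t using TensorProduct.induction_on with
    | zero => simp
    | tmul a b => simp [← mul_assoc, hc]
    | add s t hs ht => simp only [map_add, mul_add, hs, ht]
  rw [h₃]
  erw [h₄]
  rw [HopfAlgebra.mul_antipode_rTensor_comul_apply, Algebra.algebraMap_eq_smul_one]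
  simp

lemma coassoc_apply_eq {V : Type} [AddCommGroup V] [Module ℂ V]
    (f : (H ⊗[ℂ] H) ⊗[ℂ] H →ₗ[ℂ] V) (f' : H ⊗[ℂ] (H ⊗[ℂ] H) →ₗ[ℂ] V)
    (h : ∀ s t y, f ((s ⊗ₜ t) ⊗ₜ y) = f' (s ⊗ₜ (t ⊗ₜ y))) (x : H) :
    f (LinearMap.rTensor H Δ (Δ x)) = f' (LinearMap.lTensor H Δ (Δ x)) := by
  have hf : f = f' ∘ₗ (TensorProduct.assoc ℂ H H H).toLinearMap :=
    TensorProduct.ext_threefold fun s t y => by simp [h]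
  rw [hf, ← Coalgebra.coassoc_apply]
  rfl

namespace RibbonData

variable (D : RibbonData H)

lemma sliceRight_M_injective : Function.Injective fun β => sliceRight β D.M := by
  intro β γ h
  apply D.injective_drinfeld
  simpa [M, R, R', Finset.sum_mul_sum] using h

/-- The functional `μ(w ·)`. -/
def μw : Module.Dual ℂ H := D.μ ∘ₗ LinearMap.mulLeft ℂ D.w

/-- The functional `μ(v ·)`. -/
def μv : Module.Dual ℂ H := D.μ ∘ₗ LinearMap.mulLeft ℂ D.v

lemma sliceRight_μw_M : sliceRight D.μw D.M = D.μ D.w • D.v := by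
  have h := D.sliceRight_μ D.w
  rw [comul_w, sliceRight_mul_tmul] at h
  have h' : D.μ ∘ₗ LinearMap.mulRight ℂ D.w = D.μw := by
    ext x; simp [μw, D.w_comm]
  rw [h'] at h
  calc sliceRight D.μw D.M = sliceRight D.μw D.M * D.w * D.v := by
        rw [mul_assoc, D.w_mul_v, mul_one]
    _ = _ := by rw [h]; simp

lemma sliceRight_μv_P : sliceRight D.μv D.P = D.μ D.v • D.w := by
  have h := D.sliceRight_μ D.v
  rw [comul_v', sliceRight_mul_tmul] at h
  have h' : D.μ ∘ₗ LinearMap.mulRight ℂ D.v = D.μv := by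
    ext x; simp [μv, D.v_comm]
  rw [h'] at h
  calc sliceRight D.μv D.P = sliceRight D.μv D.P * D.v * D.w := by
        rw [mul_assoc, D.v_mul_w, mul_one]
    _ = _ := by rw [h]; simp

/-- The bilinear map `(s, t) ↦ β(s · S(t))`. -/
def sandwich (β : Module.Dual ℂ H) : H ⊗[ℂ] H →ₗ[ℂ] Module.Dual ℂ H :=
  TensorProduct.lift (LinearMap.mk₂ ℂ
    (fun s t => β ∘ₗ LinearMap.mulLeft ℂ s ∘ₗ LinearMap.mulRight ℂ (S t))
    (fun _ _ _ => by ext; simp [add_mul]) (fun _ _ _ => by ext; simp)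
    (fun _ _ _ => by ext; simp [mul_add]) (fun _ _ _ => by ext; simp))

@[simp] lemma sandwich_tmul (β : Module.Dual ℂ H) (s t y : H) :
    sandwich β (s ⊗ₜ t) y = β (s * (y * S t)) := by
  simp [sandwich]

/-- Evaluation of functionals on the second leg of the monodromy. -/
def drinfeld : Module.Dual ℂ H →ₗ[ℂ] H where
  toFun β := sliceRight β D.M
  map_add' β γ := by simp [sliceRight, LinearMap.lTensor_add]
  map_smul' c β := by simp [sliceRight, LinearMap.lTensor_smul]

lemma drinfeld_apply (β : Module.Dual ℂ H) : D.drinfeld β = sliceRight β D.M := rfl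

lemma drinfeld_sandwich_tmul (β : Module.Dual ℂ H) (s t : H) :
    D.drinfeld (sandwich β (s ⊗ₜ t)) = sliceRight β ((1 ⊗ₜ s) * (D.M * (1 ⊗ₜ S t))) := by
  rw [sliceRight_tmul_mul, sliceRight_mul_tmul, one_mul, mul_one, drinfeld_apply]
  congr 1

lemma sandwich_μw_comul (x : H) :
    sandwich D.μw (Δ x) = Coalgebra.counit (R := ℂ) x • D.μw := by
  let Φ : H →ₗ[ℂ] H := D.drinfeld ∘ₗ sandwich D.μw ∘ₗ Δ
  -- `x ⊗ y ⊗ z ↦ (μw-slice of (x ⊗ y) M (1 ⊗ S z))`, and the same with `M` in front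
  let f (N N' : H ⊗[ℂ] H) : (H ⊗[ℂ] H) ⊗[ℂ] H →ₗ[ℂ] H :=
    sliceRight D.μw ∘ₗ TensorProduct.lift
      ((LinearMap.mul ℂ (H ⊗[ℂ] H)).compl₁₂
        (LinearMap.mulLeft ℂ N ∘ₗ LinearMap.mulRight ℂ N') (TensorProduct.mk ℂ H H 1 ∘ₗ S))
  have hf : ∀ N N' t z, f N N' (t ⊗ₜ z) = sliceRight D.μw (N * (t * N') * (1 ⊗ₜ S z)) :=
    fun N N' t z => by simp [f]
  let f₁ : H ⊗[ℂ] (H ⊗[ℂ] H) →ₗ[ℂ] H :=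
    LinearMap.mul' ℂ H ∘ₗ LinearMap.lTensor H (D.drinfeld ∘ₗ sandwich D.μw)
  let f₂ : H ⊗[ℂ] (H ⊗[ℂ] H) →ₗ[ℂ] H := sliceRight D.μw ∘ₗ LinearMap.mulLeft ℂ D.M ∘ₗ
    LinearMap.lTensor H (LinearMap.mul' ℂ H ∘ₗ LinearMap.lTensor H S)
  have key : ∀ x, LinearMap.mul' ℂ H (LinearMap.lTensor H Φ (Δ x)) = (D.μ D.w • D.v) * x := by
    intro x
    calc LinearMap.mul' ℂ H (LinearMap.lTensor H Φ (Δ x))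
        = f₁ (LinearMap.lTensor H Δ (Δ x)) := by
          simp only [f₁, Φ, LinearMap.comp_apply, LinearMap.lTensor_comp]
      _ = f 1 D.M (LinearMap.rTensor H Δ (Δ x)) := by
          refine (coassoc_apply_eq _ _ (fun s t y => ?_) x).symm
          rw [hf, one_mul]
          simp only [f₁, LinearMap.comp_apply, LinearMap.lTensor_tmul, LinearMap.mul'_apply]
          rw [drinfeld_sandwich_tmul, mul_assoc, sliceRight_tmul_mul _ s t,
            sliceRight_tmul_mul _ 1 t, one_mul]
      _ = f D.M 1 (LinearMap.rTensor H Δ (Δ x)) := by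
          rw [← LinearMap.comp_apply, ← LinearMap.comp_apply (f D.M 1)]
          congr 1
          refine TensorProduct.ext' fun y z => ?_
          simp only [LinearMap.comp_apply, LinearMap.rTensor_tmul, hf, one_mul, mul_one,
            M_mul_comul]
      _ = f₂ (LinearMap.lTensor H Δ (Δ x)) := by
          refine coassoc_apply_eq _ _ (fun s t y => ?_) x
          rw [hf, mul_one]
          simp [f₂, mul_assoc]
      _ = (D.μ D.w • D.v) * x := by
          have : f₂ ∘ₗ LinearMap.lTensor H Δ = LinearMap.mulLeft ℂ (D.μ D.w • D.v) ∘ₗ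
              sliceRight (Coalgebra.counit (R := ℂ)) := by
            refine TensorProduct.ext' fun y z => ?_
            simp only [f₂, LinearMap.comp_apply, LinearMap.lTensor_tmul,
              HopfAlgebra.mul_antipode_lTensor_comul_apply, LinearMap.mulLeft_apply,
              Algebra.algebraMap_eq_smul_one, TensorProduct.tmul_smul, map_smul,
              sliceRight_tmul, ← D.sliceRight_μw_M]
            rw [sliceRight_mul_tmul, LinearMap.mulRight_one, LinearMap.comp_id]
          rw [← LinearMap.comp_apply, this]
          simp [sliceRight]
  apply D.sliceRight_M_injective
  have := eq_counit_smul_of_conv Φ _ (fun x => by simp [D.v_comm]) key x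
  rw [← D.sliceRight_μw_M] at this
  change D.drinfeld _ = D.drinfeld _
  rw [map_smul]
  exact this

lemma μw_mul_comm (x y : H) : D.μw (x * y) = D.μw (y * S (S x)) := by
  let f : (H ⊗[ℂ] H) ⊗[ℂ] H →ₗ[ℂ] ℂ := TensorProduct.lift
    ((sandwich D.μw).compl₂ (LinearMap.mulLeft ℂ y ∘ₗ S ∘ₗ S))
  let f' : H ⊗[ℂ] (H ⊗[ℂ] H) →ₗ[ℂ] ℂ := D.μw ∘ₗ LinearMap.mul' ℂ H ∘ₗ
    LinearMap.lTensor H (LinearMap.mulLeft ℂ y ∘ₗ S ∘ₗ LinearMap.mul' ℂ H ∘ₗ LinearMap.lTensor H S)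
  have h := coassoc_apply_eq f f' (fun s t z => by
    simp [f, f', HopfAlgebra.antipode_mul_antidistrib, mul_assoc]) x
  have h₁ : f ∘ₗ LinearMap.rTensor H Δ =
      D.μw ∘ₗ LinearMap.mulLeft ℂ y ∘ₗ S ∘ₗ S ∘ₗ sliceLeft (Coalgebra.counit (R := ℂ)) := by
    refine TensorProduct.ext' fun s t => ?_
    simp [f, sandwich_μw_comul]
  have h₂ : f' ∘ₗ LinearMap.lTensor H Δ =
      D.μw ∘ₗ LinearMap.mulRight ℂ y ∘ₗ sliceRight (Coalgebra.counit (R := ℂ)) := by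
    refine TensorProduct.ext' fun s t => ?_
    simp [f', Algebra.algebraMap_eq_smul_one]
  rw [← LinearMap.comp_apply, h₁, ← LinearMap.comp_apply f', h₂] at h
  simpa [sliceLeft, sliceRight] using h.symm

lemma μ_mul_comm (x y : H) : D.μ (x * y) = D.μ (y * S (S x)) := by
  have h := D.μw_mul_comm x (D.v * y)
  simp only [μw, LinearMap.comp_apply, LinearMap.mulLeft_apply] at h
  rwa [← mul_assoc x, ← D.v_comm, mul_assoc, mul_assoc, ← mul_assoc, ← mul_assoc D.w, D.w_mul_v,
    one_mul, one_mul] at h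

/-- The symmetric form `μ(g⁻¹ ·)`. -/
def ρ : Module.Dual ℂ H := D.μ ∘ₗ LinearMap.mulLeft ℂ D.gi

lemma ρ_apply (x : H) : D.ρ x = D.μ (D.gi * x) := rfl

lemma isSLF_ρ : IsSLF D.ρ := by
  intro x y
  rw [ρ_apply, ρ_apply, ← mul_assoc, μ_mul_comm, antipode_antipode, ← mul_assoc D.g,
    D.g_mul_gi, one_mul, ← mul_assoc, D.μ_mul_comm D.gi (y * x), antipode_antipode,
    D.g_mul_gi, one_mul]

end RibbonData

lemma isSLF_comp_mulLeft {φ : Module.Dual ℂ H} (hφ : IsSLF φ) {z : H} (hz : ∀ x, z * x = x * z) :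
    IsSLF (φ ∘ₗ LinearMap.mulLeft ℂ z) := by
  intro x y
  simp only [LinearMap.comp_apply, LinearMap.mulLeft_apply]
  rw [← mul_assoc, hφ, ← mul_assoc, ← hz, mul_assoc]

lemma isSLF_smul {φ : Module.Dual ℂ H} (hφ : IsSLF φ) (c : ℂ) : IsSLF (c • φ) := by
  intro x y
  simp only [LinearMap.smul_apply, hφ x y]

/-- The coproduct on the first tensor factor. -/
def comulLeft : H ⊗[ℂ] H →ₐ[ℂ] (H ⊗[ℂ] H) ⊗[ℂ] H :=
  Algebra.TensorProduct.map (comulAlgHom ℂ H) (AlgHom.id ℂ H)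

/-- The coproduct on the second tensor factor. -/
def comulRight : H ⊗[ℂ] H →ₐ[ℂ] H ⊗[ℂ] (H ⊗[ℂ] H) :=
  Algebra.TensorProduct.map (AlgHom.id ℂ H) (comulAlgHom ℂ H)

/-- `x ⊗ y ↦ (x ⊗ 1) ⊗ y`. -/
def left₁₃ : H ⊗[ℂ] H →ₐ[ℂ] (H ⊗[ℂ] H) ⊗[ℂ] H :=
  Algebra.TensorProduct.map Algebra.TensorProduct.includeLeft (AlgHom.id ℂ H)

/-- `x ⊗ y ↦ (1 ⊗ x) ⊗ y`. -/
def left₂₃ : H ⊗[ℂ] H →ₐ[ℂ] (H ⊗[ℂ] H) ⊗[ℂ] H :=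
  Algebra.TensorProduct.map Algebra.TensorProduct.includeRight (AlgHom.id ℂ H)

/-- `x ⊗ y ↦ x ⊗ (y ⊗ 1)`. -/
def right₁₂ : H ⊗[ℂ] H →ₐ[ℂ] H ⊗[ℂ] (H ⊗[ℂ] H) :=
  Algebra.TensorProduct.map (AlgHom.id ℂ H) Algebra.TensorProduct.includeLeft

/-- `x ⊗ y ↦ x ⊗ (1 ⊗ y)`. -/
def right₁₃ : H ⊗[ℂ] H →ₐ[ℂ] H ⊗[ℂ] (H ⊗[ℂ] H) :=
  Algebra.TensorProduct.map (AlgHom.id ℂ H) Algebra.TensorProduct.includeRight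

@[simp] lemma comulLeft_tmul (x y : H) : comulLeft (x ⊗ₜ y) = Δ x ⊗ₜ y := by simp [comulLeft]

@[simp] lemma comulRight_tmul (x y : H) : comulRight (x ⊗ₜ y) = x ⊗ₜ Δ y := by simp [comulRight]

@[simp] lemma left₁₃_tmul (x y : H) : left₁₃ (x ⊗ₜ y) = (x ⊗ₜ 1) ⊗ₜ y := by simp [left₁₃]

@[simp] lemma left₂₃_tmul (x y : H) : left₂₃ (x ⊗ₜ y) = (1 ⊗ₜ x) ⊗ₜ y := by simp [left₂₃]

@[simp] lemma right₁₂_tmul (x y : H) : right₁₂ (x ⊗ₜ y) = x ⊗ₜ (y ⊗ₜ 1) := by simp [right₁₂]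

@[simp] lemma right₁₃_tmul (x y : H) : right₁₃ (x ⊗ₜ y) = x ⊗ₜ (1 ⊗ₜ y) := by simp [right₁₃]

lemma rTensor_sliceLeft_left₂₃_mul (α : Module.Dual ℂ H) (A : H ⊗[ℂ] H)
    (X : (H ⊗[ℂ] H) ⊗[ℂ] H) :
    LinearMap.rTensor H (sliceLeft α) (left₂₃ A * X) = A * LinearMap.rTensor H (sliceLeft α) X := by
  have : LinearMap.rTensor H (sliceLeft α) ∘ₗ LinearMap.mulLeft ℂ (left₂₃ A) =
      LinearMap.mulLeft ℂ A ∘ₗ LinearMap.rTensor H (sliceLeft α) := by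
    refine TensorProduct.ext_threefold fun x y z => ?_
    induction A using TensorProduct.induction_on with
    | zero => simp
    | tmul a b => simp
    | add s t hs ht => simp_all [add_mul]
  exact LinearMap.congr_fun this X

lemma rTensor_sliceLeft_mul_left₂₃ (α : Module.Dual ℂ H) (A : H ⊗[ℂ] H)
    (X : (H ⊗[ℂ] H) ⊗[ℂ] H) :
    LinearMap.rTensor H (sliceLeft α) (X * left₂₃ A) = LinearMap.rTensor H (sliceLeft α) X * A := by
  have : LinearMap.rTensor H (sliceLeft α) ∘ₗ LinearMap.mulRight ℂ (left₂₃ A) =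
      LinearMap.mulRight ℂ A ∘ₗ LinearMap.rTensor H (sliceLeft α) := by
    refine TensorProduct.ext_threefold fun x y z => ?_
    induction A using TensorProduct.induction_on with
    | zero => simp
    | tmul a b => simp
    | add s t hs ht => simp_all [mul_add]
  exact LinearMap.congr_fun this X

lemma lTensor_sliceRight_right₁₂_mul (γ : Module.Dual ℂ H) (A : H ⊗[ℂ] H)
    (X : H ⊗[ℂ] (H ⊗[ℂ] H)) :
    LinearMap.lTensor H (sliceRight γ) (right₁₂ A * X) =
      A * LinearMap.lTensor H (sliceRight γ) X := by
  have : LinearMap.lTensor H (sliceRight γ) ∘ₗ LinearMap.mulLeft ℂ (right₁₂ A) =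
      LinearMap.mulLeft ℂ A ∘ₗ LinearMap.lTensor H (sliceRight γ) := by
    refine TensorProduct.ext_threefold' fun x y z => ?_
    induction A using TensorProduct.induction_on with
    | zero => simp
    | tmul a b => simp
    | add s t hs ht => simp_all [add_mul]
  exact LinearMap.congr_fun this X

lemma lTensor_sliceRight_mul_right₁₂ (γ : Module.Dual ℂ H) (A : H ⊗[ℂ] H)
    (X : H ⊗[ℂ] (H ⊗[ℂ] H)) :
    LinearMap.lTensor H (sliceRight γ) (X * right₁₂ A) =
      LinearMap.lTensor H (sliceRight γ) X * A := by
  have : LinearMap.lTensor H (sliceRight γ) ∘ₗ LinearMap.mulRight ℂ (right₁₂ A) =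
      LinearMap.mulRight ℂ A ∘ₗ LinearMap.lTensor H (sliceRight γ) := by
    refine TensorProduct.ext_threefold' fun x y z => ?_
    induction A using TensorProduct.induction_on with
    | zero => simp
    | tmul a b => simp
    | add s t hs ht => simp_all [mul_add]
  exact LinearMap.congr_fun this X

lemma rTensor_sliceLeft_left₁₃ (α : Module.Dual ℂ H) (N : H ⊗[ℂ] H) :
    LinearMap.rTensor H (sliceLeft α) (left₁₃ N) = 1 ⊗ₜ sliceLeft α N := by
  induction N using TensorProduct.induction_on with
  | zero => simp
  | tmul a b => simp [TensorProduct.smul_tmul]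
  | add s t hs ht => simp_all [TensorProduct.tmul_add]

lemma lTensor_sliceRight_right₁₃ (γ : Module.Dual ℂ H) (N : H ⊗[ℂ] H) :
    LinearMap.lTensor H (sliceRight γ) (right₁₃ N) = sliceRight γ N ⊗ₜ 1 := by
  induction N using TensorProduct.induction_on with
  | zero => simp
  | tmul a b => simp [TensorProduct.smul_tmul]
  | add s t hs ht => simp_all [TensorProduct.add_tmul]

namespace RibbonData

variable (D : RibbonData H)

lemma comulLeft_R : comulLeft D.R = left₁₃ D.R * left₂₃ D.R := by
  have h := D.comul_R
  simpa [R, Finset.sum_mul_sum] using h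

lemma comulLeft_R' : comulLeft D.R' = left₂₃ D.R' * left₁₃ D.R' := by
  have h := congrArg (TensorProduct.comm ℂ H (H ⊗[ℂ] H)) D.R_comul_right
  simpa [R', Finset.sum_mul_sum] using h

lemma comulRight_R : comulRight D.R = right₁₃ D.R * right₁₂ D.R := by
  have h := D.R_comul_right
  simpa [R, Finset.sum_mul_sum] using h

lemma comulRight_R' : comulRight D.R' = right₁₂ D.R' * right₁₃ D.R' := by
  have h := congrArg (TensorProduct.comm ℂ (H ⊗[ℂ] H) H) D.comul_R
  simpa [R', Finset.sum_mul_sum] using h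

lemma comulLeft_M : comulLeft D.M = left₂₃ D.R' * left₁₃ D.M * left₂₃ D.R := by
  simp only [M, map_mul, comulLeft_R, comulLeft_R', mul_assoc]

lemma comulRight_M : comulRight D.M = right₁₂ D.R' * right₁₃ D.M * right₁₂ D.R := by
  simp only [M, map_mul, comulRight_R, comulRight_R', mul_assoc]

lemma comulRight_P : comulRight D.P = right₁₂ D.Ri * right₁₃ D.P * right₁₂ D.Ri' := by
  have h : comulRight D.P * comulRight D.M = 1 := by rw [← map_mul, P_mul_M, map_one]
  refine left_inv_eq_right_inv h ?_
  have h₁ : right₁₂ D.R * right₁₂ D.Ri = 1 := by rw [← map_mul, R_mul_Ri, map_one]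
  have h₂ : right₁₃ D.M * right₁₃ D.P = 1 := by rw [← map_mul, M_mul_P, map_one]
  have h₃ : right₁₂ D.R' * right₁₂ D.Ri' = 1 := by rw [← map_mul, R'_mul_Ri', map_one]
  rw [comulRight_M, mul_assoc, ← mul_assoc (right₁₂ D.R), ← mul_assoc (right₁₂ D.R), h₁, one_mul,
    mul_assoc, ← mul_assoc (right₁₃ D.M), h₂, one_mul, h₃]

/-- The normalized form `μ(v)⁻¹ μ(g⁻¹ v ·)`. -/
def lam : Module.Dual ℂ H := (D.μ D.v)⁻¹ • (D.ρ ∘ₗ LinearMap.mulLeft ℂ D.v)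

/-- The normalized form `μ(v⁻¹)⁻¹ μ(g⁻¹ v⁻¹ ·)`. -/
def lam' : Module.Dual ℂ H := (D.μ D.w)⁻¹ • (D.ρ ∘ₗ LinearMap.mulLeft ℂ D.w)

lemma isSLF_lam : IsSLF D.lam := isSLF_smul (isSLF_comp_mulLeft D.isSLF_ρ D.v_comm) _

lemma isSLF_lam' : IsSLF D.lam' := isSLF_smul (isSLF_comp_mulLeft D.isSLF_ρ D.w_comm) _

lemma lam_comp_mulLeft_g : D.lam ∘ₗ LinearMap.mulLeft ℂ D.g = (D.μ D.v)⁻¹ • D.μv := by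
  ext x
  simp only [lam, μv, LinearMap.comp_apply, LinearMap.smul_apply, LinearMap.mulLeft_apply, ρ_apply]
  rw [← mul_assoc D.v, D.v_comm, mul_assoc, ← mul_assoc, D.gi_mul_g, one_mul]

lemma lam'_comp_mulLeft_g : D.lam' ∘ₗ LinearMap.mulLeft ℂ D.g = (D.μ D.w)⁻¹ • D.μw := by
  ext x
  simp only [lam', μw, LinearMap.comp_apply, LinearMap.smul_apply, LinearMap.mulLeft_apply, ρ_apply]
  rw [← mul_assoc D.w, D.w_comm, mul_assoc, ← mul_assoc, D.gi_mul_g, one_mul]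

lemma sliceRight_lam'_M : sliceRight (D.lam' ∘ₗ LinearMap.mulLeft ℂ D.g) D.M = D.v := by
  rw [lam'_comp_mulLeft_g, ← drinfeld_apply, map_smul, drinfeld_apply, sliceRight_μw_M,
    inv_smul_smul₀ D.μ_w]

lemma μv_mul_comm (x y : H) : D.μv (x * y) = D.μv (y * S (S x)) := by
  simp only [μv, LinearMap.comp_apply, LinearMap.mulLeft_apply]
  rw [← mul_assoc, D.v_comm, mul_assoc, μ_mul_comm, mul_assoc]

lemma antipode_sliceRight_M {β : Module.Dual ℂ H} (hβ : ∀ x y, β (x * y) = β (y * S (S x))) :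
    S (sliceRight β D.M) = sliceRight β D.P := by
  have h (j : D.ι) := congrArg (TensorProduct.lift ((LinearMap.mul ℂ H).compl₁₂
    (LinearMap.id.smulRight (S (D.a j)) ∘ₗ β ∘ₗ LinearMap.mulLeft ℂ (D.b j) ∘ₗ S) LinearMap.id))
    D.map_antipode_R
  simp only [R, map_sum, TensorProduct.map_tmul, TensorProduct.lift.tmul, LinearMap.compl₁₂_apply,
    LinearMap.comp_apply, LinearMap.mulLeft_apply, LinearMap.id_apply, LinearMap.smulRight_apply,
    LinearMap.mul_apply', smul_mul_assoc, ← hβ] at h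
  simp only [M, P, R, R', Ri, Ri', Finset.sum_mul_sum, map_sum, Algebra.TensorProduct.tmul_mul_tmul,
    sliceRight_tmul, map_smul, HopfAlgebra.antipode_mul_antidistrib]
  rw [Finset.sum_comm]
  exact Finset.sum_congr rfl fun j _ => h j

end RibbonData

lemma antipode_sliceLeft_comp (t : H ⊗[ℂ] H) (β : Module.Dual ℂ H) :
    S (sliceLeft (β ∘ₗ S) t) = sliceLeft β (TensorProduct.map S S t) := by
  induction t using TensorProduct.induction_on with
  | zero => simp
  | tmul a b => simp
  | add s t hs ht => simp only [map_add, hs, ht]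

lemma sliceLeft_comm (t : H ⊗[ℂ] H) (β : Module.Dual ℂ H) :
    sliceLeft β (TensorProduct.comm ℂ H H t) = sliceRight β t := by
  induction t using TensorProduct.induction_on with
  | zero => simp
  | tmul a b => simp
  | add s t hs ht => simp only [map_add, hs, ht]

lemma conv_smul_right (φ ψ : Module.Dual ℂ H) (c : ℂ) : conv φ (c • ψ) = c • conv φ ψ := by
  ext x
  simp [conv, TensorProduct.map_smul_right]

lemma conv_smul_left (φ ψ : Module.Dual ℂ H) (c : ℂ) : conv (c • φ) ψ = c • conv φ ψ := by
  ext x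
  simp [conv, TensorProduct.map_smul_left]

lemma conv_add_right (φ ψ ψ' : Module.Dual ℂ H) : conv φ (ψ + ψ') = conv φ ψ + conv φ ψ' := by
  ext x
  simp [conv, TensorProduct.map_add_right]

lemma Ta_apply (z : H) (φ : Module.Dual ℂ H) (x : H) : Ta z φ x = φ (z * x) := rfl

namespace RibbonData

variable (D : RibbonData H)

lemma sliceRight_lam_M : sliceRight (D.lam ∘ₗ LinearMap.mulLeft ℂ D.g) D.M = D.w := by
  have h : sliceRight D.μv D.M = D.μ D.v • D.w := by
    apply D.antipode_injective
    rw [D.antipode_sliceRight_M D.μv_mul_comm, sliceRight_μv_P, map_smul, antipode_w]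
  rw [lam_comp_mulLeft_g, ← drinfeld_apply, map_smul, drinfeld_apply, h, inv_smul_smul₀ D.μ_v]

lemma comp_mulRight_eq {φ : Module.Dual ℂ H} (hφ : IsSLF φ) (y : H) :
    φ ∘ₗ LinearMap.mulRight ℂ y = φ ∘ₗ LinearMap.mulLeft ℂ y := by
  ext x
  exact hφ _ _

lemma sliceLeft_lam_M : sliceLeft (D.lam ∘ₗ LinearMap.mulRight ℂ D.g ∘ₗ S) D.M = D.w := by
  apply D.antipode_injective
  rw [← LinearMap.comp_assoc, antipode_sliceLeft_comp, map_antipode_M, sliceLeft_comm,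
    comp_mulRight_eq D.isSLF_lam, sliceRight_lam_M, antipode_w]

/-- `x' ρ(y x'') = S(y') g ρ(y'' x)`. -/
lemma sliceRight_ρ_comul (x y : H) :
    sliceRight (D.ρ ∘ₗ LinearMap.mulLeft ℂ y) (Δ x) =
      S (sliceRight (D.ρ ∘ₗ LinearMap.mulRight ℂ x) (Δ y)) * D.g := by
  have h := leftIntegral_mul D.μ D.sliceRight_μ x (D.gi * y)
  rw [Bialgebra.comul_mul, comul_gi, sliceRight_tmul_mul, HopfAlgebra.antipode_mul_antidistrib,
    antipode_gi] at h
  convert h using 3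
  · ext z; simp [ρ_apply]
  · congr 2
    ext z; simp [ρ_apply, mul_assoc]

lemma rTensor_sliceLeft_comulLeft_M :
    LinearMap.rTensor H (sliceLeft (D.lam ∘ₗ LinearMap.mulRight ℂ D.g ∘ₗ S)) (comulLeft D.M) =
      D.M * (1 ⊗ₜ D.w) := by
  rw [comulLeft_M, rTensor_sliceLeft_mul_left₂₃, rTensor_sliceLeft_left₂₃_mul,
    rTensor_sliceLeft_left₁₃, sliceLeft_lam_M, mul_assoc,
    tmul_comm_of_central (by simp) D.w_comm, ← mul_assoc, M]

lemma conv_dualPair_ρ (α χ : Module.Dual ℂ H) (t : H ⊗[ℂ] H) (y z : H) :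
    conv α (dualPair D.ρ χ ∘ₗ LinearMap.mulLeft ℂ t ∘ₗ (TensorProduct.mk ℂ H H).flip z) y =
      dualPair D.ρ χ (LinearMap.rTensor H (sliceLeft (α ∘ₗ LinearMap.mulRight ℂ D.g ∘ₗ S))
        (comulLeft t) * (y ⊗ₜ z)) := by
  induction t using TensorProduct.induction_on with
  | zero => simp [conv]
  | add s t hs ht =>
    simp only [map_add, add_mul]
    rw [← hs, ← ht, ← LinearMap.add_apply, ← conv_add_right]
    congr 2
    ext; simp [add_mul]
  | tmul m n =>
    have h₁ : dualPair D.ρ χ ∘ₗ LinearMap.mulLeft ℂ (m ⊗ₜ n) ∘ₗ (TensorProduct.mk ℂ H H).flip z =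
        χ (n * z) • (D.ρ ∘ₗ LinearMap.mulLeft ℂ m) := by
      ext; simp [mul_comm]
    rw [h₁, conv_smul_right, LinearMap.smul_apply, conv_apply, dualPair_eq_sliceRight,
      sliceRight_ρ_comul]
    have h₂ := dualPair_eq_sliceRight (α ∘ₗ LinearMap.mulRight ℂ D.g ∘ₗ S)
      (D.ρ ∘ₗ LinearMap.mulRight ℂ y) (Δ m)
    rw [dualPair_eq_sliceLeft] at h₂
    simp only [LinearMap.comp_apply, LinearMap.mulRight_apply] at h₂
    rw [← h₂]
    simp [mul_comm]

/-- Left convolution by `μ(v)⁻¹ μ(g⁻¹ v ·)`. -/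
def L (φ : Module.Dual ℂ H) : Module.Dual ℂ H := conv D.lam φ

/-- Left convolution by `μ(v⁻¹)⁻¹ μ(g⁻¹ v⁻¹ ·)`. -/
def L' (φ : Module.Dual ℂ H) : Module.Dual ℂ H := conv D.lam' φ

lemma conv_comp_mulLeft_w (φ χ : Module.Dual ℂ H) (x : H) :
    conv φ χ (D.w * x) = dualPair (φ ∘ₗ LinearMap.mulLeft ℂ D.w) (χ ∘ₗ LinearMap.mulLeft ℂ D.w)
      (D.M * Δ x) := by
  rw [← dualPair_tmul_mul, conv_apply, Bialgebra.comul_mul, comul_w, ← mul_assoc,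
    tmul_comm_of_central D.w_comm D.w_comm]

lemma conv_comp_mulLeft_v (φ χ : Module.Dual ℂ H) (x : H) :
    conv φ χ (D.v * x) = dualPair (φ ∘ₗ LinearMap.mulLeft ℂ D.v) (χ ∘ₗ LinearMap.mulLeft ℂ D.v)
      (D.P * Δ x) := by
  rw [← dualPair_tmul_mul, conv_apply, Bialgebra.comul_mul, comul_v', ← mul_assoc,
    tmul_comm_of_central D.v_comm D.v_comm]

lemma lam_comp_mulLeft_w : D.lam ∘ₗ LinearMap.mulLeft ℂ D.w = (D.μ D.v)⁻¹ • D.ρ := by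
  ext x
  simp only [lam, LinearMap.comp_apply, LinearMap.smul_apply, LinearMap.mulLeft_apply]
  rw [← mul_assoc, D.v_mul_w, one_mul]

lemma lam'_comp_mulLeft_v : D.lam' ∘ₗ LinearMap.mulLeft ℂ D.v = (D.μ D.w)⁻¹ • D.ρ := by
  ext x
  simp only [lam', LinearMap.comp_apply, LinearMap.smul_apply, LinearMap.mulLeft_apply]
  rw [← mul_assoc, D.w_mul_v, one_mul]

lemma dualPair_smul_left (c : ℂ) (φ ψ : Module.Dual ℂ H) (t : H ⊗[ℂ] H) :
    dualPair (c • φ) ψ t = c * dualPair φ ψ t := by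
  simp [dualPair, TensorProduct.map_smul_left]

lemma dualPair_smul_right (c : ℂ) (φ ψ : Module.Dual ℂ H) (t : H ⊗[ℂ] H) :
    dualPair φ (c • ψ) t = c * dualPair φ ψ t := by
  simp [dualPair, TensorProduct.map_smul_right]

/-- The braid relation between `L` and `T_a`. -/
lemma L_Ta_L (φ : Module.Dual ℂ H) :
    D.L (Ta D.w (D.L φ)) = Ta D.w (D.L (Ta D.w φ)) := by
  have h₁ : Ta D.w (D.L φ) = (D.μ D.v)⁻¹ •
      (dualPair D.ρ (Ta D.w φ) ∘ₗ LinearMap.mulLeft ℂ D.M ∘ₗ Δ) := by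
    ext x
    rw [Ta_apply, L, conv_comp_mulLeft_w,
      lam_comp_mulLeft_w, dualPair_smul_left]
    rfl
  let f : H ⊗[ℂ] (H ⊗[ℂ] H) →ₗ[ℂ] ℂ := LinearMap.mul' ℂ ℂ ∘ₗ
    TensorProduct.map D.lam (dualPair D.ρ (Ta D.w φ) ∘ₗ LinearMap.mulLeft ℂ D.M)
  have hf : ∀ x, D.L (dualPair D.ρ (Ta D.w φ) ∘ₗ LinearMap.mulLeft ℂ D.M ∘ₗ Δ) x =
      f (LinearMap.lTensor H Δ (Δ x)) := fun x => by
    have : dualPair D.lam (dualPair D.ρ (Ta D.w φ) ∘ₗ LinearMap.mulLeft ℂ D.M ∘ₗ Δ) =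
        f ∘ₗ LinearMap.lTensor H Δ := TensorProduct.ext' fun a b => by simp [f]
    rw [L, conv_apply, this]
    rfl
  have hf' : (f ∘ₗ (TensorProduct.assoc ℂ H H H).toLinearMap) ∘ₗ LinearMap.rTensor H Δ =
      dualPair D.ρ (Ta D.w φ) ∘ₗ LinearMap.mulLeft ℂ (D.M * (1 ⊗ₜ D.w)) := by
    refine TensorProduct.ext' fun y z => ?_
    have h := D.conv_dualPair_ρ D.lam (Ta D.w φ) D.M y z
    rw [rTensor_sliceLeft_comulLeft_M] at h
    simp only [LinearMap.comp_apply, LinearMap.mulLeft_apply, LinearMap.rTensor_tmul]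
    rw [← h, conv_apply]
    generalize Δ y = t
    induction t using TensorProduct.induction_on with
    | zero => simp
    | tmul a b => simp [f]
    | add s t hs ht => simp only [TensorProduct.add_tmul, map_add, hs, ht]
  ext x
  have h₂ := LinearMap.congr_fun hf' (Δ x)
  rw [LinearMap.comp_apply,
    coassoc_apply_eq _ f (fun a b c => by simp) x, ← hf] at h₂
  rw [h₁, L, conv_smul_right]
  rw [L] at h₂
  rw [LinearMap.smul_apply, h₂, Ta_apply, L, conv_comp_mulLeft_w, lam_comp_mulLeft_w,
    dualPair_smul_left, LinearMap.comp_apply, LinearMap.mulLeft_apply,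
    ← tmul_comm_of_central (by simp) D.w_comm, mul_assoc,
    dualPair_tmul_mul, LinearMap.mulLeft_one, LinearMap.comp_id]
  rfl

end RibbonData

lemma dualPair_comm_tmul (φ ψ : Module.Dual ℂ H) (t : H ⊗[ℂ] H) :
    dualPair φ ψ (TensorProduct.comm ℂ H H t) = dualPair ψ φ t := by
  induction t using TensorProduct.induction_on with
  | zero => simp
  | tmul a b => simp [mul_comm]
  | add s t hs ht => simp only [map_add, hs, ht]

lemma dualPair_mul_comm {φ ψ : Module.Dual ℂ H} (hφ : IsSLF φ) (hψ : IsSLF ψ) (s t : H ⊗[ℂ] H) :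
    dualPair φ ψ (s * t) = dualPair φ ψ (t * s) := by
  induction s using TensorProduct.induction_on with
  | zero => simp
  | add s s' hs hs' => simp only [add_mul, mul_add, map_add, hs, hs']
  | tmul x y =>
    induction t using TensorProduct.induction_on with
    | zero => simp
    | add t t' ht ht' => simp only [add_mul, mul_add, map_add, ht, ht']
    | tmul x' y' => simp [hφ x, hψ y]

lemma isSLF_conv {φ ψ : Module.Dual ℂ H} (hφ : IsSLF φ) (hψ : IsSLF ψ) : IsSLF (conv φ ψ) := by
  intro x y
  rw [conv_apply, conv_apply, Bialgebra.comul_mul, Bialgebra.comul_mul, dualPair_mul_comm hφ hψ]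

lemma antipode_sliceRight_comp (t : H ⊗[ℂ] H) (β : Module.Dual ℂ H) :
    S (sliceRight (β ∘ₗ S) t) = sliceRight β (TensorProduct.map S S t) := by
  induction t using TensorProduct.induction_on with
  | zero => simp
  | tmul a b => simp
  | add s t hs ht => simp only [map_add, hs, ht]

lemma sliceRight_comm (t : H ⊗[ℂ] H) (β : Module.Dual ℂ H) :
    sliceRight β (TensorProduct.comm ℂ H H t) = sliceLeft β t := by
  induction t using TensorProduct.induction_on with
  | zero => simp
  | tmul a b => simp
  | add s t hs ht => simp only [map_add, hs, ht]

lemma sliceRight_comp_comul (φ ψ : Module.Dual ℂ H) (t : H ⊗[ℂ] H) :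
    sliceRight (dualPair φ ψ ∘ₗ Δ) t =
      sliceRight φ (LinearMap.lTensor H (sliceRight ψ) (comulRight t)) := by
  induction t using TensorProduct.induction_on with
  | zero => simp
  | tmul a b => simp [dualPair_eq_sliceRight]
  | add s t hs ht => simp only [map_add, hs, ht]

namespace RibbonData

variable (D : RibbonData H)

lemma conv_comm (D : RibbonData H) {φ ψ : Module.Dual ℂ H} (hφ : IsSLF φ) (hψ : IsSLF ψ) :
    conv φ ψ = conv ψ φ := by
  ext x
  have h : TensorProduct.comm ℂ H H (Δ x) = D.R * Δ x * D.Ri := by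
    have h' : D.R * Δ x = TensorProduct.comm ℂ H H (Δ x) * D.R := D.R_comul x
    rw [h', mul_assoc, R_mul_Ri, mul_one]
  rw [conv_apply, conv_apply, ← dualPair_comm_tmul φ ψ, h, mul_assoc, dualPair_mul_comm hφ hψ,
    mul_assoc, Ri_mul_R, mul_one]

/-- The functional `φ(x S(y) g) z` on `x ⊗ (y ⊗ z)`. -/
def contract (φ : Module.Dual ℂ H) : H ⊗[ℂ] (H ⊗[ℂ] H) →ₗ[ℂ] H :=
  (TensorProduct.lid ℂ H).toLinearMap ∘ₗ LinearMap.rTensor H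
    (φ ∘ₗ LinearMap.mulRight ℂ D.g ∘ₗ LinearMap.mul' ℂ H ∘ₗ LinearMap.lTensor H S) ∘ₗ
    (TensorProduct.assoc ℂ H H H).symm.toLinearMap

@[simp] lemma contract_tmul (φ : Module.Dual ℂ H) (x y z : H) :
    D.contract φ (x ⊗ₜ (y ⊗ₜ z)) = φ (x * S y * D.g) • z := by
  simp [contract]

/-- The map `x ⊗ y ↦ S(y) g x`. -/
def innerTwist : H ⊗[ℂ] H →ₗ[ℂ] H :=
  LinearMap.mul' ℂ H ∘ₗ LinearMap.rTensor H (LinearMap.mulRight ℂ D.g ∘ₗ S) ∘ₗ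
    (TensorProduct.comm ℂ H H).toLinearMap

@[simp] lemma innerTwist_tmul (x y : H) : D.innerTwist (x ⊗ₜ y) = S y * D.g * x := by
  simp [innerTwist]

lemma contract_right {φ : Module.Dual ℂ H} (hφ : IsSLF φ) (A N B : H ⊗[ℂ] H) :
    D.contract φ (right₁₂ A * right₁₃ N * right₁₂ B) =
      sliceLeft (φ ∘ₗ LinearMap.mulLeft ℂ (D.innerTwist A) ∘ₗ
        LinearMap.mulRight ℂ (LinearMap.mul' ℂ H (LinearMap.lTensor H S B))) N := by
  induction N using TensorProduct.induction_on with
  | zero => simp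
  | add s t hs ht => simp only [map_add, mul_add, add_mul, hs, ht]
  | tmul n m =>
    simp only [sliceLeft_tmul, LinearMap.comp_apply, LinearMap.mulLeft_apply,
      LinearMap.mulRight_apply]
    induction A using TensorProduct.induction_on with
    | zero => simp
    | add s t hs ht => simp only [map_add, add_mul, add_smul, hs, ht]
    | tmul a a' =>
      induction B using TensorProduct.induction_on with
      | zero => simp
      | add s t hs ht => simp only [map_add, mul_add, add_smul, hs, ht]
      | tmul b b' =>
        simp only [right₁₂_tmul, right₁₃_tmul, Algebra.TensorProduct.tmul_mul_tmul, one_mul,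
          mul_one,
          contract_tmul, HopfAlgebra.antipode_mul_antidistrib, innerTwist_tmul,
          LinearMap.lTensor_tmul, LinearMap.mul'_apply]
        have h := hφ (a * (n * (b * S b'))) (S a' * D.g)
        simp only [mul_assoc] at h ⊢
        rw [h]

lemma dualPair_ρ_mul_comul (φ : Module.Dual ℂ H) (N : H ⊗[ℂ] H) (x : H) :
    dualPair φ D.ρ (N * Δ x) = D.ρ (D.contract φ (comulRight N) * x) := by
  induction N using TensorProduct.induction_on with
  | zero => simp
  | add s t hs ht => simp only [map_add, add_mul, hs, ht]
  | tmul n m =>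
    rw [dualPair_eq_sliceRight, sliceRight_tmul_mul, sliceRight_ρ_comul, comulRight_tmul]
    generalize Δ m = t
    induction t using TensorProduct.induction_on with
    | zero => simp
    | add s t hs ht => simp only [map_add, TensorProduct.tmul_add, add_mul, mul_add, hs, ht]
    | tmul b c => simp [mul_comm, mul_assoc]

lemma innerTwist_R' : D.innerTwist D.R' = D.v := by
  simp [R', sum_antipode_mul_g_mul]

lemma innerTwist_Ri : D.innerTwist D.Ri = D.w := by
  simp [Ri, sum_antipode_mul_g_mul_antipode]

lemma mul_antipode_R : LinearMap.mul' ℂ H (LinearMap.lTensor H S D.R) = D.gi * D.v := by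
  simp [R, sum_mul_antipode]

lemma mul_antipode_Ri' : LinearMap.mul' ℂ H (LinearMap.lTensor H S D.Ri') = D.gi * D.w := by
  simp [Ri', sum_mul_antipode_antipode]

/-- The operator `T_a L T_a`. -/
def Om (φ : Module.Dual ℂ H) : Module.Dual ℂ H := Ta D.w (D.L (Ta D.w φ))

/-- The operator `T_a⁻¹ L' T_a⁻¹`. -/
def Om' (φ : Module.Dual ℂ H) : Module.Dual ℂ H := Ta D.v (D.L' (Ta D.v φ))

lemma isSLF_Ta_w {φ : Module.Dual ℂ H} (hφ : IsSLF φ) : IsSLF (Ta D.w φ) :=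
  isSLF_comp_mulLeft hφ D.w_comm

lemma isSLF_Ta_v {φ : Module.Dual ℂ H} (hφ : IsSLF φ) : IsSLF (Ta D.v φ) :=
  isSLF_comp_mulLeft hφ D.v_comm

lemma isSLF_L {φ : Module.Dual ℂ H} (hφ : IsSLF φ) : IsSLF (D.L φ) :=
  isSLF_conv D.isSLF_lam hφ

lemma Om_apply {φ : Module.Dual ℂ H} (hφ : IsSLF φ) (x : H) :
    D.Om φ x = (D.μ D.v)⁻¹ *
      D.ρ (sliceLeft (φ ∘ₗ LinearMap.mulRight ℂ D.gi) D.M * x) := by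
  have hw := D.isSLF_Ta_w hφ
  have hww : IsSLF (Ta D.w φ ∘ₗ LinearMap.mulLeft ℂ D.w) := D.isSLF_Ta_w hw
  rw [Om, Ta_apply, L, D.conv_comm D.isSLF_lam hw, conv_comp_mulLeft_w, lam_comp_mulLeft_w,
    dualPair_smul_right, dualPair_ρ_mul_comul, comulRight_M, contract_right _ hww, innerTwist_R',
    mul_antipode_R]
  congr 5
  ext n
  simp only [LinearMap.comp_apply, LinearMap.mulLeft_apply, LinearMap.mulRight_apply, Ta_apply]
  congr 1
  rw [← mul_assoc n, ← D.v_comm (n * D.gi), ← mul_assoc D.w D.v, D.w_mul_v]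
  simp [← mul_assoc, D.w_mul_v]

lemma Om'_apply {φ : Module.Dual ℂ H} (hφ : IsSLF φ) (x : H) :
    D.Om' φ x = (D.μ D.w)⁻¹ *
      D.ρ (sliceLeft (φ ∘ₗ LinearMap.mulRight ℂ D.gi) D.P * x) := by
  have hv := D.isSLF_Ta_v hφ
  have hvv : IsSLF (Ta D.v φ ∘ₗ LinearMap.mulLeft ℂ D.v) := D.isSLF_Ta_v hv
  rw [Om', Ta_apply, L', D.conv_comm D.isSLF_lam' hv, conv_comp_mulLeft_v, lam'_comp_mulLeft_v,
    dualPair_smul_right, dualPair_ρ_mul_comul, comulRight_P, contract_right _ hvv, innerTwist_Ri,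
    mul_antipode_Ri']
  congr 5
  ext n
  simp only [LinearMap.comp_apply, LinearMap.mulLeft_apply, LinearMap.mulRight_apply, Ta_apply]
  congr 1
  rw [← mul_assoc n, ← D.w_comm (n * D.gi), ← mul_assoc D.v D.w, D.v_mul_w]
  simp [← mul_assoc, D.v_mul_w]

lemma sliceRight_counit_M : sliceRight (Coalgebra.counit (R := ℂ) (A := H)) D.M = 1 := by
  have h : D.w = sliceRight (Coalgebra.counit (R := ℂ) (A := H)) D.M * D.w := by
    conv_lhs => rw [← one_mul D.w]
    have h' := congrArg (TensorProduct.rid ℂ H) (Coalgebra.lTensor_counit_comul (R := ℂ) D.w)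
    rw [comul_w] at h'
    change sliceRight _ _ = _ at h'
    rw [sliceRight_mul_tmul] at h'
    convert h'.symm using 2
    · simp
    · congr 2
      ext x
      simp [counit_w]
  calc _ = sliceRight (Coalgebra.counit (R := ℂ) (A := H)) D.M * D.w * D.v := by
        rw [mul_assoc, D.w_mul_v, mul_one]
    _ = 1 := by rw [← h, D.w_mul_v]

lemma conv_lam_lam' : conv D.lam D.lam' = Coalgebra.counit (R := ℂ) (A := H) := by
  have h : conv D.lam D.lam' ∘ₗ LinearMap.mulLeft ℂ D.g =
      Coalgebra.counit (R := ℂ) (A := H) := by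
    apply D.sliceRight_M_injective
    have h' : conv D.lam D.lam' ∘ₗ LinearMap.mulLeft ℂ D.g =
        dualPair (D.lam ∘ₗ LinearMap.mulLeft ℂ D.g) (D.lam' ∘ₗ LinearMap.mulLeft ℂ D.g) ∘ₗ Δ := by
      ext x
      simp only [LinearMap.comp_apply, LinearMap.mulLeft_apply, conv_apply, Bialgebra.comul_mul,
        comul_g]
      rw [dualPair_tmul_mul]
    have hv : D.R' * D.v ⊗ₜ[ℂ] 1 = D.v ⊗ₜ[ℂ] 1 * D.R' :=
      (tmul_comm_of_central D.v_comm (fun x => by simp) _).symm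
    simp only
    rw [h', sliceRight_comp_comul, comulRight_M, lTensor_sliceRight_mul_right₁₂,
      lTensor_sliceRight_right₁₂_mul, lTensor_sliceRight_right₁₃, sliceRight_lam'_M, hv, mul_assoc,
      sliceRight_tmul_mul, sliceRight_counit_M]
    have h₁ : (D.lam ∘ₗ LinearMap.mulLeft ℂ D.g) ∘ₗ LinearMap.mulLeft ℂ 1 =
        D.lam ∘ₗ LinearMap.mulLeft ℂ D.g := by ext; simp
    rw [h₁, ← M, sliceRight_lam_M, D.v_mul_w]
  ext x
  have := LinearMap.congr_fun h (D.gi * x)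
  have hc : Coalgebra.counit (R := ℂ) D.gi = 1 := by
    have := congrArg (Coalgebra.counit (R := ℂ) (A := H)) D.g_mul_gi
    simpa [Bialgebra.counit_mul, counit_g] using this
  simpa [← mul_assoc, D.g_mul_gi, Bialgebra.counit_mul, hc] using this

lemma conv_lam'_lam : conv D.lam' D.lam = Coalgebra.counit (R := ℂ) (A := H) := by
  rw [D.conv_comm D.isSLF_lam' D.isSLF_lam, conv_lam_lam']

lemma eq_zero_of_ρ_mul {y : H} (hy : ∀ x, D.ρ (y * x) = 0) : y = 0 := by
  have h₁ : sliceRight D.lam (Δ y) = 0 := by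
    have h := D.sliceRight_ρ_comul D.v y
    have h₀ : D.ρ ∘ₗ LinearMap.mulLeft ℂ y = 0 := by ext x; exact hy x
    have h₂ : sliceRight (0 : Module.Dual ℂ H) = 0 := by
      simp [sliceRight]
    rw [h₀, h₂, LinearMap.zero_apply, comp_mulRight_eq D.isSLF_ρ] at h
    have h₃ : S (sliceRight (D.ρ ∘ₗ LinearMap.mulLeft ℂ D.v) (Δ y)) = 0 := by
      rw [← mul_one (S _), ← D.g_mul_gi, ← mul_assoc, ← h, zero_mul]
    rw [← map_zero S] at h₃
    have h₄ := D.antipode_injective h₃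
    rw [lam, sliceRight, LinearMap.lTensor_smul, LinearMap.comp_smul, LinearMap.smul_apply]
    rw [sliceRight] at h₄
    rw [h₄, smul_zero]
  rw [← Module.forall_dual_apply_eq_zero_iff ℂ]
  intro φ
  rw [← conv_counit φ, ← conv_lam'_lam D, ← conv_assoc, conv_apply, dualPair_eq_sliceRight, h₁,
    map_zero]

lemma Ta_counit : Ta D.w (Coalgebra.counit (R := ℂ) (A := H)) =
    Coalgebra.counit (R := ℂ) (A := H) := by
  ext x
  simp [Ta_apply, Bialgebra.counit_mul, counit_w]

lemma Om_lam' : D.Om D.lam' = D.lam := by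
  rw [Om, ← L_Ta_L, L, L, conv_lam_lam', Ta_counit, conv_counit]

lemma sliceLeft_lam'_M : sliceLeft (D.lam' ∘ₗ LinearMap.mulRight ℂ D.gi) D.M = D.v := by
  rw [← sub_eq_zero]
  refine D.eq_zero_of_ρ_mul fun x => ?_
  have h := LinearMap.congr_fun D.Om_lam' x
  rw [D.Om_apply D.isSLF_lam', lam, LinearMap.smul_apply, smul_eq_mul] at h
  rw [sub_mul, map_sub, sub_eq_zero]
  exact mul_left_cancel₀ (inv_ne_zero D.μ_v) h

lemma lam'_antipode (x : H) : D.lam' (S x) = D.lam' x := by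
  have h : (D.lam' ∘ₗ LinearMap.mulRight ℂ D.gi) ∘ₗ S = D.lam' ∘ₗ LinearMap.mulLeft ℂ D.g := by
    apply D.sliceRight_M_injective
    apply D.antipode_injective
    simp only
    rw [antipode_sliceRight_comp, map_antipode_M, sliceRight_comm, sliceLeft_lam'_M,
      sliceRight_lam'_M, antipode_v]
  have := LinearMap.congr_fun h (D.gi * x)
  simpa [HopfAlgebra.antipode_mul_antidistrib, antipode_gi, mul_assoc, D.g_mul_gi,
    ← mul_assoc D.g D.gi] using this

lemma ρ_antipode (x : H) : D.ρ (S x) = D.ρ x := by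
  have h (y : H) : D.lam' (D.v * y) = (D.μ D.w)⁻¹ * D.ρ y :=
    LinearMap.congr_fun D.lam'_comp_mulLeft_v y
  have h' := D.lam'_antipode (D.v * x)
  rw [HopfAlgebra.antipode_mul_antidistrib, antipode_v, ← D.v_comm, h, h] at h'
  exact mul_left_cancel₀ (inv_ne_zero D.μ_w) h'

lemma antipode_sliceLeft_M {φ : Module.Dual ℂ H} (hφ : IsSLF φ) :
    S (sliceLeft (φ ∘ₗ LinearMap.mulRight ℂ D.gi) D.M) =
      sliceLeft (φ ∘ₗ LinearMap.mulRight ℂ D.gi) D.P := by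
  have hg (x y : H) : φ (S (S x) * y * D.gi) = φ (y * x * D.gi) := by
    calc φ (S (S x) * y * D.gi) = φ (D.g * (x * (D.gi * y * D.gi))) := by
          simp only [D.antipode_antipode, mul_assoc]
      _ = φ (x * (D.gi * y)) := by
          rw [hφ]
          simp only [mul_assoc, D.gi_mul_g, mul_one]
      _ = φ (y * x * D.gi) := by rw [hφ, mul_assoc, hφ]
  have h (i : D.ι) := congrArg (TensorProduct.lift ((LinearMap.mul ℂ H).compl₁₂
    (LinearMap.toSpanSingleton ℂ H 1 ∘ₗ φ ∘ₗ LinearMap.mulRight ℂ (D.b i * D.gi) ∘ₗ S)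
    (LinearMap.mulRight ℂ (S (D.a i)))))
    D.map_antipode_R
  simp only [R, map_sum, TensorProduct.map_tmul, TensorProduct.lift.tmul, LinearMap.compl₁₂_apply,
    LinearMap.comp_apply, LinearMap.mulRight_apply, LinearMap.toSpanSingleton_apply,
    LinearMap.mul_apply', smul_mul_assoc, one_mul, ← mul_assoc, hg] at h
  simp only [M, P, R, R', Ri, Ri', Finset.sum_mul_sum, map_sum, Algebra.TensorProduct.tmul_mul_tmul,
    sliceLeft_tmul, map_smul, HopfAlgebra.antipode_mul_antidistrib, LinearMap.comp_apply,
    LinearMap.mulRight_apply]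
  conv_rhs => rw [Finset.sum_comm]
  exact Finset.sum_congr rfl fun i _ => h i

lemma Om'_antipode {φ : Module.Dual ℂ H} (hφ : IsSLF φ) (x : H) :
    D.Om' φ (S x) = (D.μ D.w)⁻¹ * D.μ D.v * D.Om φ x := by
  rw [Om'_apply _ hφ, Om_apply _ hφ, ← antipode_sliceLeft_M _ hφ,
    ← HopfAlgebra.antipode_mul_antidistrib, ρ_antipode, D.isSLF_ρ, mul_assoc,
    mul_inv_cancel_left₀ D.μ_v]

lemma Ta_v_Ta_w (φ : Module.Dual ℂ H) : Ta D.v (Ta D.w φ) = φ := by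
  ext x
  simp [Ta_apply, ← mul_assoc, D.w_mul_v]

lemma Ta_w_Ta_v (φ : Module.Dual ℂ H) : Ta D.w (Ta D.v φ) = φ := by
  ext x
  simp [Ta_apply, ← mul_assoc, D.v_mul_w]

lemma Om'_Om (φ : Module.Dual ℂ H) : D.Om' (D.Om φ) = φ := by
  rw [Om', Om, Ta_v_Ta_w, L, L', ← conv_assoc, conv_lam'_lam, counit_conv, Ta_v_Ta_w]

lemma isSLF_Om {φ : Module.Dual ℂ H} (hφ : IsSLF φ) : IsSLF (D.Om φ) :=
  D.isSLF_Ta_w (D.isSLF_L (D.isSLF_Ta_w hφ))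

lemma Om_Om {ψ : Module.Dual ℂ H} (hψ : IsSLF ψ) :
    D.Om (D.Om ψ) = (D.μ D.w / D.μ D.v) • (ψ ∘ₗ S) := by
  ext x
  have h := D.Om'_antipode (D.isSLF_Om hψ) x
  rw [Om'_Om] at h
  rw [LinearMap.smul_apply, LinearMap.comp_apply, h, smul_eq_mul]
  field_simp [D.μ_v, D.μ_w]

lemma Tb_eq (φ : Module.Dual ℂ H) : Tb D.μ D.v D.w D.gi φ = Ta D.w (D.L (Ta D.v φ)) := by
  rw [L, lam, conv_smul_left]
  have h : D.ρ ∘ₗ LinearMap.mulLeft ℂ D.v = D.μ ∘ₗ LinearMap.mulLeft ℂ (D.gi * D.v) := by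
    ext x
    simp [ρ_apply]
  rw [h]
  rfl

lemma isSLF_Tb {φ : Module.Dual ℂ H} (hφ : IsSLF φ) : IsSLF (Tb D.μ D.v D.w D.gi φ) := by
  rw [Tb_eq]
  exact D.isSLF_Ta_w (D.isSLF_L (D.isSLF_Ta_v hφ))

lemma braid : Ta D.w ∘ Tb D.μ D.v D.w D.gi ∘ Ta D.w =
    Tb D.μ D.v D.w D.gi ∘ Ta D.w ∘ Tb D.μ D.v D.w D.gi := by
  funext φ
  simp only [Function.comp_apply, Tb_eq, Ta_v_Ta_w, L_Ta_L, Ta_w_Ta_v]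

lemma Ta_antipode (ψ : Module.Dual ℂ H) : Ta D.w (Ta D.v ψ ∘ₗ S) = ψ ∘ₗ S := by
  ext x
  simp only [Ta_apply, LinearMap.comp_apply, HopfAlgebra.antipode_mul_antidistrib, antipode_w]
  rw [← D.w_comm, ← mul_assoc, D.v_mul_w, one_mul]

lemma iterate_three {ψ : Module.Dual ℂ H} (hψ : IsSLF ψ) :
    (Ta D.w ∘ Tb D.μ D.v D.w D.gi)^[3] ψ = (D.μ D.w / D.μ D.v) • (ψ ∘ₗ S) := by
  have h : (Ta D.w ∘ Tb D.μ D.v D.w D.gi)^[3] ψ = Ta D.w (D.Om (D.Om (Ta D.v ψ))) := by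
    simp only [Function.iterate_succ, Function.iterate_zero, Function.comp_apply, id_eq, Tb_eq,
      Ta_v_Ta_w, Om, L_Ta_L]
  rw [h, Om_Om _ (D.isSLF_Ta_v hψ)]
  exact congrArg (fun χ : Module.Dual ℂ H => (D.μ D.w / D.μ D.v) • χ) (D.Ta_antipode ψ)

lemma isSLF_comp_antipode {ψ : Module.Dual ℂ H} (hψ : IsSLF ψ) : IsSLF (ψ ∘ₗ S) := by
  intro x y
  simp only [LinearMap.comp_apply, HopfAlgebra.antipode_mul_antidistrib]
  exact hψ _ _

lemma iterate_six {ψ : Module.Dual ℂ H} (hψ : IsSLF ψ) :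
    (Ta D.w ∘ Tb D.μ D.v D.w D.gi)^[6] ψ = (D.μ D.w / D.μ D.v) ^ 2 • ψ := by
  rw [show 6 = 3 + 3 from rfl, Function.iterate_add_apply, iterate_three _ hψ,
    iterate_three _ (isSLF_smul (isSLF_comp_antipode hψ) _)]
  ext x
  simp only [LinearMap.smul_apply, LinearMap.comp_apply, smul_smul, sq]
  rw [antipode_antipode, hψ, ← mul_assoc, D.gi_mul_g, one_mul]

end RibbonData

end RibbonHopf

theorem projective_SL2Z_on_SLF
    {H : Type} [Ring H] [HopfAlgebra ℂ H] [FiniteDimensional ℂ H]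
    -- the antipode is invertible
    (Sinv : H →ₗ[ℂ] H)
    (hSinv₁ : ∀ x : H, Sinv (HopfAlgebra.antipode (R := ℂ) x) = x)
    (hSinv₂ : ∀ x : H, HopfAlgebra.antipode (R := ℂ) (Sinv x) = x)
    -- an invertible R-matrix `R = Σᵢ aᵢ ⊗ bᵢ`
    {ι : Type} [Fintype ι] (aR bR : ι → H)
    (hRinv : IsUnit (∑ i, aR i ⊗ₜ[ℂ] bR i : H ⊗[ℂ] H))
    -- `R Δ(x) = Δᵒᵖ(x) R`
    (hRΔ : ∀ x : H,
      (∑ i, aR i ⊗ₜ[ℂ] bR i) * Coalgebra.comul (R := ℂ) x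
        = (TensorProduct.comm ℂ H H) (Coalgebra.comul (R := ℂ) x)
            * ∑ i, aR i ⊗ₜ[ℂ] bR i)
    -- `(Δ ⊗ id)(R) = R₁₃ R₂₃`
    (hR₁ : (∑ i, (Coalgebra.comul (R := ℂ) (aR i)) ⊗ₜ[ℂ] bR i)
        = ∑ i, ∑ j, (aR i ⊗ₜ[ℂ] aR j) ⊗ₜ[ℂ] (bR i * bR j))
    -- `(id ⊗ Δ)(R) = R₁₃ R₁₂`
    (hR₂ : (∑ i, aR i ⊗ₜ[ℂ] (Coalgebra.comul (R := ℂ) (bR i)))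
        = ∑ i, ∑ j, (aR i * aR j) ⊗ₜ[ℂ] (bR j ⊗ₜ[ℂ] bR i))
    -- a ribbon element `v`
    (v vinv : H) (hv₁ : v * vinv = 1) (hv₂ : vinv * v = 1)
    (hvcentral : ∀ x : H, v * x = x * v)
    (hSv : HopfAlgebra.antipode (R := ℂ) v = v)
    (hεv : Coalgebra.counit (R := ℂ) v = 1)
    -- `Δ(v) = (R'R)⁻¹ (v ⊗ v)`, i.e. `R' R Δ(v) = v ⊗ v`
    (hΔv : (∑ i, bR i ⊗ₜ[ℂ] aR i) * ((∑ i, aR i ⊗ₜ[ℂ] bR i)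
            * Coalgebra.comul (R := ℂ) v) = v ⊗ₜ[ℂ] v)
    -- factorizability: `β ↦ (β ⊗ id)(RR')` is bijective
    (hfact : Function.Bijective fun β : Module.Dual ℂ H =>
        ∑ i, ∑ j, β (aR i * bR j) • (bR i * aR j))
    -- the pivotal element `g = u v⁻¹`, where `u = Σᵢ S(bᵢ) aᵢ` is the Drinfeld element;
    -- `g` is invertible, grouplike and implements `S²`
    (g gi : H)
    (hg : g = (∑ i, HopfAlgebra.antipode (R := ℂ) (bR i) * aR i) * vinv)
    (hgi₁ : g * gi = 1) (hgi₂ : gi * g = 1)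
    (hggrouplike : Coalgebra.comul (R := ℂ) g = g ⊗ₜ[ℂ] g)
    (hgS₂ : ∀ x : H,
      HopfAlgebra.antipode (R := ℂ) (HopfAlgebra.antipode (R := ℂ) x) * g = g * x)
    -- a left integral `μˡ`, with `μˡ(v) ≠ 0` and `μˡ(v⁻¹) ≠ 0`
    (μl : Module.Dual ℂ H) (hμl0 : μl ≠ 0)
    (hμl : ∀ x : H, (TensorProduct.rid ℂ H)
        ((LinearMap.lTensor H μl) (Coalgebra.comul (R := ℂ) x)) = μl x • (1 : H))
    (hμlv : μl v ≠ 0) (hμlvinv : μl vinv ≠ 0)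
    :
    -- `T_a` and `T_b` map `SLF(H)` into itself
    (∀ φ : Module.Dual ℂ H, IsSLF φ → IsSLF (Ta vinv φ) ∧ IsSLF (Tb μl v vinv gi φ))
    -- (i) the braid relation
    ∧ Ta vinv ∘ Tb μl v vinv gi ∘ Ta vinv = Tb μl v vinv gi ∘ Ta vinv ∘ Tb μl v vinv gi
    -- (ii) `(T_aT_b)³(ψ) = (μˡ(v⁻¹)/μˡ(v))·(ψ ∘ S)` on `SLF(H)`
    ∧ (∀ ψ : Module.Dual ℂ H, IsSLF ψ →
        (Ta vinv ∘ Tb μl v vinv gi)^[3] ψ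
          = (μl vinv / μl v) • (ψ ∘ₗ HopfAlgebra.antipode (R := ℂ)))
    -- (iii) `(T_aT_b)⁶ = (μˡ(v⁻¹)/μˡ(v))²·id` on `SLF(H)`
    ∧ (∀ ψ : Module.Dual ℂ H, IsSLF ψ →
        (Ta vinv ∘ Tb μl v vinv gi)^[6] ψ = ((μl vinv / μl v) ^ 2) • ψ)
    -- if moreover `ψ ∘ S = ψ` on `SLF(H)`, then `(T_aT_b)³ = (μˡ(v⁻¹)/μˡ(v))·id` on `SLF(H)`,
    -- giving a projective representation of `PSL₂(ℤ)`
    ∧ ((∀ ψ : Module.Dual ℂ H, IsSLF ψ → ψ ∘ₗ HopfAlgebra.antipode (R := ℂ) = ψ) →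
        ∀ ψ : Module.Dual ℂ H, IsSLF ψ →
          (Ta vinv ∘ Tb μl v vinv gi)^[3] ψ = (μl vinv / μl v) • ψ) := by
  let D : RibbonHopf.RibbonData H :=
    { Sinv := Sinv, Sinv_antipode := hSinv₁, antipode_Sinv := hSinv₂
      ι := ι, a := aR, b := bR, isUnit_R := hRinv, R_comul := hRΔ
      comul_R := hR₁, R_comul_right := hR₂
      v := v, w := vinv, v_mul_w := hv₁, w_mul_v := hv₂, v_comm := hvcentral
      antipode_v := hSv, counit_v := hεv, comul_v := hΔv
      injective_drinfeld := hfact.injective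
      g := g, gi := gi, g_eq := hg, g_mul_gi := hgi₁, gi_mul_g := hgi₂
      comul_g := hggrouplike, antipode_antipode_mul_g := hgS₂
      μ := μl, sliceRight_μ := hμl, μ_v := hμlv, μ_w := hμlvinv }
  exact ⟨fun φ hφ => ⟨D.isSLF_Ta_w hφ, D.isSLF_Tb hφ⟩, D.braid,
    fun ψ hψ => D.iterate_three hψ, fun ψ hψ => D.iterate_six hψ,
    fun h ψ hψ => (D.iterate_three hψ).trans
      (congrArg (fun χ : Module.Dual ℂ H => (μl vinv / μl v) • χ) (h ψ hψ))⟩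

end
end

section
/- Define S_LM, T_LM : H → H by S_LM(x) = (id ⊗ μ^l)(R^{-1}(1 ⊗ x)R'^{-1}) and T_LM(x) = v^{-1}x (the Lyubashenko–Majid operators); they map Z(H) into itself and T_a, T_b restrict to bijections of SLF(H). Then the linear map f : Z(H) → SLF(H) defined by f(z) = μ^r(g v^{-1} S(z)·?) is an isomorphism of vector spaces satisfying f ∘ (S_LM|_{Z(H)}) = μ^l(v^{-1})·S' ∘ f and f ∘ (T_LM|_{Z(H)}) = T' ∘ f, where T' = T_a|_{SLF(H)} and S' = ((T_a ∘ T_b ∘ T_a)|_{SLF(H)})^{-1}. Hence the projective SL₂(ℤ)-representation on SLF(H) given by τ_a ↦ T_a, τ_b ↦ T_b is equivalent to the Lyubashenko–Majid projective SL₂(ℤ)-representation on Z(H) given by s ↦ S_LM|_{Z(H)}, t ↦ T_LM|_{Z(H)} (with s = τ_a^{-1}τ_b^{-1}τ_a^{-1}, t = τ_a). -/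
/- STATEMENT 7: equivalence of the `SL₂(ℤ)`-projective representation on `SLF(H)` with
the Lyubashenko–Majid projective representation on `Z(H)`, via `f(z) = μʳ(g v⁻¹ S(z) ?)`. -/

noncomputable section

open scoped TensorProduct
open TensorProduct

/-- The Lyubashenko–Majid operator `S_LM(x) = (id ⊗ μˡ)(R⁻¹ (1 ⊗ x) R'⁻¹)`,
written with `R⁻¹ = Σᵢ a'ᵢ ⊗ b'ᵢ` : `S_LM(x) = Σ_{i,j} μˡ(b'ᵢ x a'ⱼ) • a'ᵢ b'ⱼ`. -/
def SLM {H ι : Type} [Ring H] [Algebra ℂ H] [Fintype ι]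
    (aS bS : ι → H) (μl : Module.Dual ℂ H) (x : H) : H :=
  ∑ i, ∑ j, μl (bS i * x * aS j) • (aS i * bS j)

local notation "Δ" => Coalgebra.comul (R := ℂ)
local notation "ε" => Coalgebra.counit (R := ℂ)
local notation "𝒮" => HopfAlgebra.antipode ℂ

section Slice

variable {H : Type} [Ring H] [Algebra ℂ H]

/-- The right slice map `id ⊗ β : H ⊗ H → H`. -/
def slice (β : Module.Dual ℂ H) : H ⊗[ℂ] H →ₗ[ℂ] H :=
  (TensorProduct.rid ℂ H).toLinearMap ∘ₗ LinearMap.lTensor H β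

@[simp] lemma slice_tmul (β : Module.Dual ℂ H) (a b : H) : slice β (a ⊗ₜ b) = β b • a := by
  simp [slice]

lemma slice_mul_left (β : Module.Dual ℂ H) (a b : H) (X : H ⊗[ℂ] H) :
    slice β ((a ⊗ₜ b) * X) = a * slice (β ∘ₗ LinearMap.mulLeft ℂ b) X := by
  induction X with
  | zero => simp
  | tmul x y => simp
  | add X Y hX hY => simp only [mul_add, map_add, hX, hY]

lemma slice_mul_right (β : Module.Dual ℂ H) (a b : H) (X : H ⊗[ℂ] H) :
    slice β (X * (a ⊗ₜ b)) = slice (β ∘ₗ LinearMap.mulRight ℂ b) X * a := by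
  induction X with
  | zero => simp
  | tmul x y => simp
  | add X Y hX hY => simp only [add_mul, map_add, hX, hY]

lemma slice_map (f : H →ₗ[ℂ] H) (β : Module.Dual ℂ H) (h : H →ₗ[ℂ] H) (X : H ⊗[ℂ] H) :
    slice β (TensorProduct.map f h X) = f (slice (β ∘ₗ h) X) := by
  induction X with
  | zero => simp
  | tmul x y => simp
  | add X Y hX hY => simp only [map_add, hX, hY]

lemma slice_smul (c : ℂ) (β : Module.Dual ℂ H) (X : H ⊗[ℂ] H) :
    slice (c • β) X = c • slice β X := by
  simp [slice, LinearMap.lTensor_smul]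

end Slice

section Sweedler

variable {H : Type} [Ring H] [HopfAlgebra ℂ H]

open Coalgebra HopfAlgebra

lemma slice_counit_comul (x : H) : slice (counit (R := ℂ)) (Δ x) = x := by
  simp [slice]

lemma sum_map_comul_right_eq {V ι : Type} [AddCommMonoid V] [Module ℂ V] {x : H}
    (r : Repr ℂ x ι) (L : H ⊗[ℂ] (H ⊗[ℂ] H) →ₗ[ℂ] V) :
    ∑ i ∈ r.index, L (r.left i ⊗ₜ Δ (r.right i)) =
      ∑ i ∈ r.index, L (TensorProduct.assoc ℂ H H H (Δ (r.left i) ⊗ₜ r.right i)) := by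
  have h := congrArg L (coassoc_apply (R := ℂ) x)
  rw [← r.eq] at h
  simpa [map_sum] using h.symm

lemma sum_antipode_mul_comul {ι : Type} {x : H} (r : Repr ℂ x ι) :
    ∑ i ∈ r.index, (𝒮 (r.left i) ⊗ₜ[ℂ] (1 : H)) * Δ (r.right i) = 1 ⊗ₜ x := by
  have h := sum_map_comul_right_eq r (LinearMap.mul' ℂ (H ⊗[ℂ] H) ∘ₗ
    TensorProduct.map ((TensorProduct.mk ℂ H H).flip 1 ∘ₗ antipode ℂ) .id)
  simp only [LinearMap.comp_apply, TensorProduct.map_tmul, LinearMap.mul'_apply,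
    LinearMap.flip_apply, TensorProduct.mk_apply, LinearMap.id_apply] at h
  rw [h]
  have key : ∀ (X : H ⊗[ℂ] H) (y : H), LinearMap.mul' ℂ (H ⊗[ℂ] H) (TensorProduct.map
      ((TensorProduct.mk ℂ H H).flip 1 ∘ₗ antipode ℂ) .id (TensorProduct.assoc ℂ H H H (X ⊗ₜ y)))
      = LinearMap.mul' ℂ H (LinearMap.rTensor H (antipode ℂ) X) ⊗ₜ y := by
    intro X y
    induction X with
    | zero => simp
    | tmul a b => simp
    | add X Y hX hY => simp only [TensorProduct.add_tmul, map_add, hX, hY]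
  simp only [key, mul_antipode_rTensor_comul_apply, Algebra.algebraMap_eq_smul_one,
    TensorProduct.smul_tmul, ← TensorProduct.tmul_sum, sum_counit_smul]

lemma sum_comul_mul_antipode {ι : Type} {x : H} (r : Repr ℂ x ι) :
    ∑ i ∈ r.index, Δ (r.left i) * ((1 : H) ⊗ₜ[ℂ] 𝒮 (r.right i)) = x ⊗ₜ 1 := by
  have h := sum_map_comul_right_eq r (LinearMap.mul' ℂ (H ⊗[ℂ] H) ∘ₗ
    TensorProduct.map .id (TensorProduct.mk ℂ H H 1 ∘ₗ antipode ℂ) ∘ₗ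
      (TensorProduct.assoc ℂ H H H).symm.toLinearMap)
  simp only [LinearMap.comp_apply, LinearEquiv.coe_coe, LinearEquiv.symm_apply_apply,
    TensorProduct.map_tmul, LinearMap.mul'_apply, TensorProduct.mk_apply, LinearMap.id_apply] at h
  rw [← h]
  have key : ∀ (X : H ⊗[ℂ] H) (y : H), LinearMap.mul' ℂ (H ⊗[ℂ] H) (TensorProduct.map .id
      (TensorProduct.mk ℂ H H 1 ∘ₗ antipode ℂ) ((TensorProduct.assoc ℂ H H H).symm (y ⊗ₜ X)))
      = y ⊗ₜ LinearMap.mul' ℂ H (LinearMap.lTensor H (antipode ℂ) X) := by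
    intro X y
    induction X with
    | zero => simp
    | tmul a b => simp
    | add X Y hX hY => simp only [TensorProduct.tmul_add, map_add, hX, hY]
  simp only [key, mul_antipode_lTensor_comul_apply, Algebra.algebraMap_eq_smul_one,
    TensorProduct.tmul_smul, TensorProduct.smul_tmul', ← TensorProduct.sum_tmul]
  congr 1
  conv_rhs => rw [← slice_counit_comul x, ← r.eq]
  simp [map_sum]

lemma comul_antipode (x : H) :
    Δ (𝒮 x) = TensorProduct.map (antipode ℂ) (antipode ℂ) (TensorProduct.comm ℂ H H (Δ x)) := by
  have hl : WithConv.toConv (TensorProduct.map (antipode ℂ) (antipode ℂ) ∘ₗ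
      (TensorProduct.comm ℂ H H).toLinearMap ∘ₗ comul (R := ℂ) (A := H)) *
        WithConv.toConv (comul (R := ℂ) (A := H)) = 1 := by
    ext x
    have h1 := (ℛ ℂ x)
    have h := sum_map_comul_right_eq (ℛ ℂ x) (LinearMap.mul' ℂ (H ⊗[ℂ] H) ∘ₗ
      TensorProduct.map (TensorProduct.mk ℂ H H 1 ∘ₗ antipode ℂ)
        (LinearMap.mul' ℂ (H ⊗[ℂ] H) ∘ₗ
    TensorProduct.map ((TensorProduct.mk ℂ H H).flip 1 ∘ₗ antipode ℂ) (comul (R := ℂ))))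
    have key : ∀ (X : H ⊗[ℂ] H) (y : H), (LinearMap.mul' ℂ (H ⊗[ℂ] H) ∘ₗ
      TensorProduct.map (TensorProduct.mk ℂ H H 1 ∘ₗ antipode ℂ)
        (LinearMap.mul' ℂ (H ⊗[ℂ] H) ∘ₗ
    TensorProduct.map ((TensorProduct.mk ℂ H H).flip 1 ∘ₗ antipode ℂ) (comul (R := ℂ))))
      (TensorProduct.assoc ℂ H H H (X ⊗ₜ y)) = TensorProduct.map (antipode ℂ) (antipode ℂ)
        (TensorProduct.comm ℂ H H X) * Δ y := by
      intro X y
      induction X with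
      | zero => simp
      | tmul a b => simp [← mul_assoc]
      | add X Y hX hY => simp only [TensorProduct.add_tmul, map_add, hX, hY, add_mul]
    have key2 : ∀ y : H, (LinearMap.mul' ℂ (H ⊗[ℂ] H) ∘ₗ
      TensorProduct.map ((TensorProduct.mk ℂ H H).flip 1 ∘ₗ antipode ℂ) (comul (R := ℂ))) (Δ y)
        = 1 ⊗ₜ y := by
      intro y
      conv_lhs => rw [← (ℛ ℂ y).eq]
      simpa [map_sum] using sum_antipode_mul_comul (ℛ ℂ y)
    simp only [key] at h
    rw [(ℛ ℂ x).convMul_apply]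
    simp only [LinearMap.comp_apply] at h key2 ⊢
    simp only [LinearEquiv.coe_coe] at h ⊢
    refine h.symm.trans ?_
    simp only [TensorProduct.map_tmul, LinearMap.comp_apply, key2, LinearMap.mul'_apply,
      TensorProduct.mk_apply, Algebra.TensorProduct.tmul_mul_tmul, one_mul,
      ← TensorProduct.tmul_sum, sum_antipode_mul_eq_algebraMap_counit]
    simp [Algebra.algebraMap_eq_smul_one, Algebra.TensorProduct.one_def]
  have := left_inv_eq_right_inv hl (LinearMap.comul_right_inv (R := ℂ) (C := H))
  exact (congrArg (fun f => f.ofConv x) this).symm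

end Sweedler

section AntipodeInverse

variable {H : Type} [Ring H] [HopfAlgebra ℂ H]

open Coalgebra HopfAlgebra

/-- `T` is a two-sided inverse of the antipode. -/
structure IsAntipodeInv (T : H →ₗ[ℂ] H) : Prop where
  left : ∀ x, T (𝒮 x) = x
  right : ∀ x, 𝒮 (T x) = x

namespace IsAntipodeInv

variable {T : H →ₗ[ℂ] H} (hT : IsAntipodeInv T)
include hT

lemma inj {x y : H} (h : 𝒮 x = 𝒮 y) : x = y := by
  rw [← hT.left x, h, hT.left]

lemma map_mul (x y : H) : T (x * y) = T y * T x :=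
  hT.inj (by rw [hT.right, antipode_mul_antidistrib, hT.right, hT.right])

lemma comul (x : H) :
    Δ (T x) = TensorProduct.map T T (TensorProduct.comm ℂ H H (Δ x)) := by
  have key : ∀ X : H ⊗[ℂ] H, TensorProduct.map T T (TensorProduct.comm ℂ H H
      (TensorProduct.map (antipode ℂ) (antipode ℂ) (TensorProduct.comm ℂ H H X))) = X := by
    intro X
    induction X with
    | zero => simp
    | tmul a b => simp [hT.left]
    | add X Y hX hY => simp only [map_add, hX, hY]
  conv_rhs => rw [← hT.right x, comul_antipode, key]

lemma mul_map_left (x : H) :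
    LinearMap.mul' ℂ H (TensorProduct.map T .id (TensorProduct.comm ℂ H H (Δ x))) = ε x • 1 := by
  apply hT.inj
  have key : ∀ X : H ⊗[ℂ] H, 𝒮 (LinearMap.mul' ℂ H (TensorProduct.map T .id
      (TensorProduct.comm ℂ H H X))) = LinearMap.mul' ℂ H (LinearMap.rTensor H (antipode ℂ) X) := by
    intro X
    induction X with
    | zero => simp
    | tmul a b => simp [hT.right, antipode_mul_antidistrib]
    | add X Y hX hY => simp only [map_add, hX, hY]
  rw [key, mul_antipode_rTensor_comul_apply, map_smul, antipode_one, Algebra.algebraMap_eq_smul_one]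

lemma mul_map_right (x : H) :
    LinearMap.mul' ℂ H (TensorProduct.map .id T (TensorProduct.comm ℂ H H (Δ x))) = ε x • 1 := by
  apply hT.inj
  have key : ∀ X : H ⊗[ℂ] H, 𝒮 (LinearMap.mul' ℂ H (TensorProduct.map .id T
      (TensorProduct.comm ℂ H H X))) = LinearMap.mul' ℂ H (LinearMap.lTensor H (antipode ℂ) X) := by
    intro X
    induction X with
    | zero => simp
    | tmul a b => simp [hT.right, antipode_mul_antidistrib]
    | add X Y hX hY => simp only [map_add, hX, hY]
  rw [key, mul_antipode_lTensor_comul_apply, map_smul, antipode_one, Algebra.algebraMap_eq_smul_one]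

lemma sum_inv_mul_comul {ι : Type} {x : H} (r : Repr ℂ x ι) :
    ∑ i ∈ r.index, ((1 : H) ⊗ₜ[ℂ] T (r.right i)) * Δ (r.left i) = x ⊗ₜ 1 := by
  have h := sum_map_comul_right_eq r (LinearMap.mul' ℂ (H ⊗[ℂ] H) ∘ₗ
    TensorProduct.map (TensorProduct.mk ℂ H H 1 ∘ₗ T) .id ∘ₗ
      (TensorProduct.comm ℂ (H ⊗[ℂ] H) H).toLinearMap ∘ₗ
      (TensorProduct.assoc ℂ H H H).symm.toLinearMap)
  simp only [LinearMap.comp_apply, LinearEquiv.coe_coe, LinearEquiv.symm_apply_apply,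
    TensorProduct.map_tmul, LinearMap.mul'_apply, TensorProduct.mk_apply, LinearMap.id_apply,
    TensorProduct.comm_tmul] at h
  rw [← h]
  have key : ∀ (X : H ⊗[ℂ] H) (y : H), LinearMap.mul' ℂ (H ⊗[ℂ] H) (TensorProduct.map
      (TensorProduct.mk ℂ H H 1 ∘ₗ T) .id (TensorProduct.comm ℂ (H ⊗[ℂ] H) H
        ((TensorProduct.assoc ℂ H H H).symm (y ⊗ₜ X))))
      = y ⊗ₜ LinearMap.mul' ℂ H (TensorProduct.map T .id (TensorProduct.comm ℂ H H X)) := by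
    intro X y
    induction X with
    | zero => simp
    | tmul a b => simp
    | add X Y hX hY => simp only [TensorProduct.tmul_add, _root_.map_add, hX, hY]
  simp only [key, hT.mul_map_left, TensorProduct.tmul_smul, TensorProduct.smul_tmul',
    ← TensorProduct.sum_tmul]
  congr 1
  conv_rhs => rw [← slice_counit_comul x, ← r.eq]
  simp [map_sum]

lemma sum_comul_mul_inv {ι : Type} {x : H} (r : Repr ℂ x ι) :
    ∑ i ∈ r.index, Δ (r.right i) * (T (r.left i) ⊗ₜ[ℂ] (1 : H)) = 1 ⊗ₜ x := by
  have h := sum_map_comul_right_eq r (LinearMap.mul' ℂ (H ⊗[ℂ] H) ∘ₗ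
    TensorProduct.map .id ((TensorProduct.mk ℂ H H).flip 1 ∘ₗ T) ∘ₗ
      (TensorProduct.comm ℂ H (H ⊗[ℂ] H)).toLinearMap)
  simp only [LinearMap.comp_apply, LinearEquiv.coe_coe, TensorProduct.comm_tmul,
    TensorProduct.map_tmul, LinearMap.mul'_apply,
    LinearMap.flip_apply, TensorProduct.mk_apply, LinearMap.id_apply] at h
  rw [h]
  have key : ∀ (X : H ⊗[ℂ] H) (y : H), LinearMap.mul' ℂ (H ⊗[ℂ] H) (TensorProduct.map .id
      ((TensorProduct.mk ℂ H H).flip 1 ∘ₗ T) (TensorProduct.comm ℂ H (H ⊗[ℂ] H)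
        (TensorProduct.assoc ℂ H H H (X ⊗ₜ y))))
      = LinearMap.mul' ℂ H (TensorProduct.map .id T (TensorProduct.comm ℂ H H X)) ⊗ₜ y := by
    intro X y
    induction X with
    | zero => simp
    | tmul a b => simp
    | add X Y hX hY => simp only [TensorProduct.add_tmul, _root_.map_add, hX, hY]
  simp only [key, hT.mul_map_right,
    TensorProduct.smul_tmul, ← TensorProduct.tmul_sum, sum_counit_smul]

end IsAntipodeInv

end AntipodeInverse

section Integral

variable {H : Type} [Ring H] [HopfAlgebra ℂ H]

open Coalgebra HopfAlgebra

lemma lift_eq_sum_coord_slice {ι : Type*} [Fintype ι] (e : Module.Basis ι ℂ H)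
    (Φ : H →ₗ[ℂ] H →ₗ[ℂ] ℂ) (X : H ⊗[ℂ] H) :
    TensorProduct.lift Φ X = ∑ i, e.coord i (slice (Φ (e i)) X) := by
  induction X with
  | zero => simp
  | tmul x y =>
    conv_lhs => rw [← e.sum_repr x]
    simp only [TensorProduct.lift.tmul, map_sum, map_smul, LinearMap.sum_apply,
      LinearMap.smul_apply, smul_eq_mul, slice_tmul, Module.Basis.coord_apply]
    exact Finset.sum_congr rfl fun i _ => mul_comm _ _
  | add X Y hX hY => simp only [map_add, hX, hY, Finset.sum_add_distrib]

lemma lift_eq_zero_of_slice_eq_zero [FiniteDimensional ℂ H]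
    (Φ : H →ₗ[ℂ] H →ₗ[ℂ] ℂ) (X : H ⊗[ℂ] H) (h : ∀ a, slice (Φ a) X = 0) :
    TensorProduct.lift Φ X = 0 := by
  rw [lift_eq_sum_coord_slice (Module.finBasis ℂ H)]
  simp [h]

/-- `μ` is a nonzero left integral form on `H`, and `T` inverts the antipode. -/
structure IsLeftInt (T : H →ₗ[ℂ] H) (μ : Module.Dual ℂ H) : Prop extends IsAntipodeInv T where
  ne_zero : μ ≠ 0
  slice_comul : ∀ x, slice μ (Δ x) = μ x • (1 : H)

namespace IsLeftInt

variable {T : H →ₗ[ℂ] H} {μ : Module.Dual ℂ H} (hμ : IsLeftInt T μ)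
include hμ

lemma slice_comul_mul (a b : H) :
    slice μ (Δ b * (1 ⊗ₜ a)) = T (slice (μ ∘ₗ LinearMap.mulLeft ℂ b) (Δ a)) := by
  have h := hμ.sum_comul_mul_inv (ℛ ℂ a)
  rw [← h, Finset.mul_sum, map_sum]
  conv_rhs => rw [← (ℛ ℂ a).eq]
  rw [map_sum, map_sum]
  refine Finset.sum_congr rfl fun i _ => ?_
  rw [← mul_assoc, ← Bialgebra.comul_mul, slice_mul_right, LinearMap.mulRight_one,
    LinearMap.comp_id, hμ.slice_comul]
  simp

variable [FiniteDimensional ℂ H]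

lemma eq_zero_of_forall {a : H} (ha : ∀ x, μ (x * a) = 0) : a = 0 := by
  have key : ∀ a : H, (∀ x, μ (x * a) = 0) → ∀ c, slice (μ ∘ₗ LinearMap.mulLeft ℂ c) (Δ a) = 0 := by
    intro a ha c
    have h := hμ.slice_comul_mul a c
    have h0 : slice μ (Δ c * (1 ⊗ₜ a)) = 0 := by
      rw [slice_mul_right]
      have : μ ∘ₗ LinearMap.mulRight ℂ a = 0 := by ext x; simpa using ha x
      simp [this, slice]
    rw [h0] at h
    have := congrArg 𝒮 h
    rw [hμ.right] at this
    simpa using this.symm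
  have hε : ∀ a : H, (∀ x, μ (x * a) = 0) → ε a = 0 := by
    intro a ha
    obtain ⟨b, hb⟩ : ∃ b, μ b ≠ 0 := by
      by_contra! h
      exact hμ.ne_zero (LinearMap.ext h)
    have h := lift_eq_zero_of_slice_eq_zero
      (((LinearMap.mul ℂ H).compr₂ (μ ∘ₗ LinearMap.mulLeft ℂ b)) ∘ₗ antipode ℂ) (Δ a) (by
        intro c
        have := key a ha (b * 𝒮 c)
        rw [← this]
        congr 2
        ext x
        simp)
    have h2 : ∀ X : H ⊗[ℂ] H, TensorProduct.lift
        (((LinearMap.mul ℂ H).compr₂ (μ ∘ₗ LinearMap.mulLeft ℂ b)) ∘ₗ antipode ℂ) X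
        = μ (b * LinearMap.mul' ℂ H (LinearMap.rTensor H (antipode ℂ) X)) := by
      intro X
      induction X with
      | zero => simp
      | tmul x y => simp
      | add X Y hX hY => simp only [map_add, hX, hY, mul_add]
    rw [h2, mul_antipode_rTensor_comul_apply, Algebra.algebraMap_eq_smul_one] at h
    simpa [hb] using h
  rw [← Module.forall_dual_apply_eq_zero_iff ℂ]
  intro β
  have h1 := hε (TensorProduct.lid ℂ H (LinearMap.rTensor H β (Δ a))) (by
    intro x
    have h2 : ∀ X : H ⊗[ℂ] H, μ (x * TensorProduct.lid ℂ H (LinearMap.rTensor H β X)) =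
        β (slice (μ ∘ₗ LinearMap.mulLeft ℂ x) X) := by
      intro X
      induction X with
      | zero => simp
      | tmul y z => simp [mul_comm]
      | add X Y hX hY => simp only [map_add, hX, hY, mul_add]
    rw [h2, key a ha, map_zero])
  have h3 : ∀ X : H ⊗[ℂ] H, ε (TensorProduct.lid ℂ H (LinearMap.rTensor H β X)) =
      β (slice (counit (R := ℂ)) X) := by
    intro X
    induction X with
    | zero => simp
    | tmul y z => simp [mul_comm]
    | add X Y hX hY => simp only [map_add, hX, hY]
  rwa [h3, slice_counit_comul] at h1

lemma ext_mul_right {a b : H} (h : ∀ x, μ (x * a) = μ (x * b)) : a = b :=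
  sub_eq_zero.1 (hμ.eq_zero_of_forall fun x => by rw [mul_sub, map_sub, h, sub_self])

lemma exists_mulRight_eq (ω : Module.Dual ℂ H) : ∃ a, ∀ x, μ (x * a) = ω x := by
  let F : H →ₗ[ℂ] Module.Dual ℂ H := (LinearMap.mul ℂ H).flip.compr₂ μ
  have hF : Function.Injective F := fun a b hab =>
    hμ.ext_mul_right fun x => by simpa [F] using LinearMap.congr_fun hab x
  obtain ⟨a, ha⟩ := (LinearMap.injective_iff_surjective_of_finrank_eq_finrank
    (Subspace.dual_finrank_eq (K := ℂ) (V := H)).symm).1 hF ω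
  exact ⟨a, fun x => by simpa [F] using LinearMap.congr_fun ha x⟩

end IsLeftInt

/-- A left integral form `μ` together with the left integral `Λ` dual to it. -/
structure IsIntPair (T : H →ₗ[ℂ] H) (μ : Module.Dual ℂ H) (Λ : H) : Prop
    extends IsLeftInt T μ where
  apply_mul : ∀ b, μ (b * Λ) = ε b

lemma IsLeftInt.exists_isIntPair [FiniteDimensional ℂ H] {T : H →ₗ[ℂ] H} {μ : Module.Dual ℂ H}
    (hμ : IsLeftInt T μ) : ∃ Λ, IsIntPair T μ Λ := by
  obtain ⟨Λ, hΛ⟩ := hμ.exists_mulRight_eq (counit (R := ℂ))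
  exact ⟨Λ, hμ, hΛ⟩

namespace IsIntPair

variable {T : H →ₗ[ℂ] H} {μ : Module.Dual ℂ H} {Λ : H} (hΛ : IsIntPair T μ Λ)
include hΛ

lemma apply_eq_one : μ Λ = 1 := by simpa using hΛ.apply_mul 1

lemma slice_mulLeft_comul (b : H) : slice (μ ∘ₗ LinearMap.mulLeft ℂ b) (Δ Λ) = 𝒮 b := by
  have h := hΛ.slice_comul_mul Λ b
  rw [slice_mul_right, mul_one] at h
  have : μ ∘ₗ LinearMap.mulRight ℂ Λ = counit (R := ℂ) := by ext x; simpa using hΛ.apply_mul x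
  rw [this, slice_counit_comul] at h
  conv_rhs => rw [h, hΛ.right]

lemma slice_comul_self : slice μ (Δ Λ) = 1 := by
  simpa using hΛ.slice_mulLeft_comul 1

variable [FiniteDimensional ℂ H]

lemma mul_left (c : H) : c * Λ = ε c • Λ :=
  hΛ.ext_mul_right fun x => by
    rw [← mul_assoc, hΛ.apply_mul, mul_smul_comm, map_smul, hΛ.apply_mul]
    simp [mul_comm]

lemma eq_smul_of_leftIntegral {l : H} (hl : ∀ c, c * l = ε c • l) : l = μ l • Λ :=
  hΛ.ext_mul_right fun x => by
    rw [hl, mul_smul_comm, map_smul, map_smul, hΛ.apply_mul]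
    simp [mul_comm]

lemma exists_mulLeft_eq (ω : Module.Dual ℂ H) : ∃ b, μ ∘ₗ LinearMap.mulLeft ℂ b = ω := by
  let F : H →ₗ[ℂ] Module.Dual ℂ H := (LinearMap.mul ℂ H).compr₂ μ
  have hF' : ∀ b, F b = μ ∘ₗ LinearMap.mulLeft ℂ b := fun b => by ext x; simp [F]
  have hF : Function.Injective F := fun a b hab =>
    hΛ.inj (by rw [← hΛ.slice_mulLeft_comul, ← hΛ.slice_mulLeft_comul, ← hF', ← hF', hab])
  obtain ⟨a, ha⟩ := (LinearMap.injective_iff_surjective_of_finrank_eq_finrank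
    (Subspace.dual_finrank_eq (K := ℂ) (V := H)).symm).1 hF ω
  exact ⟨a, by rw [← hF', ha]⟩

lemma ext_slice {ω ω' : Module.Dual ℂ H} (h : slice ω (Δ Λ) = slice ω' (Δ Λ)) : ω = ω' := by
  obtain ⟨b, rfl⟩ := hΛ.exists_mulLeft_eq ω
  obtain ⟨b', rfl⟩ := hΛ.exists_mulLeft_eq ω'
  rw [hΛ.slice_mulLeft_comul, hΛ.slice_mulLeft_comul] at h
  rw [hΛ.inj h]

lemma one_tmul_mul_comul (c : H) : (1 ⊗ₜ c) * Δ Λ = (𝒮 c ⊗ₜ 1) * Δ Λ := by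
  rw [← sum_antipode_mul_comul (ℛ ℂ c), Finset.sum_mul]
  conv_rhs => rw [← slice_counit_comul c, ← (ℛ ℂ c).eq]
  simp only [map_sum, slice_tmul, map_smul, TensorProduct.sum_tmul, Finset.sum_mul]
  refine Finset.sum_congr rfl fun i _ => ?_
  rw [mul_assoc, ← Bialgebra.comul_mul, hΛ.mul_left, map_smul, mul_smul_comm,
    ← TensorProduct.smul_tmul', smul_mul_assoc]

lemma tmul_one_mul_comul (c : H) : (c ⊗ₜ 1) * Δ Λ = (1 ⊗ₜ T c) * Δ Λ := by
  rw [hΛ.one_tmul_mul_comul, hΛ.right]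

lemma mul_right (c : H) : Λ * c = μ (Λ * c) • Λ :=
  hΛ.eq_smul_of_leftIntegral fun x => by rw [← mul_assoc, hΛ.mul_left, smul_mul_assoc]

lemma modulus_mul (c d : H) : μ (Λ * (c * d)) = μ (Λ * c) * μ (Λ * d) := by
  rw [← mul_assoc, hΛ.mul_right c, smul_mul_assoc, map_smul, smul_eq_mul]
  conv_rhs => rw [hΛ.mul_right c]
  simp [hΛ.apply_eq_one]

lemma comul_mul_tmul_one (c : H) : Δ Λ * (c ⊗ₜ 1) = Δ Λ *
    (1 ⊗ₜ 𝒮 (slice (μ ∘ₗ LinearMap.mulLeft ℂ Λ) (TensorProduct.comm ℂ H H (Δ c)))) := by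
  rw [← sum_comul_mul_antipode (ℛ ℂ c), Finset.mul_sum]
  conv_rhs => rw [← (ℛ ℂ c).eq]
  simp only [map_sum, TensorProduct.comm_tmul, slice_tmul, map_smul, TensorProduct.tmul_sum,
    Finset.mul_sum]
  refine Finset.sum_congr rfl fun i _ => ?_
  rw [← mul_assoc, ← Bialgebra.comul_mul, hΛ.mul_right, map_smul, smul_mul_assoc,
    TensorProduct.tmul_smul, mul_smul_comm]
  rfl

lemma comul_mul_one_tmul (c : H) : Δ Λ * (1 ⊗ₜ c) = Δ Λ *
    (T (slice (μ ∘ₗ LinearMap.mulLeft ℂ Λ) (Δ c)) ⊗ₜ 1) := by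
  rw [← hΛ.sum_comul_mul_inv (ℛ ℂ c), Finset.mul_sum]
  conv_rhs => rw [← (ℛ ℂ c).eq]
  simp only [map_sum, slice_tmul, map_smul, TensorProduct.sum_tmul, Finset.mul_sum]
  refine Finset.sum_congr rfl fun i _ => ?_
  rw [← mul_assoc, ← Bialgebra.comul_mul, hΛ.mul_right, map_smul, smul_mul_assoc,
    ← TensorProduct.smul_tmul', mul_smul_comm]
  rfl

end IsIntPair

end Integral

section SumFamilies

variable {H : Type} [Ring H] [HopfAlgebra ℂ H] {ι : Type} [Fintype ι] (a b : ι → H)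

open HopfAlgebra

lemma IsAntipodeInv.sum_inv_mul {T : H →ₗ[ℂ] H} (hT : IsAntipodeInv T) :
    ∑ i, T (a i) * b i = T (∑ i, 𝒮 (b i) * a i) := by
  rw [map_sum]
  simp [hT.map_mul, hT.left]

lemma IsIntPair.sum_tmul_mul_comul_left [FiniteDimensional ℂ H] {T : H →ₗ[ℂ] H}
    {μ : Module.Dual ℂ H} {Λ : H} (hΛ : IsIntPair T μ Λ) :
    (∑ i, a i ⊗ₜ[ℂ] b i) * Δ Λ = ((∑ i, a i * 𝒮 (b i)) ⊗ₜ 1) * Δ Λ := by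
  rw [TensorProduct.sum_tmul, Finset.sum_mul, Finset.sum_mul]
  refine Finset.sum_congr rfl fun i _ => ?_
  have h1 : a i ⊗ₜ[ℂ] b i = (a i ⊗ₜ 1) * (1 ⊗ₜ b i) := by simp
  rw [h1, mul_assoc, hΛ.one_tmul_mul_comul, ← mul_assoc]
  simp

lemma IsIntPair.sum_tmul_mul_comul_right [FiniteDimensional ℂ H] {T : H →ₗ[ℂ] H}
    {μ : Module.Dual ℂ H} {Λ : H} (hΛ : IsIntPair T μ Λ) :
    (∑ i, a i ⊗ₜ[ℂ] b i) * Δ Λ = (1 ⊗ₜ (∑ i, b i * T (a i))) * Δ Λ := by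
  rw [TensorProduct.tmul_sum, Finset.sum_mul, Finset.sum_mul]
  refine Finset.sum_congr rfl fun i _ => ?_
  have h1 : a i ⊗ₜ[ℂ] b i = (1 ⊗ₜ b i) * (a i ⊗ₜ 1) := by simp
  rw [h1, mul_assoc, hΛ.tmul_one_mul_comul, ← mul_assoc]
  simp

end SumFamilies

section Quasitriangular

variable {H : Type} [Ring H] [HopfAlgebra ℂ H]

open Coalgebra HopfAlgebra

/-- `R = Σᵢ aᵢ ⊗ bᵢ` is an R-matrix with inverse `R'`. -/
structure IsRMatrix {ι : Type} [Fintype ι] (a b : ι → H) (R' : H ⊗[ℂ] H) : Prop where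
  mul_comul : ∀ x : H, (∑ i, a i ⊗ₜ[ℂ] b i) * Δ x =
    TensorProduct.comm ℂ H H (Δ x) * ∑ i, a i ⊗ₜ[ℂ] b i
  comul_left : (∑ i, Δ (a i) ⊗ₜ[ℂ] b i) = ∑ i, ∑ j, (a i ⊗ₜ[ℂ] a j) ⊗ₜ[ℂ] (b i * b j)
  comul_right : (∑ i, a i ⊗ₜ[ℂ] Δ (b i)) = ∑ i, ∑ j, (a i * a j) ⊗ₜ[ℂ] (b j ⊗ₜ[ℂ] b i)
  inv_mul : R' * ∑ i, a i ⊗ₜ[ℂ] b i = 1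
  mul_inv : (∑ i, a i ⊗ₜ[ℂ] b i) * R' = 1

namespace IsRMatrix

variable {ι : Type} [Fintype ι] {a b : ι → H} {R' : H ⊗[ℂ] H} (hR : IsRMatrix a b R')
include hR

lemma eq_one_of_mul_eq {X : H ⊗[ℂ] H} (h : X * ∑ i, a i ⊗ₜ[ℂ] b i = ∑ i, a i ⊗ₜ[ℂ] b i) :
    X = 1 := by
  have := congrArg (· * R') h
  simpa only [mul_assoc, hR.mul_inv, mul_one] using this

lemma eq_one_of_eq_mul {X : H ⊗[ℂ] H} (h : (∑ i, a i ⊗ₜ[ℂ] b i) * X = ∑ i, a i ⊗ₜ[ℂ] b i) :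
    X = 1 := by
  have := congrArg (R' * ·) h
  simpa only [← mul_assoc, hR.inv_mul, one_mul] using this

lemma sum_counit_left : ∑ i, ε (a i) • b i = 1 := by
  have h := congrArg (TensorProduct.map ((TensorProduct.lid ℂ H).toLinearMap ∘ₗ
    LinearMap.rTensor H (counit (R := ℂ) (A := H))) (LinearMap.id (R := ℂ) (M := H))) hR.comul_left
  simp only [map_sum, TensorProduct.map_tmul, LinearMap.comp_apply, rTensor_counit_comul,
    LinearEquiv.coe_coe, TensorProduct.lid_tmul, one_smul, LinearMap.id_apply,
    LinearMap.rTensor_tmul] at h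
  have h2 : (1 : H) ⊗ₜ[ℂ] (∑ i, ε (a i) • b i) = 1 := hR.eq_one_of_mul_eq (by
    conv_rhs => rw [h]
    rw [TensorProduct.tmul_sum, Finset.sum_mul_sum]
    simp [TensorProduct.smul_tmul'])
  have h3 := congrArg (fun X => slice (counit (R := ℂ)) (TensorProduct.comm ℂ H H X)) h2
  simpa [Algebra.TensorProduct.one_def] using h3

lemma sum_counit_right : ∑ i, ε (b i) • a i = 1 := by
  have h := congrArg (TensorProduct.map (LinearMap.id (R := ℂ) (M := H))
    ((TensorProduct.lid ℂ H).toLinearMap ∘ₗ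
    LinearMap.rTensor H (counit (R := ℂ) (A := H)))) hR.comul_right
  simp only [map_sum, TensorProduct.map_tmul, LinearMap.comp_apply, rTensor_counit_comul,
    LinearEquiv.coe_coe, TensorProduct.lid_tmul, one_smul, LinearMap.id_apply,
    LinearMap.rTensor_tmul] at h
  have h2 : (∑ i, ε (b i) • a i) ⊗ₜ[ℂ] (1 : H) = 1 := hR.eq_one_of_eq_mul (by
    conv_rhs => rw [h]
    rw [TensorProduct.sum_tmul, Finset.sum_mul_sum]
    simp [TensorProduct.smul_tmul'])
  have h3 := congrArg (fun X => slice (counit (R := ℂ)) X) h2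
  simpa [Algebra.TensorProduct.one_def] using h3

lemma inv_eq_antipode : R' = ∑ i, 𝒮 (a i) ⊗ₜ[ℂ] b i := by
  have h := congrArg (TensorProduct.map (LinearMap.mul' ℂ H ∘ₗ
    LinearMap.rTensor H (antipode ℂ)) (LinearMap.id (R := ℂ) (M := H))) hR.comul_left
  simp only [map_sum, TensorProduct.map_tmul, LinearMap.comp_apply,
    LinearMap.id_apply, LinearMap.mul'_apply, mul_antipode_rTensor_comul_apply,
    LinearMap.rTensor_tmul, Algebra.algebraMap_eq_smul_one, TensorProduct.smul_tmul,
    ← TensorProduct.tmul_sum, hR.sum_counit_left] at h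
  refine (left_inv_eq_right_inv ?_ hR.mul_inv).symm
  rw [Finset.sum_mul_sum]
  simpa [Algebra.TensorProduct.one_def] using h.symm

lemma inv_eq_antipodeInv {T : H →ₗ[ℂ] H} (hT : IsAntipodeInv T) :
    R' = ∑ i, a i ⊗ₜ[ℂ] T (b i) := by
  have h := congrArg (TensorProduct.map (LinearMap.id (R := ℂ) (M := H)) (LinearMap.mul' ℂ H ∘ₗ
    TensorProduct.map T .id ∘ₗ (TensorProduct.comm ℂ H H).toLinearMap)) hR.comul_right
  simp only [map_sum, TensorProduct.map_tmul, LinearMap.comp_apply, LinearEquiv.coe_coe,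
    LinearMap.id_apply, LinearMap.mul'_apply, hT.mul_map_left, TensorProduct.comm_tmul,
    ← TensorProduct.smul_tmul,
    ← TensorProduct.sum_tmul, hR.sum_counit_right] at h
  refine (left_inv_eq_right_inv ?_ hR.mul_inv).symm
  rw [Finset.sum_mul_sum]
  simpa [Algebra.TensorProduct.one_def] using h.symm

lemma map_antipode {T : H →ₗ[ℂ] H} (hT : IsAntipodeInv T) :
    ∑ i, 𝒮 (a i) ⊗ₜ[ℂ] 𝒮 (b i) = ∑ i, a i ⊗ₜ[ℂ] b i := by
  have h := congrArg (TensorProduct.map (LinearMap.id (R := ℂ) (M := H)) (antipode ℂ))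
    (hR.inv_eq_antipode.symm.trans (hR.inv_eq_antipodeInv hT))
  simpa [map_sum, hT.right] using h

lemma sum_mul_antipodeInv {T : H →ₗ[ℂ] H} (hT : IsAntipodeInv T) :
    ∑ i, b i * T (a i) = ∑ i, 𝒮 (b i) * a i := by
  have h := congrArg (LinearMap.mul' ℂ H ∘ₗ TensorProduct.map .id T ∘ₗ
    (TensorProduct.comm ℂ H H).toLinearMap) (hR.map_antipode hT)
  simpa [map_sum, hT.left] using h.symm

lemma sum_mul_antipode {T : H →ₗ[ℂ] H} (hT : IsAntipodeInv T) :
    ∑ i, a i * 𝒮 (b i) = 𝒮 (∑ i, 𝒮 (b i) * a i) := by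
  rw [← hR.sum_mul_antipodeInv hT, map_sum]
  simp [antipode_mul_antidistrib, hT.right]

lemma commute_sum_apply_left {g gi : H} (hg : g * gi = 1) (hΔg : Δ g = g ⊗ₜ g)
    {α : Module.Dual ℂ H} (hα : ∀ x y, α (x * y) = α x * α y)
    (hα₁ : α 1 = 1) : g * ∑ i, α (a i) • b i = (∑ i, α (a i) • b i) * g := by
  have h := congrArg (fun X => slice α (TensorProduct.comm ℂ H H X)) (hR.mul_comul g)
  have h0 : α g ≠ 0 := fun h0 => by
    have := hα g gi
    rw [hg, hα₁, h0, zero_mul] at this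
    exact one_ne_zero this
  simp only [hΔg, Finset.sum_mul, Algebra.TensorProduct.tmul_mul_tmul, map_sum,
    TensorProduct.comm_tmul, slice_tmul, Finset.mul_sum, hα] at h
  have h2 : α g • (g * ∑ i, α (a i) • b i) = α g • ((∑ i, α (a i) • b i) * g) := by
    rw [Finset.mul_sum, Finset.sum_mul, Finset.smul_sum, Finset.smul_sum]
    refine Eq.trans ?_ (h.symm.trans ?_)
    · exact Finset.sum_congr rfl fun i _ => by simp [smul_smul]
    · exact Finset.sum_congr rfl fun i _ => by simp [smul_smul, mul_comm]
  exact smul_right_injective H h0 h2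

/-- The two evaluations of `Δ(Λ) R₂₁`. -/
lemma comul_mul_flip_eq_left [FiniteDimensional ℂ H] {T : H →ₗ[ℂ] H} {μ : Module.Dual ℂ H} {Λ : H}
    (hΛ : IsIntPair T μ Λ) : Δ Λ * ∑ i, b i ⊗ₜ[ℂ] a i =
      Δ Λ * (1 ⊗ₜ ((∑ i, 𝒮 (b i) * a i) * ∑ i, μ (Λ * b i) • a i)) := by
  have h := congrArg (LinearMap.mul' ℂ H ∘ₗ (TensorProduct.comm ℂ H H).toLinearMap ∘ₗ
    TensorProduct.map .id (antipode ℂ ∘ₗ slice (μ ∘ₗ LinearMap.mulLeft ℂ Λ) ∘ₗ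
      (TensorProduct.comm ℂ H H).toLinearMap)) hR.comul_right
  simp only [map_sum, TensorProduct.map_tmul, LinearMap.comp_apply, LinearEquiv.coe_coe,
    LinearMap.id_apply, LinearMap.mul'_apply, TensorProduct.comm_tmul, slice_tmul, map_smul,
    LinearMap.mulLeft_apply, ← mul_assoc, smul_mul_assoc] at h
  rw [Finset.sum_mul_sum]
  simp only [mul_smul_comm, ← h, TensorProduct.tmul_sum, Finset.mul_sum]
  refine Finset.sum_congr rfl fun i _ => ?_
  have h1 : b i ⊗ₜ[ℂ] a i = (b i ⊗ₜ 1) * (1 ⊗ₜ a i) := by simp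
  rw [h1, ← mul_assoc, hΛ.comul_mul_tmul_one, mul_assoc]
  simp

lemma comul_mul_flip_eq_right [FiniteDimensional ℂ H] {T : H →ₗ[ℂ] H} {μ : Module.Dual ℂ H}
    {Λ : H} (hΛ : IsIntPair T μ Λ) : Δ Λ * ∑ i, b i ⊗ₜ[ℂ] a i =
      Δ Λ * (((∑ i, T (a i) * b i) * ∑ i, μ (Λ * a i) • b i) ⊗ₜ 1) := by
  have h := congrArg (LinearMap.mul' ℂ H ∘ₗ
    TensorProduct.map (T ∘ₗ slice (μ ∘ₗ LinearMap.mulLeft ℂ Λ)) .id) hR.comul_left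
  simp only [map_sum, TensorProduct.map_tmul, LinearMap.comp_apply,
    LinearMap.id_apply, LinearMap.mul'_apply, slice_tmul, map_smul,
    LinearMap.mulLeft_apply, ← mul_assoc, smul_mul_assoc] at h
  rw [Finset.sum_mul_sum]
  simp only [mul_smul_comm, ← h, TensorProduct.sum_tmul, Finset.mul_sum]
  refine Finset.sum_congr rfl fun i _ => ?_
  have h1 : b i ⊗ₜ[ℂ] a i = (1 ⊗ₜ a i) * (b i ⊗ₜ 1) := by simp
  rw [h1, ← mul_assoc, hΛ.comul_mul_one_tmul, mul_assoc]
  simp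

lemma comm_comul_mul (x : H) : TensorProduct.comm ℂ H H (Δ x * ∑ i, b i ⊗ₜ[ℂ] a i) =
    (∑ i, a i ⊗ₜ[ℂ] b i) * Δ x := by
  rw [hR.mul_comul]
  have h : ∀ X Y : H ⊗[ℂ] H, TensorProduct.comm ℂ H H (X * Y) =
      TensorProduct.comm ℂ H H X * TensorProduct.comm ℂ H H Y :=
    fun X Y => map_mul (Algebra.TensorProduct.comm ℂ H H) X Y
  rw [h, map_sum]
  simp

end IsRMatrix

end Quasitriangular

section Ribbon

variable {H : Type} [Ring H] [HopfAlgebra ℂ H]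

open Coalgebra HopfAlgebra

/-- A factorizable ribbon structure on `H` with R-matrix `Σᵢ aᵢ ⊗ bᵢ`, its inverse `R'`, ribbon
element `v` and its inverse `t`, pivotal element `g` and its inverse `gi`, together with a left
integral form `μ`, the dual left integral `Λ` and the inverse `T` of the antipode. -/
structure IsRibbonData {ι : Type} [Fintype ι] (T : H →ₗ[ℂ] H) (μ : Module.Dual ℂ H) (Λ : H)
    (a b : ι → H) (R' : H ⊗[ℂ] H) (v t g gi : H) : Prop
    extends IsIntPair T μ Λ, IsRMatrix a b R' where
  v_mul_t : v * t = 1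
  t_mul_v : t * v = 1
  v_comm : ∀ x : H, v * x = x * v
  antipode_v : 𝒮 v = v
  comul_v : (∑ i, b i ⊗ₜ[ℂ] a i) * ((∑ i, a i ⊗ₜ[ℂ] b i) * Δ v) = v ⊗ₜ[ℂ] v
  fact : Function.Bijective fun β : Module.Dual ℂ H => ∑ i, ∑ j, β (a i * b j) • (b i * a j)
  g_mul_gi : g * gi = 1
  gi_mul_g : gi * g = 1
  grouplike : Δ g = g ⊗ₜ[ℂ] g
  antipode_antipode_mul : ∀ x : H, 𝒮 (𝒮 x) * g = g * x
  drinfeld : ∑ i, 𝒮 (b i) * a i = g * v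

namespace IsRibbonData

variable {ι : Type} [Fintype ι] {T : H →ₗ[ℂ] H} {μ : Module.Dual ℂ H} {Λ : H}
    {a b : ι → H} {R' : H ⊗[ℂ] H} {v t g gi : H} (h : IsRibbonData T μ Λ a b R' v t g gi)
include h

lemma t_comm (x : H) : t * x = x * t := by
  calc t * x = t * (x * v) * t := by rw [mul_assoc, mul_assoc, h.v_mul_t, mul_one]
    _ = x * t := by rw [← h.v_comm, ← mul_assoc, h.t_mul_v, one_mul]

lemma antipode_t : 𝒮 t = t := by
  have h1 : 𝒮 t * v = 1 := by
    conv_lhs => rw [← h.antipode_v, ← antipode_mul_antidistrib]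
    rw [h.v_mul_t, antipode_one]
  exact left_inv_eq_right_inv h1 h.v_mul_t

lemma inv_v : T v = v := by
  conv_lhs => rw [← h.antipode_v, h.left]

lemma inv_t : T t = t := by
  conv_lhs => rw [← h.antipode_t, h.left]

lemma counit_g : ε g = 1 := by
  have h1 := slice_counit_comul g
  rw [h.grouplike, slice_tmul] at h1
  have h2 := congrArg (· * gi) h1
  simp only [smul_mul_assoc, h.g_mul_gi] at h2
  simpa using congrArg (counit (R := ℂ)) h2

lemma antipode_g : 𝒮 g = gi := by
  have h1 := mul_antipode_rTensor_comul_apply (R := ℂ) g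
  rw [h.grouplike, LinearMap.rTensor_tmul, LinearMap.mul'_apply, h.counit_g, map_one] at h1
  exact left_inv_eq_right_inv h1 h.g_mul_gi

lemma antipode_gi : 𝒮 gi = g := by
  have h1 : gi * 𝒮 gi = 1 := by
    conv_lhs => rw [← h.antipode_g, h.antipode_g]
    rw [← h.antipode_g, ← antipode_mul_antidistrib, h.antipode_g, h.gi_mul_g, antipode_one]
  exact (left_inv_eq_right_inv h.g_mul_gi h1).symm

lemma inv_g : T g = gi := by
  rw [← h.antipode_gi, h.left]

lemma inv_gi : T gi = g := by
  rw [← h.antipode_g, h.left]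

variable [FiniteDimensional ℂ H]

lemma modulus_eq_counit (c : H) : μ (Λ * c) = ε c := by
  have hT := h.toIsAntipodeInv
  have hΛ := h.toIsIntPair
  have hR := h.toIsRMatrix
  set x := ∑ i, μ (Λ * a i) • b i with hx
  set y := ∑ i, μ (Λ * b i) • a i with hy
  have e1 := hR.comm_comul_mul Λ
  have e2 := e1
  rw [hR.comul_mul_flip_eq_left hΛ, hΛ.sum_tmul_mul_comul_left, hR.sum_mul_antipode hT,
    h.drinfeld] at e1
  rw [hR.comul_mul_flip_eq_right hΛ, hΛ.sum_tmul_mul_comul_right, hR.sum_mul_antipodeInv hT,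
    hT.sum_inv_mul, h.drinfeld] at e2
  have hcm : ∀ X Y : H ⊗[ℂ] H, TensorProduct.comm ℂ H H (X * Y) =
      TensorProduct.comm ℂ H H X * TensorProduct.comm ℂ H H Y :=
    fun X Y => map_mul (Algebra.TensorProduct.comm ℂ H H) X Y
  rw [hcm, TensorProduct.comm_tmul] at e1 e2
  replace e2 := congrArg (TensorProduct.comm ℂ H H) e2
  rw [hcm, hcm] at e2
  simp only [TensorProduct.comm_comm, TensorProduct.comm_tmul] at e2
  -- `e1 : flip (ΔΛ) (uy ⊗ 1) = (S(gv) ⊗ 1) ΔΛ`, `e2 : ΔΛ (T(gv) x ⊗ 1) = (gv ⊗ 1) flip (ΔΛ)`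
  have e3 : Δ Λ * ((T (g * v) * x) ⊗ₜ[ℂ] (1 : H)) * ((g * v * y) ⊗ₜ 1) =
      ((g * v) ⊗ₜ 1) * ((𝒮 (g * v)) ⊗ₜ 1) * Δ Λ := by
    rw [e2, mul_assoc, e1, mul_assoc]
  have e4 := congrArg (slice μ) e3
  rw [mul_assoc, Algebra.TensorProduct.tmul_mul_tmul, Algebra.TensorProduct.tmul_mul_tmul,
    one_mul, slice_mul_left, slice_mul_right, LinearMap.mulLeft_one, LinearMap.mulRight_one,
    LinearMap.comp_id, hΛ.slice_comul_self, one_mul, mul_one, hT.map_mul,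
    antipode_mul_antidistrib, h.antipode_g, h.antipode_v, h.inv_v, h.inv_g] at e4
  have hα₁ : μ (Λ * 1) = 1 := by rw [mul_one, hΛ.apply_eq_one]
  have hgx : g * x = x * g := hR.commute_sum_apply_left h.g_mul_gi h.grouplike
    (α := μ ∘ₗ LinearMap.mulLeft ℂ Λ) (fun x y => by simpa using hΛ.modulus_mul x y) hα₁
  have hxy : x * y = 1 := by
    have e5 : t * t * (v * gi * x * (g * v * y)) = t * t * (g * v * (v * gi)) := by rw [e4]
    have l : t * t * (v * gi * x * (g * v * y)) = x * y := by
      calc t * t * (v * gi * x * (g * v * y)) = t * (t * v) * gi * x * (g * v) * y := by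
            simp only [mul_assoc]
        _ = (gi * (x * g)) * t * v * y := by
            rw [h.t_mul_v, mul_one]
            simp only [mul_assoc, h.t_comm]
        _ = x * y := by
            rw [← hgx, ← mul_assoc, h.gi_mul_g, one_mul, mul_assoc x, h.t_mul_v, mul_one]
    have r : t * t * (g * v * (v * gi)) = 1 := by
      calc t * t * (g * v * (v * gi)) = g * t * (t * v) * v * gi := by
            simp only [mul_assoc]
            rw [← mul_assoc t g, h.t_comm g, mul_assoc g t, ← mul_assoc t g, h.t_comm g,
              mul_assoc g t]
        _ = 1 := by rw [h.t_mul_v, mul_one, mul_assoc g, h.t_mul_v, mul_one, h.g_mul_gi]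
    rw [← l, e5, r]
  have hε : (counit (R := ℂ) : Module.Dual ℂ H) = μ ∘ₗ LinearMap.mulLeft ℂ Λ := by
    apply h.fact.1
    have l : ∑ i, ∑ j, ε (a i * b j) • (b i * a j) = 1 := by
      simp only [Bialgebra.counit_mul]
      rw [← one_mul (1 : H)]
      conv_rhs =>
        enter [1]
        rw [← hR.sum_counit_left]
      conv_rhs =>
        enter [2]
        rw [← hR.sum_counit_right]
      rw [Finset.sum_mul_sum]
      simp [smul_smul, mul_comm]
    have r : ∑ i, ∑ j, μ (Λ * (a i * b j)) • (b i * a j) = 1 := by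
      simp only [hΛ.modulus_mul]
      rw [← hxy, hx, hy, Finset.sum_mul_sum]
      simp [smul_smul, mul_comm]
    simpa using l.trans r.symm
  exact (LinearMap.congr_fun hε c).symm

end IsRibbonData

end Ribbon

section Trace

variable {H : Type} [Ring H] [HopfAlgebra ℂ H]

open Coalgebra HopfAlgebra

lemma comm_mul (X Y : H ⊗[ℂ] H) : TensorProduct.comm ℂ H H (X * Y) =
    TensorProduct.comm ℂ H H X * TensorProduct.comm ℂ H H Y :=
  map_mul (Algebra.TensorProduct.comm ℂ H H) X Y

/-- The form `x ↦ μ(g⁻¹ x q)`. -/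
def traceForm (μ : Module.Dual ℂ H) (gi q : H) : Module.Dual ℂ H :=
  μ ∘ₗ LinearMap.mulLeft ℂ gi ∘ₗ LinearMap.mulRight ℂ q

@[simp] lemma traceForm_apply (μ : Module.Dual ℂ H) (gi q x : H) :
    traceForm μ gi q x = μ (gi * (x * q)) := rfl

namespace IsRibbonData

variable {ι : Type} [Fintype ι] {T : H →ₗ[ℂ] H} {μ : Module.Dual ℂ H} {Λ : H}
    {a b : ι → H} {R' : H ⊗[ℂ] H} {v t g gi : H} (h : IsRibbonData T μ Λ a b R' v t g gi)
include h

lemma inv_inv (x : H) : T (T x) = gi * x * g := by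
  have h1 := h.antipode_antipode_mul (T (T x))
  rw [h.right, h.right] at h1
  rw [mul_assoc, h1, ← mul_assoc, h.gi_mul_g, one_mul]

lemma antipode_antipode (x : H) : 𝒮 (𝒮 x) = g * x * gi := by
  rw [← h.antipode_antipode_mul, mul_assoc, h.g_mul_gi, mul_one]

variable [FiniteDimensional ℂ H]

lemma comul_integral_mul_one_tmul (c : H) : Δ Λ * (1 ⊗ₜ c) = Δ Λ * (T c ⊗ₜ 1) := by
  rw [h.comul_mul_one_tmul]
  have : μ ∘ₗ LinearMap.mulLeft ℂ Λ = counit (R := ℂ) := LinearMap.ext h.modulus_eq_counit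
  rw [this, slice_counit_comul]

/-- Quasi-cyclicity of the integral form. -/
lemma apply_mul_eq (x c : H) : μ (x * c) = μ (T (T c) * x) := by
  have h1 : μ ∘ₗ LinearMap.mulRight ℂ c = μ ∘ₗ LinearMap.mulLeft ℂ (T (T c)) := by
    apply h.ext_slice
    have h2 := congrArg (slice μ) (h.comul_integral_mul_one_tmul c)
    rw [slice_mul_right, slice_mul_right, LinearMap.mulRight_one, LinearMap.comp_id,
      h.slice_comul_self, mul_one, one_mul] at h2
    rw [h2, h.slice_mulLeft_comul, h.right]
  exact LinearMap.congr_fun h1 x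

lemma apply_mul_comm (x y : H) : μ (gi * (x * y)) = μ (gi * (y * x)) := by
  rw [← mul_assoc, h.apply_mul_eq, h.inv_inv]
  congr 1
  calc gi * y * g * (gi * x) = gi * y * (g * gi) * x := by simp only [mul_assoc]
    _ = gi * (y * x) := by rw [h.g_mul_gi, mul_one, mul_assoc]

lemma apply_mul_gi (x : H) : μ (x * gi) = μ (gi * x) := by
  rw [h.apply_mul_eq, h.inv_gi, h.inv_g]

lemma apply_conj (x : H) : μ (gi * (gi * x * g)) = μ (gi * x) := by
  rw [h.apply_mul_comm, ← mul_assoc g, h.g_mul_gi, one_mul]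

lemma apply_inv_inv (x : H) : μ (T (T x)) = μ x := by
  have := h.apply_mul_eq 1 x
  rwa [one_mul, mul_one, eq_comm] at this

lemma comm_comul_integral :
    TensorProduct.comm ℂ H H (Δ Λ) = (gi ⊗ₜ 1) * Δ Λ * (gi ⊗ₜ 1) := by
  have e1 := h.comm_comul_mul Λ
  have hy : ∑ i, μ (Λ * b i) • a i = 1 := by
    simp only [h.modulus_eq_counit, h.sum_counit_right]
  rw [h.comul_mul_flip_eq_left h.toIsIntPair, h.sum_tmul_mul_comul_left,
    h.sum_mul_antipode h.toIsAntipodeInv, hy, h.drinfeld, comm_mul, TensorProduct.comm_tmul,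
    mul_one, antipode_mul_antidistrib, h.antipode_g, h.antipode_v] at e1
  have e2 := congrArg (· * ((t * gi) ⊗ₜ[ℂ] (1 : H))) e1
  have l : g * v * (t * gi) = 1 := by
    rw [mul_assoc, ← mul_assoc v, h.v_mul_t, one_mul, h.g_mul_gi]
  simp only [mul_assoc, Algebra.TensorProduct.tmul_mul_tmul, mul_one] at e2
  rw [← mul_assoc g, l, ← Algebra.TensorProduct.one_def, mul_one] at e2
  have hv : (v ⊗ₜ[ℂ] (1 : H)) * Δ Λ = Δ Λ * (v ⊗ₜ 1) := by
    induction Δ Λ with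
    | zero => simp
    | tmul x y => simp [h.v_comm]
    | add X Y hX hY => rw [mul_add, add_mul, hX, hY]
  have e3 : (v * gi) ⊗ₜ[ℂ] (1 : H) = (gi ⊗ₜ 1) * (v ⊗ₜ 1) := by simp [h.v_comm]
  rw [e2, e3, mul_assoc, ← mul_assoc (v ⊗ₜ[ℂ] (1 : H)), hv, mul_assoc (Δ Λ),
    Algebra.TensorProduct.tmul_mul_tmul, ← mul_assoc v, h.v_mul_t, one_mul, one_mul, mul_assoc]

lemma apply_inv (x : H) : μ (T x) = μ (T Λ) * μ (gi * gi * x) := by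
  have hl : T Λ = μ (T Λ) • Λ := h.eq_smul_of_leftIntegral fun c => by
    rw [← h.left c, ← h.map_mul, h.mul_right, h.modulus_eq_counit, map_smul, h.left,
      counit_antipode]
  have e1 := h.comul Λ
  rw [hl, map_smul] at e1
  have e2 := congrArg (fun X => 𝒮 (slice μ X)) e1
  simp only [map_smul, slice_map, h.slice_comul_self, h.right, h.comm_comul_integral,
    antipode_one] at e2
  rw [slice_mul_right, slice_mul_left] at e2
  simp only [LinearMap.mulLeft_one, LinearMap.mulRight_one, LinearMap.comp_id] at e2
  have e3 : μ ∘ₗ T = μ (T Λ) • (μ ∘ₗ LinearMap.mulLeft ℂ (gi * gi)) := by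
    apply h.ext_slice
    rw [slice_smul, h.slice_mulLeft_comul, antipode_mul_antidistrib, h.antipode_gi]
    have e4 := congrArg (fun x => g * x * g) e2
    simp only [mul_smul_comm, smul_mul_assoc, mul_one] at e4
    rw [e4, mul_assoc g, mul_assoc _ gi g, h.gi_mul_g, mul_one, ← mul_assoc, h.g_mul_gi, one_mul]
  exact LinearMap.congr_fun e3 x

lemma apply_gi_mul_inv (x : H) : μ (gi * T x) = μ (T Λ) * μ (gi * x) := by
  rw [← h.inv_g, ← h.map_mul, h.apply_inv, h.inv_g, mul_assoc, ← mul_assoc gi x, h.apply_conj]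

lemma apply_inv_integral_ne_zero : μ (T Λ) ≠ 0 := by
  intro h0
  apply h.ne_zero
  ext x
  have := h.apply_gi_mul_inv (𝒮 (g * x))
  rwa [h0, zero_mul, h.left, ← mul_assoc, h.gi_mul_g, one_mul] at this

/-- The form defining the isomorphism, in terms of the symmetric form `μ(g⁻¹ ?)`. -/
lemma right_integral_form (z : H) : (μ ∘ₗ T) ∘ₗ LinearMap.mulLeft ℂ (g * t * 𝒮 z) =
    μ (T Λ) • traceForm μ gi (t * 𝒮 z) := by
  ext x
  simp only [LinearMap.comp_apply, LinearMap.mulLeft_apply, LinearMap.smul_apply, traceForm_apply,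
    smul_eq_mul]
  rw [← h.apply_gi_mul_inv]
  simp only [h.map_mul, h.inv_g, h.inv_t, h.left]
  rw [← mul_assoc z, ← mul_assoc (T x), h.apply_mul_gi, h.apply_mul_comm]

lemma traceForm_injective {p q : H} (hpq : traceForm μ gi p = traceForm μ gi q) : p = q :=
  h.ext_mul_right fun x => by
    have := LinearMap.congr_fun hpq (g * x)
    simpa only [traceForm_apply, ← mul_assoc, h.gi_mul_g, one_mul] using this

lemma bijOn_traceForm :
    Set.BijOn (traceForm μ gi) {z : H | ∀ x : H, z * x = x * z}
      {φ : Module.Dual ℂ H | IsSLF φ} := by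
  refine ⟨fun q hq x y => ?_, fun p _ q _ => h.traceForm_injective, fun φ hφ => ?_⟩
  · have hq : ∀ x, q * x = x * q := hq
    simp only [traceForm_apply]
    rw [mul_assoc, h.apply_mul_comm, mul_assoc y q x, hq, ← mul_assoc, ← mul_assoc]
    simp only [mul_assoc]
  · obtain ⟨q, hq⟩ := h.exists_mulRight_eq (φ ∘ₗ LinearMap.mulLeft ℂ g)
    have hφ' : ∀ x, φ x = μ (gi * (x * q)) := fun x => by
      rw [← mul_assoc, hq]
      simp [← mul_assoc, h.g_mul_gi]
    refine ⟨q, fun y => ?_, LinearMap.ext fun x => (hφ' x).symm⟩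
    apply h.traceForm_injective
    ext x
    have hs : φ (x * y) = φ (y * x) := hφ x y
    rw [hφ', hφ'] at hs
    simp only [traceForm_apply]
    rw [← mul_assoc x q y, h.apply_mul_comm, ← mul_assoc y, ← hs, mul_assoc]

end IsRibbonData

end Trace

section Transform

variable {H : Type} [Ring H] [HopfAlgebra ℂ H]

open Coalgebra HopfAlgebra

lemma conv_apply (φ ψ : Module.Dual ℂ H) (y : H) : conv φ ψ y = φ (slice ψ (Δ y)) := by
  simp only [conv, LinearMap.comp_apply]
  induction Δ y with
  | zero => simp
  | tmul p q => simp [mul_comm]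
  | add X Y hX hY => simp only [map_add, hX, hY]

lemma slice_comul_slice (φ ψ : Module.Dual ℂ H) (x : H) :
    slice φ (Δ (slice ψ (Δ x))) = slice (conv φ ψ) (Δ x) := by
  have key := sum_map_comul_right_eq (ℛ ℂ x) ((TensorProduct.rid ℂ H).toLinearMap ∘ₗ
    LinearMap.lTensor H (LinearMap.mul' ℂ ℂ ∘ₗ TensorProduct.map φ ψ))
  have key2 : ∀ (X : H ⊗[ℂ] H) (y : H), ((TensorProduct.rid ℂ H).toLinearMap ∘ₗ
    LinearMap.lTensor H (LinearMap.mul' ℂ ℂ ∘ₗ TensorProduct.map φ ψ))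
      (TensorProduct.assoc ℂ H H H (X ⊗ₜ y)) = ψ y • slice φ X := by
    intro X y
    induction X with
    | zero => simp
    | tmul p q => simp [smul_smul, mul_comm]
    | add X Y hX hY => simp only [TensorProduct.add_tmul, map_add, hX, hY, smul_add]
  simp only [key2] at key
  conv_lhs => rw [← (ℛ ℂ x).eq]
  conv_rhs => rw [← (ℛ ℂ x).eq]
  simp only [map_sum, slice_tmul, map_smul, ← key]
  simp [conv]

lemma comm_comul_of_antipode_eq {x : H} (hx : 𝒮 x = x) :
    TensorProduct.comm ℂ H H (Δ x) = TensorProduct.map (antipode ℂ) (antipode ℂ) (Δ x) := by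
  have h1 : ∀ X : H ⊗[ℂ] H, TensorProduct.comm ℂ H H (TensorProduct.map (antipode ℂ) (antipode ℂ)
      (TensorProduct.comm ℂ H H X)) = TensorProduct.map (antipode ℂ) (antipode ℂ) X := by
    intro X
    induction X with
    | zero => simp
    | tmul p q => simp
    | add X Y hX hY => simp only [map_add, hX, hY]
  conv_lhs => rw [← hx, comul_antipode, h1]

omit [HopfAlgebra ℂ H] in
lemma mul_central {c d : H} (hc : ∀ x, c * x = x * c) (hd : ∀ x, d * x = x * d) (x : H) :
    c * d * x = x * (c * d) := by
  rw [mul_assoc, hd, ← mul_assoc, hc, mul_assoc]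

/-- The element `h' μ(h'' c)`. -/
def integralTransform (μ : Module.Dual ℂ H) (h c : H) : H :=
  slice (μ ∘ₗ LinearMap.mulRight ℂ c) (Δ h)

lemma integralTransform_smul (μ : Module.Dual ℂ H) (h : H) (r : ℂ) (c : H) :
    integralTransform μ h (r • c) = r • integralTransform μ h c := by
  rw [integralTransform, integralTransform, ← slice_smul]
  congr 1
  ext x
  simp

namespace IsLeftInt

variable {T : H →ₗ[ℂ] H} {μ : Module.Dual ℂ H} (hμ : IsLeftInt T μ)
include hμ

lemma integralTransform_one (h : H) : integralTransform μ h 1 = μ h • 1 := by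
  rw [integralTransform, LinearMap.mulRight_one, LinearMap.comp_id, hμ.slice_comul]

lemma integralTransform_eq (h c : H) :
    integralTransform μ h c = T (slice (μ ∘ₗ LinearMap.mulLeft ℂ h) (Δ c)) := by
  rw [← hμ.slice_comul_mul, slice_mul_right, mul_one, integralTransform]

end IsLeftInt

namespace IsRibbonData

variable {ι : Type} [Fintype ι] {T : H →ₗ[ℂ] H} {μ : Module.Dual ℂ H} {Λ : H}
    {a b : ι → H} {R' : H ⊗[ℂ] H} {v t g gi : H} (h : IsRibbonData T μ Λ a b R' v t g gi)
include h

lemma antipode_antipode_of_central {c : H} (hc : ∀ x, c * x = x * c) : 𝒮 (𝒮 c) = c := by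
  rw [h.antipode_antipode, ← hc, mul_assoc, h.g_mul_gi, mul_one]

lemma antipode_central {c : H} (hc : ∀ x, c * x = x * c) (x : H) : 𝒮 c * x = x * 𝒮 c := by
  rw [← h.right x, ← antipode_mul_antidistrib, ← antipode_mul_antidistrib, hc]

lemma Ta_traceForm (q : H) : Ta t (traceForm μ gi q) = traceForm μ gi (t * q) := by
  ext x
  simp only [Ta, LinearMap.comp_apply, LinearMap.mulLeft_apply, traceForm_apply]
  rw [h.t_comm, mul_assoc]

variable [FiniteDimensional ℂ H]

lemma apply_inv_mul (p y : H) : μ (T p * y) = μ (y * 𝒮 p) := by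
  rw [h.apply_mul_eq y, h.left]

lemma slice_inv_mul {c : H} (hc : ∀ x, c * x = x * c) (p : H) (X : H ⊗[ℂ] H) :
    slice (μ ∘ₗ LinearMap.mulRight ℂ c) ((1 ⊗ₜ T p) * X) =
      slice (μ ∘ₗ LinearMap.mulRight ℂ c) (X * (1 ⊗ₜ 𝒮 p)) := by
  have e : (μ ∘ₗ LinearMap.mulRight ℂ c) ∘ₗ LinearMap.mulLeft ℂ (T p) =
      (μ ∘ₗ LinearMap.mulRight ℂ c) ∘ₗ LinearMap.mulRight ℂ (𝒮 p) := by
    ext x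
    simp only [LinearMap.comp_apply, LinearMap.mulRight_apply, LinearMap.mulLeft_apply]
    rw [mul_assoc, h.apply_inv_mul, mul_assoc, mul_assoc, hc]
  rw [slice_mul_left, slice_mul_right, one_mul, mul_one, e]

lemma integralTransform_central {d c : H} (hd : ∀ x, d * x = x * d) (hc : ∀ x, c * x = x * c)
    (x : H) : integralTransform μ d c * x = x * integralTransform μ d c := by
  have e1 : integralTransform μ d c * x =
      slice (μ ∘ₗ LinearMap.mulRight ℂ c) (Δ d * (x ⊗ₜ 1)) := by
    rw [slice_mul_right, LinearMap.mulRight_one, LinearMap.comp_id, integralTransform]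
  have e2 : x * integralTransform μ d c =
      slice (μ ∘ₗ LinearMap.mulRight ℂ c) ((x ⊗ₜ 1) * Δ d) := by
    rw [slice_mul_left, LinearMap.mulLeft_one, LinearMap.comp_id, integralTransform]
  rw [← sum_comul_mul_antipode (ℛ ℂ x), Finset.mul_sum, map_sum] at e1
  rw [← h.sum_inv_mul_comul (ℛ ℂ x), Finset.sum_mul, map_sum] at e2
  rw [e1, e2]
  refine Finset.sum_congr rfl fun i _ => ?_
  rw [mul_assoc, h.slice_inv_mul hc, ← Bialgebra.comul_mul, ← mul_assoc, ← Bialgebra.comul_mul, hd]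

lemma apply_v_mul_antipode (p : H) : μ (v * 𝒮 p) = μ (v * T p) := by
  rw [← h.apply_inv_inv]
  simp only [h.map_mul, h.left, h.inv_v]

lemma conv_traceForm (q y : H) :
    conv (μ ∘ₗ LinearMap.mulLeft ℂ (gi * v)) (traceForm μ gi q) y =
      traceForm μ gi (integralTransform μ v (𝒮 q)) y := by
  have e1 : traceForm μ gi q = μ ∘ₗ LinearMap.mulRight ℂ (q * gi) := by
    ext z
    simp [← h.apply_mul_gi, mul_assoc]
  have e2 : (μ ∘ₗ LinearMap.mulLeft ℂ y) ∘ₗ LinearMap.mulRight ℂ gi =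
      μ ∘ₗ LinearMap.mulLeft ℂ (gi * y) := by
    ext z
    simp only [LinearMap.comp_apply, LinearMap.mulRight_apply, LinearMap.mulLeft_apply]
    rw [← mul_assoc, h.apply_mul_gi, mul_assoc]
  have e3 : Δ gi = gi ⊗ₜ gi := by
    rw [← h.antipode_g, comul_antipode, h.grouplike]
    simp
  have e4 := h.integralTransform_eq y (q * gi)
  rw [Bialgebra.comul_mul, e3, slice_mul_right, e2, h.map_mul, h.inv_gi] at e4
  have e5 : ∀ X : H ⊗[ℂ] H, ∀ β : Module.Dual ℂ H, μ (v * T (slice β X)) =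
      β (slice (μ ∘ₗ LinearMap.mulLeft ℂ v ∘ₗ antipode ℂ) (TensorProduct.comm ℂ H H X)) := by
    intro X β
    induction X with
    | zero => simp
    | tmul p q => simp [h.apply_v_mul_antipode, mul_comm]
    | add X Y hX hY => simp only [map_add, mul_add, hX, hY]
  have e6 : ∀ X : H ⊗[ℂ] H, T (slice (μ ∘ₗ LinearMap.mulLeft ℂ v)
      (TensorProduct.map (antipode ℂ) (antipode ℂ) X)) =
      slice (μ ∘ₗ LinearMap.mulLeft ℂ v ∘ₗ antipode ℂ) X := by
    intro X
    rw [slice_map, h.left]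
    rfl
  rw [conv_apply, e1, ← integralTransform, e4]
  simp only [LinearMap.comp_apply, LinearMap.mulLeft_apply, traceForm_apply]
  rw [h.integralTransform_eq, comul_antipode, e6]
  have e7 : ∀ X : H, gi * v * (g * X) = v * X := fun X => by
    rw [← h.v_comm, mul_assoc, ← mul_assoc gi, h.gi_mul_g, one_mul]
  rw [e7, e5]
  simp

lemma Tb_traceForm (q : H) : Tb μ v t gi (traceForm μ gi q) =
    (μ v)⁻¹ • traceForm μ gi (t * integralTransform μ v (𝒮 (v * q))) := by
  have e1 : traceForm μ gi q ∘ₗ LinearMap.mulLeft ℂ v = traceForm μ gi (v * q) := by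
    ext x
    simp only [LinearMap.comp_apply, LinearMap.mulLeft_apply, traceForm_apply]
    rw [h.v_comm, mul_assoc]
  rw [Tb, e1]
  congr 1
  ext x
  rw [LinearMap.comp_apply, LinearMap.mulLeft_apply, h.conv_traceForm, traceForm_apply,
    traceForm_apply, h.t_comm, mul_assoc]

end IsRibbonData

end Transform

section Monodromy

variable {H : Type} [Ring H] [HopfAlgebra ℂ H]

open Coalgebra HopfAlgebra

lemma IsRMatrix.slice_monodromy {ι : Type} [Fintype ι] {a b : ι → H} {R' : H ⊗[ℂ] H}
    (hR : IsRMatrix a b R') {μ β : Module.Dual ℂ H} {D : H}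
    (hμ : ∀ x, slice μ (Δ x) = μ x • (1 : H))
    (hD : ∑ i, ∑ j, μ (a i * b j) • (b i * a j) = D) (hc : ∀ x, D * x = x * D) :
    (∑ i, ∑ j, β (a i * b j) • (b i * a j)) * D = β 1 • D := by
  have h1 : ∑ i, b i ⊗ₜ[ℂ] Δ (a i) = ∑ i, ∑ j, (b i * b j) ⊗ₜ[ℂ] (a i ⊗ₜ[ℂ] a j) := by
    simpa [map_sum] using congrArg (TensorProduct.comm ℂ (H ⊗[ℂ] H) H) hR.comul_left
  have h2 := congrArg (fun X => (TensorProduct.rid ℂ H) (LinearMap.lTensor H (β ∘ₗ slice μ)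
    (X * ∑ i, a i ⊗ₜ[ℂ] Δ (b i)))) h1
  conv_rhs at h2 => rw [hR.comul_right]
  simp only [Finset.sum_mul, Finset.mul_sum, map_sum, Algebra.TensorProduct.tmul_mul_tmul,
    LinearMap.lTensor_tmul, TensorProduct.rid_tmul, LinearMap.comp_apply, slice_tmul,
    ← Bialgebra.comul_mul, hμ, map_smul, smul_eq_mul] at h2
  rw [Finset.sum_comm] at hD
  have h3 : β 1 • D = ∑ j, ∑ i, (μ (a i * b j) * β 1) • (b i * a j) := by
    rw [← hD]
    simp only [Finset.smul_sum, smul_smul, mul_comm]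
  rw [h3, h2, Finset.sum_mul, Finset.sum_comm]
  simp only [Finset.sum_mul]
  rw [Finset.sum_comm]
  refine Finset.sum_congr rfl fun j _ => ?_
  rw [Finset.sum_comm]
  refine Finset.sum_congr rfl fun k _ => ?_
  rw [smul_mul_assoc, mul_assoc, ← hc, ← hD]
  simp only [Finset.sum_mul, Finset.mul_sum, Finset.smul_sum]
  refine Finset.sum_congr rfl fun i _ => Finset.sum_congr rfl fun l _ => ?_
  simp only [smul_mul_assoc, mul_smul_comm, smul_smul, mul_assoc, mul_comm]

namespace IsRibbonData

variable {ι : Type} [Fintype ι] {T : H →ₗ[ℂ] H} {μ : Module.Dual ℂ H} {Λ : H}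
    {a b : ι → H} {R' : H ⊗[ℂ] H} {v t g gi : H} (h : IsRibbonData T μ Λ a b R' v t g gi)
include h

lemma comul_v_mul_comul_t : Δ v * Δ t = 1 := by
  rw [← Bialgebra.comul_mul, h.v_mul_t, Bialgebra.comul_one]

lemma monodromy_eq : (∑ i, b i ⊗ₜ[ℂ] a i) * (∑ i, a i ⊗ₜ[ℂ] b i) = (v ⊗ₜ v) * Δ t := by
  rw [← h.comul_v, mul_assoc, mul_assoc, h.comul_v_mul_comul_t, mul_one]

lemma sum_apply_smul (β : Module.Dual ℂ H) : ∑ i, ∑ j, β (a i * b j) • (b i * a j) =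
    v * slice (β ∘ₗ LinearMap.mulLeft ℂ v) (Δ t) := by
  rw [← slice_mul_left, ← h.monodromy_eq, Finset.sum_mul_sum]
  simp

variable [FiniteDimensional ℂ H] in
/-- The form `μ(v ?)` is sent to a multiple of the integral. -/
lemma integralTransform_t_v : ∃ r : ℂ, integralTransform μ t v = r • Λ := by
  have e0 : μ ∘ₗ LinearMap.mulLeft ℂ v = μ ∘ₗ LinearMap.mulRight ℂ v := by
    ext x
    simp [h.v_comm]
  have e1 := h.sum_apply_smul μ
  rw [e0, ← integralTransform] at e1
  have hc := mul_central h.v_comm (h.integralTransform_central h.t_comm h.v_comm)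
  have e2 : ∀ c, c * (v * integralTransform μ t v) = ε c • (v * integralTransform μ t v) := by
    intro c
    obtain ⟨β, rfl⟩ := h.fact.2 c
    simp only
    rw [h.slice_monodromy h.slice_comul e1 hc]
    congr 1
    have h1 : β ((∑ i, ε (b i) • a i) * ∑ i, ε (a i) • b i) = β 1 := by
      rw [h.sum_counit_left, h.sum_counit_right, mul_one]
    rw [← h1, Finset.sum_mul_sum]
    simp only [map_sum, map_smul, smul_eq_mul, smul_mul_assoc, mul_smul_comm,
      Bialgebra.counit_mul]
    exact Finset.sum_congr rfl fun i _ => Finset.sum_congr rfl fun j _ => by ring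
  have e3 := h.eq_smul_of_leftIntegral e2
  have e4 := e2 t
  rw [← mul_assoc, h.t_mul_v, one_mul] at e4
  exact ⟨_, e4.trans (by rw [e3, smul_smul])⟩

variable [FiniteDimensional ℂ H] in
lemma integralTransform_integral (z : H) : integralTransform μ Λ z = T z := by
  have h2 := congrArg (slice μ) (h.comul_integral_mul_one_tmul z)
  rwa [slice_mul_right, slice_mul_right, LinearMap.mulRight_one, LinearMap.comp_id,
    h.slice_comul_self, mul_one, one_mul] at h2

lemma antipode_integralTransform_integralTransform (z : H) :
    𝒮 (integralTransform μ t (𝒮 (integralTransform μ v z))) =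
      𝒮 (integralTransform μ (integralTransform μ t v) z) := by
  congr 1
  conv_rhs => rw [integralTransform, integralTransform, slice_comul_slice]
  rw [integralTransform]
  have key : μ ∘ₗ LinearMap.mulRight ℂ (𝒮 (integralTransform μ v z)) =
      conv (μ ∘ₗ LinearMap.mulRight ℂ z) (μ ∘ₗ LinearMap.mulRight ℂ v) := by
    ext y
    rw [conv_apply, ← integralTransform, h.integralTransform_eq y v, integralTransform]
    simp only [LinearMap.comp_apply, LinearMap.mulRight_apply]
    have e1 : ∀ X : H ⊗[ℂ] H, μ (y * 𝒮 (slice (μ ∘ₗ LinearMap.mulRight ℂ z) X)) =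
        μ (T (slice (μ ∘ₗ LinearMap.mulLeft ℂ y) (TensorProduct.comm ℂ H H
          (TensorProduct.map (antipode ℂ) (antipode ℂ) X))) * z) := by
      intro X
      induction X with
      | zero => simp
      | tmul p q => simp [h.left, mul_comm]
      | add X Y hX hY => simp only [map_add, mul_add, add_mul, hX, hY]
    rw [e1, ← comm_comul_of_antipode_eq h.antipode_v, TensorProduct.comm_comm]
  rw [key]

variable [FiniteDimensional ℂ H] in
/-- The two transforms attached to `v` and `v⁻¹` are mutually inverse up to a scalar. -/
lemma antipode_transform_antipode_transform (z : H) :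
    𝒮 (integralTransform μ t (𝒮 (integralTransform μ v z))) = (μ v * μ t) • z := by
  obtain ⟨r, hr⟩ := h.integralTransform_t_v
  have key : ∀ z, 𝒮 (integralTransform μ t (𝒮 (integralTransform μ v z))) = r • z := by
    intro z
    rw [h.antipode_integralTransform_integralTransform, hr]
    have : integralTransform μ (r • Λ) z = r • integralTransform μ Λ z := by
      simp [integralTransform]
    rw [this, h.integralTransform_integral, map_smul, h.right]
  have h1 := key 1
  rw [h.integralTransform_one, map_smul, antipode_one, integralTransform_smul,
    h.integralTransform_one, map_smul, map_smul, antipode_one, smul_smul] at h1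
  have hr' : r = μ v * μ t := by
    have := congrArg (counit (R := ℂ)) h1
    simpa using this.symm
  rw [key, hr']

end IsRibbonData

end Monodromy

section LyubashenkoMajid

variable {H : Type} [Ring H] [HopfAlgebra ℂ H]

open Coalgebra HopfAlgebra

lemma Ta_smul (t : H) (r : ℂ) (φ : Module.Dual ℂ H) : Ta t (r • φ) = r • Ta t φ := rfl

lemma Tb_smul (μ : Module.Dual ℂ H) (v t gi : H) (r : ℂ) (φ : Module.Dual ℂ H) :
    Tb μ v t gi (r • φ) = r • Tb μ v t gi φ := by
  simp only [Tb, conv, LinearMap.smul_comp, TensorProduct.map_smul_right, LinearMap.comp_smul,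
    smul_comm r]

/-- The Lyubashenko–Majid operator on the center, in terms of the ribbon element. -/
def ribbonTransform (μ : Module.Dual ℂ H) (v t z : H) : H :=
  t * integralTransform μ v (t * z)

lemma ribbonTransform_smul (μ : Module.Dual ℂ H) (v t : H) (r : ℂ) (z : H) :
    ribbonTransform μ v t (r • z) = r • ribbonTransform μ v t z := by
  simp only [ribbonTransform, mul_smul_comm, integralTransform_smul]

namespace IsRibbonData

variable {ι : Type} [Fintype ι] {T : H →ₗ[ℂ] H} {μ : Module.Dual ℂ H} {Λ : H}
    {a b : ι → H} {R' : H ⊗[ℂ] H} {v t g gi : H} (h : IsRibbonData T μ Λ a b R' v t g gi)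
include h

lemma inv_mul_comm_inv : R' * TensorProduct.comm ℂ H H R' = Δ v * (t ⊗ₜ t) := by
  have e1 : (R' * TensorProduct.comm ℂ H H R') *
      ((∑ i, b i ⊗ₜ[ℂ] a i) * (∑ i, a i ⊗ₜ[ℂ] b i)) = 1 := by
    have e2 : TensorProduct.comm ℂ H H R' * ∑ i, b i ⊗ₜ[ℂ] a i = 1 := by
      have := congrArg (TensorProduct.comm ℂ H H) h.inv_mul
      rw [comm_mul] at this
      simpa [map_sum, Algebra.TensorProduct.one_def] using this
    rw [mul_assoc, ← mul_assoc _ _ (∑ i, a i ⊗ₜ[ℂ] b i), e2, one_mul, h.inv_mul]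
  refine left_inv_eq_right_inv e1 ?_
  rw [← mul_assoc, mul_assoc _ _ (Δ v), h.comul_v, Algebra.TensorProduct.tmul_mul_tmul, h.v_mul_t,
    ← Algebra.TensorProduct.one_def]

lemma mul_comm_monodromy : (∑ i, a i ⊗ₜ[ℂ] b i) * (∑ i, b i ⊗ₜ[ℂ] a i) =
    (v ⊗ₜ v) * TensorProduct.map (antipode ℂ) (antipode ℂ) (Δ t) := by
  have := congrArg (TensorProduct.comm ℂ H H) h.monodromy_eq
  rw [comm_mul, comm_mul, comm_comul_of_antipode_eq h.antipode_t] at this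
  simpa [map_sum] using this

lemma slice_inv_mul_comm_inv (z : H) :
    slice (μ ∘ₗ LinearMap.mulRight ℂ z) (R' * TensorProduct.comm ℂ H H R') =
      integralTransform μ v (t * z) * t := by
  rw [h.inv_mul_comm_inv, slice_mul_right, integralTransform]
  congr 3
  ext x
  simp [mul_assoc]

lemma v_mul_v_mul_antipode (q : H) : v * (v * 𝒮 (t * (t * q))) = 𝒮 q := by
  rw [antipode_mul_antidistrib, antipode_mul_antidistrib, h.antipode_t, ← h.t_comm (_ * _),
    ← h.t_comm (𝒮 q), ← mul_assoc v t, h.v_mul_t, one_mul, ← mul_assoc, h.v_mul_t, one_mul]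

variable [FiniteDimensional ℂ H]

lemma slice_inv_mul_comm_inv' {z : H} (hz : ∀ x, z * x = x * z) :
    slice (μ ∘ₗ LinearMap.mulRight ℂ z) (R' * TensorProduct.comm ℂ H H R') =
      v * 𝒮 (integralTransform μ t (v * z)) := by
  have e1 : slice (μ ∘ₗ LinearMap.mulRight ℂ z) (R' * TensorProduct.comm ℂ H H R') =
      slice ((μ ∘ₗ LinearMap.mulRight ℂ z) ∘ₗ antipode ℂ)
        ((∑ i, a i ⊗ₜ[ℂ] b i) * (∑ i, b i ⊗ₜ[ℂ] a i)) := by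
    conv_lhs =>
      enter [2, 1]
      rw [h.inv_eq_antipodeInv h.toIsAntipodeInv]
    rw [h.inv_eq_antipode]
    simp only [map_sum, TensorProduct.comm_tmul, Finset.sum_mul_sum,
      Algebra.TensorProduct.tmul_mul_tmul, slice_tmul, LinearMap.comp_apply,
      LinearMap.mulRight_apply, antipode_mul_antidistrib]
    refine Finset.sum_congr rfl fun i _ => Finset.sum_congr rfl fun j _ => ?_
    rw [mul_assoc, h.apply_inv_mul, mul_assoc, mul_assoc, hz]
  have hvz := mul_central h.v_comm hz
  rw [e1, h.mul_comm_monodromy, slice_mul_left, slice_map, integralTransform]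
  congr 4
  ext x
  simp only [LinearMap.comp_apply, LinearMap.mulLeft_apply, LinearMap.mulRight_apply]
  rw [antipode_mul_antidistrib, h.antipode_v, mul_assoc]
  conv_lhs => rw [← h.antipode_antipode_of_central hvz]
  rw [← antipode_mul_antidistrib, ← antipode_mul_antidistrib, ← hvz, ← h.apply_inv_inv, h.left,
    h.left]

lemma mul_ribbonTransform_eq {w : H} (hw : ∀ x, w * x = x * w) :
    v * ribbonTransform μ v t (t * w) = v * (v * 𝒮 (integralTransform μ t w)) := by
  have htw := mul_central h.t_comm hw
  rw [ribbonTransform, h.t_comm, ← h.slice_inv_mul_comm_inv, h.slice_inv_mul_comm_inv' htw,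
    ← mul_assoc v t, h.v_mul_t, one_mul]

lemma ribbonTransform_central {z : H} (hz : ∀ x, z * x = x * z) (x : H) :
    ribbonTransform μ v t z * x = x * ribbonTransform μ v t z :=
  mul_central h.t_comm (h.integralTransform_central h.v_comm (mul_central h.t_comm hz)) x

lemma ribbonTransform_antipode_ribbonTransform {z : H} (hz : ∀ x, z * x = x * z) :
    ribbonTransform μ v t (𝒮 (ribbonTransform μ v t z)) = (μ v * μ t) • z := by
  have hw := h.antipode_central
    (h.integralTransform_central h.v_comm (mul_central h.t_comm hz))
  have e1 := h.mul_ribbonTransform_eq hw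
  rw [h.antipode_transform_antipode_transform] at e1
  have e2 : 𝒮 (ribbonTransform μ v t z) = t * 𝒮 (integralTransform μ v (t * z)) := by
    rw [ribbonTransform, antipode_mul_antidistrib, h.antipode_t, ← h.t_comm (𝒮 _)]
  have e3 := congrArg (t * ·) e1
  simp only [← mul_assoc, h.t_mul_v, one_mul] at e3
  rw [e2, e3, mul_smul_comm, ← mul_assoc, h.v_mul_t, one_mul]

lemma ribbonTransform_antipode {z : H} (hz : ∀ x, z * x = x * z) (hκ : μ v * μ t ≠ 0) :
    ribbonTransform μ v t (𝒮 z) = 𝒮 (ribbonTransform μ v t z) := by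
  have hFz := h.antipode_central (h.ribbonTransform_central hz)
  have e1 := h.ribbonTransform_antipode_ribbonTransform hFz
  rw [h.ribbonTransform_antipode_ribbonTransform hz, map_smul, ribbonTransform_smul] at e1
  exact smul_right_injective H hκ e1

lemma ribbonTransform_ribbonTransform {z : H} (hz : ∀ x, z * x = x * z) (hκ : μ v * μ t ≠ 0) :
    ribbonTransform μ v t (ribbonTransform μ v t z) = (μ v * μ t) • 𝒮 z := by
  rw [← h.ribbonTransform_antipode_ribbonTransform (h.antipode_central hz),
    h.ribbonTransform_antipode hz hκ,
    h.antipode_antipode_of_central (h.ribbonTransform_central hz)]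

lemma Tb_traceForm_eq (q : H) : Tb μ v t gi (traceForm μ gi q) =
    (μ v)⁻¹ • traceForm μ gi (ribbonTransform μ v t (v * (v * 𝒮 q))) := by
  rw [h.Tb_traceForm, antipode_mul_antidistrib, h.antipode_v, ribbonTransform,
    ← mul_assoc t v, h.t_mul_v, one_mul, h.v_comm]

lemma bijOn_Ta : Set.BijOn (Ta t) {φ : Module.Dual ℂ H | IsSLF φ} {φ | IsSLF φ} := by
  have hbij := h.bijOn_traceForm
  refine ⟨fun φ hφ => ?_, fun φ _ ψ _ hφψ => ?_, fun φ hφ => ?_⟩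
  · obtain ⟨q, hq, rfl⟩ := hbij.surjOn hφ
    rw [h.Ta_traceForm]
    exact hbij.mapsTo (mul_central h.t_comm hq)
  · ext x
    have := LinearMap.congr_fun hφψ (v * x)
    simpa [Ta, ← mul_assoc, h.t_mul_v] using this
  · obtain ⟨q, hq, rfl⟩ := hbij.surjOn hφ
    refine ⟨_, hbij.mapsTo (mul_central h.v_comm hq), ?_⟩
    rw [h.Ta_traceForm, ← mul_assoc, h.t_mul_v, one_mul]

lemma bijOn_Tb (hv : μ v ≠ 0) (ht : μ t ≠ 0) :
    Set.BijOn (Tb μ v t gi) {φ : Module.Dual ℂ H | IsSLF φ} {φ | IsSLF φ} := by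
  have hbij := h.bijOn_traceForm
  have hκ := mul_ne_zero hv ht
  have hvv : ∀ {q : H}, (∀ x, q * x = x * q) → ∀ x, v * (v * 𝒮 q) * x = x * (v * (v * 𝒮 q)) :=
    fun hq => mul_central h.v_comm (mul_central h.v_comm (h.antipode_central hq))
  refine ⟨fun φ hφ => ?_, fun φ hφ ψ hψ hφψ => ?_, fun φ hφ => ?_⟩
  · obtain ⟨q, hq, rfl⟩ := hbij.surjOn hφ
    rw [h.Tb_traceForm_eq]
    intro x y
    have := hbij.mapsTo (h.ribbonTransform_central (hvv hq)) x y
    simp only [LinearMap.smul_apply, this]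
  · obtain ⟨p, hp, rfl⟩ := hbij.surjOn hφ
    obtain ⟨q, hq, rfl⟩ := hbij.surjOn hψ
    rw [h.Tb_traceForm_eq, h.Tb_traceForm_eq] at hφψ
    have e1 := h.traceForm_injective (smul_right_injective _ (inv_ne_zero hv) hφψ)
    have e2 := congrArg (fun y => ribbonTransform μ v t (𝒮 y)) e1
    simp only [h.ribbonTransform_antipode_ribbonTransform (hvv hp),
      h.ribbonTransform_antipode_ribbonTransform (hvv hq)] at e2
    have e3 := congrArg (fun y => t * (t * y)) (smul_right_injective H hκ e2)
    have e4 : ∀ y, t * (t * (v * (v * y))) = y := fun y => by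
      rw [← mul_assoc t v, h.t_mul_v, one_mul, ← mul_assoc, h.t_mul_v, one_mul]
    simp only [e4] at e3
    rw [h.inj e3]
  · obtain ⟨p, hp, rfl⟩ := hbij.surjOn hφ
    have hFp := h.ribbonTransform_central hp
    refine ⟨traceForm μ gi ((μ t)⁻¹ • (t * (t * ribbonTransform μ v t p))),
      hbij.mapsTo fun x => ?_, ?_⟩
    · rw [smul_mul_assoc, mul_smul_comm, mul_central h.t_comm (mul_central h.t_comm hFp)]
    · rw [h.Tb_traceForm_eq, map_smul, mul_smul_comm, mul_smul_comm, h.v_mul_v_mul_antipode,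
        ribbonTransform_smul, h.ribbonTransform_antipode_ribbonTransform hp, smul_smul, mul_comm,
        mul_assoc, mul_inv_cancel₀ ht, mul_one]
      ext x
      simp [inv_mul_cancel_left₀ hv]

lemma Ta_Tb_Ta_traceForm (hv : μ v ≠ 0) (ht : μ t ≠ 0) {z : H} (hz : ∀ x, z * x = x * z) :
    Ta t (Tb μ v t gi (Ta t (traceForm μ gi (t * 𝒮 (ribbonTransform μ v t z))))) =
      μ t • traceForm μ gi (t * 𝒮 z) := by
  rw [h.Ta_traceForm, h.Tb_traceForm_eq, h.v_mul_v_mul_antipode,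
    h.antipode_antipode_of_central (h.ribbonTransform_central hz),
    h.ribbonTransform_ribbonTransform hz (mul_ne_zero hv ht), Ta_smul, h.Ta_traceForm]
  ext x
  simp [inv_mul_cancel_left₀ hv, mul_assoc]

lemma bijOn_right_integral_form :
    Set.BijOn (fun z => (μ ∘ₗ T) ∘ₗ LinearMap.mulLeft ℂ (g * t * 𝒮 z))
      {z : H | ∀ x : H, z * x = x * z} {φ : Module.Dual ℂ H | IsSLF φ} := by
  have hbij := h.bijOn_traceForm
  have hk := h.apply_inv_integral_ne_zero
  refine ⟨fun z hz x y => ?_, fun z _ w _ hzw => ?_, fun φ hφ => ?_⟩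
  · have := hbij.mapsTo (mul_central h.t_comm (h.antipode_central hz)) x y
    simp only [h.right_integral_form, LinearMap.smul_apply, this]
  · simp only [h.right_integral_form] at hzw
    have e1 := h.traceForm_injective (smul_right_injective _ hk hzw)
    have e2 := congrArg (v * ·) e1
    simp only [← mul_assoc, h.v_mul_t, one_mul] at e2
    exact h.inj e2
  · obtain ⟨q, hq, rfl⟩ := hbij.surjOn hφ
    refine ⟨(μ (T Λ))⁻¹ • (v * 𝒮 q), fun x => ?_, ?_⟩
    · rw [smul_mul_assoc, mul_smul_comm, mul_central h.v_comm (h.antipode_central hq)]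
    · simp only [h.right_integral_form]
      rw [map_smul, antipode_mul_antidistrib, h.antipode_antipode_of_central hq, h.antipode_v,
        mul_smul_comm, ← h.v_comm, ← mul_assoc, h.t_mul_v, one_mul]
      ext x
      simp [mul_inv_cancel_left₀ hk]

end IsRibbonData

lemma SLM_eq_slice {κ : Type} [Fintype κ] (c d : κ → H) (μ : Module.Dual ℂ H) {z : H}
    (hz : ∀ x, z * x = x * z) : SLM c d μ z = slice (μ ∘ₗ LinearMap.mulRight ℂ z)
      ((∑ i, c i ⊗ₜ[ℂ] d i) * TensorProduct.comm ℂ H H (∑ i, c i ⊗ₜ[ℂ] d i)) := by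
  simp only [SLM, map_sum, TensorProduct.comm_tmul, Finset.sum_mul_sum,
    Algebra.TensorProduct.tmul_mul_tmul, slice_tmul, LinearMap.comp_apply, LinearMap.mulRight_apply]
  simp only [mul_assoc, hz]

end LyubashenkoMajid

theorem equivalence_with_Lyubashenko_Majid
    {H : Type} [Ring H] [HopfAlgebra ℂ H] [FiniteDimensional ℂ H]
    -- the antipode is invertible
    (Sinv : H →ₗ[ℂ] H)
    (hSinv₁ : ∀ x : H, Sinv (HopfAlgebra.antipode (R := ℂ) x) = x)
    (hSinv₂ : ∀ x : H, HopfAlgebra.antipode (R := ℂ) (Sinv x) = x)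
    -- an invertible R-matrix `R = Σᵢ aᵢ ⊗ bᵢ`
    {ι : Type} [Fintype ι] (aR bR : ι → H)
    (hRinv : IsUnit (∑ i, aR i ⊗ₜ[ℂ] bR i : H ⊗[ℂ] H))
    -- `R Δ(x) = Δᵒᵖ(x) R`
    (hRΔ : ∀ x : H,
      (∑ i, aR i ⊗ₜ[ℂ] bR i) * Coalgebra.comul (R := ℂ) x
        = (TensorProduct.comm ℂ H H) (Coalgebra.comul (R := ℂ) x)
            * ∑ i, aR i ⊗ₜ[ℂ] bR i)
    -- `(Δ ⊗ id)(R) = R₁₃ R₂₃`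
    (hR₁ : (∑ i, (Coalgebra.comul (R := ℂ) (aR i)) ⊗ₜ[ℂ] bR i)
        = ∑ i, ∑ j, (aR i ⊗ₜ[ℂ] aR j) ⊗ₜ[ℂ] (bR i * bR j))
    -- `(id ⊗ Δ)(R) = R₁₃ R₁₂`
    (hR₂ : (∑ i, aR i ⊗ₜ[ℂ] (Coalgebra.comul (R := ℂ) (bR i)))
        = ∑ i, ∑ j, (aR i * aR j) ⊗ₜ[ℂ] (bR j ⊗ₜ[ℂ] bR i))
    -- a ribbon element `v`
    (v vinv : H) (hv₁ : v * vinv = 1) (hv₂ : vinv * v = 1)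
    (hvcentral : ∀ x : H, v * x = x * v)
    (hSv : HopfAlgebra.antipode (R := ℂ) v = v)
    (hεv : Coalgebra.counit (R := ℂ) v = 1)
    -- `Δ(v) = (R'R)⁻¹ (v ⊗ v)`, i.e. `R' R Δ(v) = v ⊗ v`
    (hΔv : (∑ i, bR i ⊗ₜ[ℂ] aR i) * ((∑ i, aR i ⊗ₜ[ℂ] bR i)
            * Coalgebra.comul (R := ℂ) v) = v ⊗ₜ[ℂ] v)
    -- factorizability: `β ↦ (β ⊗ id)(RR')` is bijective
    (hfact : Function.Bijective fun β : Module.Dual ℂ H =>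
        ∑ i, ∑ j, β (aR i * bR j) • (bR i * aR j))
    -- the pivotal element `g = u v⁻¹`, where `u = Σᵢ S(bᵢ) aᵢ` is the Drinfeld element;
    -- `g` is invertible, grouplike and implements `S²`
    (g gi : H)
    (hg : g = (∑ i, HopfAlgebra.antipode (R := ℂ) (bR i) * aR i) * vinv)
    (hgi₁ : g * gi = 1) (hgi₂ : gi * g = 1)
    (hggrouplike : Coalgebra.comul (R := ℂ) g = g ⊗ₜ[ℂ] g)
    (hgS₂ : ∀ x : H,
      HopfAlgebra.antipode (R := ℂ) (HopfAlgebra.antipode (R := ℂ) x) * g = g * x)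
    -- a left integral `μˡ`, the right integral `μʳ = μˡ ∘ S⁻¹`, and `μˡ(v^{±1}) ≠ 0`
    (μl μr : Module.Dual ℂ H) (hμl0 : μl ≠ 0)
    (hμl : ∀ x : H, (TensorProduct.rid ℂ H)
        ((LinearMap.lTensor H μl) (Coalgebra.comul (R := ℂ) x)) = μl x • (1 : H))
    (hμr : μr = μl ∘ₗ Sinv)
    (hμlv : μl v ≠ 0) (hμlvinv : μl vinv ≠ 0)
    -- the components of `R⁻¹ = Σᵢ a'ᵢ ⊗ b'ᵢ`
    {ι' : Type} [Fintype ι'] (aS bS : ι' → H)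
    (hRS₁ : (∑ i, aS i ⊗ₜ[ℂ] bS i) * (∑ i, aR i ⊗ₜ[ℂ] bR i) = 1)
    (hRS₂ : (∑ i, aR i ⊗ₜ[ℂ] bR i) * (∑ i, aS i ⊗ₜ[ℂ] bS i) = 1) :
    -- `S_LM` and `T_LM` map the center `Z(H)` into itself
    (∀ z : H, (∀ x : H, z * x = x * z) →
      ∀ x : H, SLM aS bS μl z * x = x * SLM aS bS μl z)
    ∧ (∀ z : H, (∀ x : H, z * x = x * z) → ∀ x : H, (vinv * z) * x = x * (vinv * z))
    -- `T_a` and `T_b` restrict to bijections of `SLF(H)`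
    ∧ Set.BijOn (Ta vinv) {φ : Module.Dual ℂ H | IsSLF φ} {φ : Module.Dual ℂ H | IsSLF φ}
    ∧ Set.BijOn (Tb μl v vinv gi)
        {φ : Module.Dual ℂ H | IsSLF φ} {φ : Module.Dual ℂ H | IsSLF φ}
    -- `f(z) = μʳ(g v⁻¹ S(z) ?)` is linear
    ∧ (∀ z w : H,
        μr ∘ₗ LinearMap.mulLeft ℂ
            (g * vinv * HopfAlgebra.antipode (R := ℂ) (z + w))
          = μr ∘ₗ LinearMap.mulLeft ℂ (g * vinv * HopfAlgebra.antipode (R := ℂ) z)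
            + μr ∘ₗ LinearMap.mulLeft ℂ (g * vinv * HopfAlgebra.antipode (R := ℂ) w))
    ∧ (∀ (c : ℂ) (z : H),
        μr ∘ₗ LinearMap.mulLeft ℂ (g * vinv * HopfAlgebra.antipode (R := ℂ) (c • z))
          = c • (μr ∘ₗ LinearMap.mulLeft ℂ (g * vinv * HopfAlgebra.antipode (R := ℂ) z)))
    -- and a bijection from `Z(H)` onto `SLF(H)`
    ∧ Set.BijOn
        (fun z : H => μr ∘ₗ LinearMap.mulLeft ℂ (g * vinv * HopfAlgebra.antipode (R := ℂ) z))
        {z : H | ∀ x : H, z * x = x * z} {φ : Module.Dual ℂ H | IsSLF φ}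
    -- intertwining: `f ∘ S_LM = μˡ(v⁻¹) • S' ∘ f` with `S' = ((T_a∘T_b∘T_a)|_SLF)⁻¹`,
    -- i.e. `(T_a∘T_b∘T_a)(f(S_LM z)) = μˡ(v⁻¹) • f(z)` on the center
    ∧ (∀ z : H, (∀ x : H, z * x = x * z) →
        (Ta vinv ∘ Tb μl v vinv gi ∘ Ta vinv)
            (μr ∘ₗ LinearMap.mulLeft ℂ
              (g * vinv * HopfAlgebra.antipode (R := ℂ) (SLM aS bS μl z)))
          = μl vinv •
              (μr ∘ₗ LinearMap.mulLeft ℂ (g * vinv * HopfAlgebra.antipode (R := ℂ) z)))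
    -- intertwining: `f ∘ T_LM = T' ∘ f` with `T' = T_a|_SLF`
    ∧ (∀ z : H, (∀ x : H, z * x = x * z) →
        (μr ∘ₗ LinearMap.mulLeft ℂ
            (g * vinv * HopfAlgebra.antipode (R := ℂ) (vinv * z)))
          = Ta vinv
              (μr ∘ₗ LinearMap.mulLeft ℂ (g * vinv * HopfAlgebra.antipode (R := ℂ) z))) := by
  have hT : IsLeftInt Sinv μl := ⟨⟨hSinv₁, hSinv₂⟩, hμl0, hμl⟩
  obtain ⟨Λ, hΛ⟩ := hT.exists_isIntPair
  have h : IsRibbonData Sinv μl Λ aR bR (∑ i, aS i ⊗ₜ[ℂ] bS i) v vinv g gi :=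
    { hΛ with
      mul_comul := hRΔ
      comul_left := hR₁
      comul_right := hR₂
      inv_mul := hRS₁
      mul_inv := hRS₂
      v_mul_t := hv₁
      t_mul_v := hv₂
      v_comm := hvcentral
      antipode_v := hSv
      comul_v := hΔv
      fact := hfact
      g_mul_gi := hgi₁
      gi_mul_g := hgi₂
      grouplike := hggrouplike
      antipode_antipode_mul := hgS₂
      drinfeld := by rw [hg, mul_assoc, hv₂, mul_one] }
  have hSLM : ∀ z : H, (∀ x : H, z * x = x * z) →
      SLM aS bS μl z = ribbonTransform μl v vinv z := fun z hz => by
    rw [SLM_eq_slice _ _ _ hz, h.slice_inv_mul_comm_inv, ribbonTransform,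
      h.t_comm (integralTransform _ _ _)]
  subst hμr
  refine ⟨fun z hz => ?_, fun z hz => mul_central h.t_comm hz, h.bijOn_Ta,
    h.bijOn_Tb hμlv hμlvinv, fun z w => ?_, fun c z => ?_, h.bijOn_right_integral_form,
    fun z hz => ?_, fun z hz => ?_⟩
  · rw [hSLM z hz]
    exact h.ribbonTransform_central hz
  · ext x
    simp [mul_add, add_mul, mul_assoc]
  · ext x
    simp [mul_assoc]
  · rw [hSLM z hz, h.right_integral_form, h.right_integral_form]
    simp only [Function.comp_apply]
    rw [Ta_smul, Tb_smul, Ta_smul, h.Ta_Tb_Ta_traceForm hμlv hμlvinv hz, smul_comm]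
  · rw [h.right_integral_form, h.right_integral_form, Ta_smul, h.Ta_traceForm,
      HopfAlgebra.antipode_mul_antidistrib, h.antipode_t, ← h.t_comm (HopfAlgebra.antipode ℂ z)]

end
end
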